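/- arXiv:2311.01397 — 2 statements merged into one kernel-verified Lean document; each statement's English description precedes it below -/
import Mathlib

section
/- Let E be a finite set. The set of functions { 1_{relint P(M)} : M a Schubert matroid on E }, where M ranges over all Schubert matroids on E (with respect to all linear orderings of E and all choices of the defining subset U), is linearly independent over ℤ, and its ℤ-linear span (inside the functions ℝ^E → ℤ) equals the ℤ-linear span of the set { 1_{relint P(M)} : M an arbitrary matroid on E }, where 1_{relint P(M)} denotes the indicator function of the relative interior of the base polytope of M. -/
open scoped Classical

namespace GPoly

/-- A step of a Delannoy path: east `+(1,0)`, north `+(0,1)` or diagonal `+(1,1)`. -/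
inductive DStep : Type
  | east : DStep
  | north : DStep
  | diag : DStep
  deriving DecidableEq

/-- Horizontal displacement of a step. -/
def DStep.dx : DStep → ℕ
  | .east => 1
  | .north => 0
  | .diag => 1

/-- Vertical displacement of a step. -/
def DStep.dy : DStep → ℕ
  | .east => 0
  | .north => 1
  | .diag => 1

/-- Position reached after the first `k` steps of `P`, starting at the point `s`. -/
def pathPos (s : ℕ × ℕ) (P : List DStep) (k : ℕ) : ℕ × ℕ :=
  (s.1 + ((P.take k).map DStep.dx).sum, s.2 + ((P.take k).map DStep.dy).sum)

/-- The Gale order: `U ≤ B` iff the increasing enumerations satisfy `u_ℓ ≤ b_ℓ`. -/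
def galeLe {α : Type*} [LinearOrder α] (U B : Finset α) : Prop :=
  List.Forall₂ (· ≤ ·) (U.sort (· ≤ ·)) (B.sort (· ≤ ·))

/-- Bases of the Schubert matroid `SM(U)` of rank `r` on `[n] = {1, …, n}`:
all `r`-subsets `B` of `[n]` with `U ≤ B` in the Gale order. -/
noncomputable def schubertBases (n r : ℕ) (U : Finset ℕ) : Finset (Finset ℕ) :=
  (Finset.Icc 1 n).powerset.filter fun B => B.card = r ∧ galeLe U B

/-- The point `p` lies weakly below the lattice path `path(U)`. -/
def belowPath (U : Finset ℕ) (p : ℕ × ℕ) : Prop :=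
  p.2 ≤ (U ∩ Finset.Icc 1 (p.1 + p.2)).card

/-- `path(U)` traverses the vertical unit segment from `(x, y)` to `(x, y+1)`
(by its north step number `x + y + 1`). -/
def uVertSeg (U : Finset ℕ) (x y : ℕ) : Prop :=
  x + y + 1 ∈ U ∧ (U ∩ Finset.Icc 1 (x + y + 1)).card = y + 1

/-- A Delannoy path associated to `SM(U)`: starts at `(1,1)`, ends at `(n-r, r)` and
stays weakly below `path(U)`. -/
def IsDelannoy (n r : ℕ) (U : Finset ℕ) (P : List DStep) : Prop :=
  pathPos (1, 1) P P.length = (n - r, r) ∧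
    ∀ k ≤ P.length, belowPath U (pathPos (1, 1) P k)

/-- Admissible Delannoy path associated to `SM(U)`. -/
def IsAdmissible (n r : ℕ) (U : Finset ℕ) (P : List DStep) : Prop :=
  IsDelannoy n r U P ∧
    ∀ (k : ℕ) (h : k < P.length),
      (P.get ⟨k, h⟩ = DStep.north →
        pathPos (1, 1) P (k + 1) = (n - r, r) ∨
          ¬ uVertSeg U (pathPos (1, 1) P k).1 (pathPos (1, 1) P k).2) ∧
      (P.get ⟨k, h⟩ = DStep.diag →
        belowPath U ((pathPos (1, 1) P k).1, (pathPos (1, 1) P k).2 + 1) ∧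
          ¬ uVertSeg U (pathPos (1, 1) P k).1 (pathPos (1, 1) P k).2)

/-- Number of diagonal steps of a path. -/
def diagCount (P : List DStep) : ℕ := (P.filter (· = DStep.diag)).length

/-- The set of indices (0-based) of the diagonal steps of `P`. -/
def diagIndices (P : List DStep) : Finset ℕ :=
  (Finset.range P.length).filter fun k => P.getD k DStep.east = DStep.diag

/-- Replace a diagonal step by a north step followed by an east step. -/
def expandNE : DStep → List DStep
  | DStep.diag => [DStep.north, DStep.east]
  | s => [s]

/-- Replace a diagonal step by an east step followed by a north step. -/
def expandEN : DStep → List DStep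
  | DStep.diag => [DStep.east, DStep.north]
  | s => [s]

/-- The full lattice path of `B_P`: an east step, a north step, then the steps of `P`
with each diagonal step replaced by a north step immediately followed by an east step. -/
def fullPath (P : List DStep) : List DStep :=
  DStep.east :: DStep.north :: (P.map expandNE).flatten

/-- The subset of `[n]` whose `path` is the given (diagonal-free) list of steps:
the set of (1-based) positions of the north steps. -/
def northSet (L : List DStep) : Finset ℕ :=
  ((Finset.range L.length).filter fun k => L.getD k DStep.east = DStep.north).image (· + 1)

/-- The basis `B_P` associated to a Delannoy path `P`. -/
def delannoyBasis (P : List DStep) : Finset ℕ := northSet (fullPath P)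

/-! ### Matroid notions for a family of bases -/

/-- `S` is independent for the basis family `ℬ`: it is contained in some basis. -/
def famIndep (ℬ : Finset (Finset ℕ)) (S : Finset ℕ) : Prop := ∃ B ∈ ℬ, S ⊆ B

/-- `C` is a circuit for the basis family `ℬ`: a minimal dependent set. -/
def famCircuit (ℬ : Finset (Finset ℕ)) (C : Finset ℕ) : Prop :=
  ¬ famIndep ℬ C ∧ ∀ C' ⊂ C, famIndep ℬ C'

/-- The dual basis family on the ground set `E`: complements of bases. -/
noncomputable def famDual (E : Finset ℕ) (ℬ : Finset (Finset ℕ)) : Finset (Finset ℕ) :=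
  ℬ.image fun B => E \ B

/-- `e ∉ B` is externally active: `e` is the smallest element of the unique circuit
contained in `B ∪ {e}`. -/
def ExtActive (E : Finset ℕ) (ℬ : Finset (Finset ℕ)) (B : Finset ℕ) (e : ℕ) : Prop :=
  e ∈ E ∧ e ∉ B ∧
    ∃ C, C ⊆ insert e B ∧ famCircuit ℬ C ∧ e ∈ C ∧ ∀ x ∈ C, e ≤ x

/-- `i ∈ B` is internally active: `i` is the smallest element of the unique cocircuit
contained in `(E ∖ B) ∪ {i}`. -/
def IntActive (E : Finset ℕ) (ℬ : Finset (Finset ℕ)) (B : Finset ℕ) (i : ℕ) : Prop :=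
  i ∈ B ∧
    ∃ C, C ⊆ insert i (E \ B) ∧ famCircuit (famDual E ℬ) C ∧ i ∈ C ∧ ∀ x ∈ C, i ≤ x

/-- External activity `e(B)`. -/
noncomputable def extAct (E : Finset ℕ) (ℬ : Finset (Finset ℕ)) (B : Finset ℕ) : ℕ :=
  (E.filter (ExtActive E ℬ B)).card

/-- Internal activity `i(B)`. -/
noncomputable def intAct (E : Finset ℕ) (ℬ : Finset (Finset ℕ)) (B : Finset ℕ) : ℕ :=
  (E.filter (IntActive E ℬ B)).card

/-- The statistic `α(B)`: the number of `i ∈ B` such that `B' = (B ∖ {i}) ∪ {i+1}`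
is a basis with `e(B') = e(B)` and `i(B') = i(B)`. -/
noncomputable def alphaStat (E : Finset ℕ) (ℬ : Finset (Finset ℕ)) (B : Finset ℕ) : ℕ :=
  (B.filter fun i =>
    insert (i + 1) (B.erase i) ∈ ℬ ∧
      extAct E ℬ (insert (i + 1) (B.erase i)) = extAct E ℬ B ∧
      intAct E ℬ (insert (i + 1) (B.erase i)) = intAct E ℬ B).card

/-- The rank function determined by a family of bases. -/
noncomputable def famRank (ℬ : Finset (Finset ℕ)) (A : Finset ℕ) : ℕ :=
  ℬ.sup fun B => (A ∩ B).card

/-- The β-invariant: `β(M) = (−1)^{rk(E)} Σ_{A ⊆ E} (−1)^{|A|} rk(A)`. -/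
noncomputable def betaInv (E : Finset ℕ) (ℬ : Finset (Finset ℕ)) : ℤ :=
  (-1) ^ famRank ℬ E * ∑ A ∈ E.powerset, (-1) ^ A.card * (famRank ℬ A : ℤ)

/-- `ℬ` is the collection of bases of a matroid with ground set `E`:
it is a nonempty family of subsets of `E` satisfying the basis exchange property. -/
def IsBasisFamily (E : Finset ℕ) (ℬ : Finset (Finset ℕ)) : Prop :=
  ℬ.Nonempty ∧ (∀ B ∈ ℬ, B ⊆ E) ∧
    ∀ B₁ ∈ ℬ, ∀ B₂ ∈ ℬ, ∀ x ∈ B₁ \ B₂, ∃ y ∈ B₂ \ B₁, insert y (B₁.erase x) ∈ ℬ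

/-- Two elements lie in a common component: they are equal or in a common circuit. -/
def connRel (ℬ : Finset (Finset ℕ)) (e f : ℕ) : Prop :=
  e = f ∨ ∃ C, famCircuit ℬ C ∧ e ∈ C ∧ f ∈ C

/-- The number of connected components of the matroid with bases `ℬ` on `E`. -/
noncomputable def numComponents (E : Finset ℕ) (ℬ : Finset (Finset ℕ)) : ℕ :=
  Set.ncard {S : Set ℕ | ∃ e ∈ E, S = {f | f ∈ E ∧ Relation.EqvGen (connRel ℬ) e f}}

/-- The matroid with bases `ℬ` on ground set `E` is connected. -/
def IsConnectedFam (E : Finset ℕ) (ℬ : Finset (Finset ℕ)) : Prop :=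
  E.Nonempty ∧ ∀ e ∈ E, ∀ f ∈ E, Relation.EqvGen (connRel ℬ) e f

/-- Series-parallel matroid: isomorphic to `U_{0,1}` or `U_{1,1}`
(a single loop or a single coloop), or connected with β-invariant `1`. -/
def IsSeriesParallel (E : Finset ℕ) (ℬ : Finset (Finset ℕ)) : Prop :=
  (E.card = 1 ∧ (ℬ = {∅} ∨ ℬ = {E})) ∨ (IsConnectedFam E ℬ ∧ betaInv E ℬ = 1)

/-- The bases of the restriction of the matroid with bases `ℬ` to the set `F`:
the maximal intersections of bases with `F`. -/
noncomputable def famRestrict (ℬ : Finset (Finset ℕ)) (F : Finset ℕ) : Finset (Finset ℕ) :=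
  (ℬ.image (· ∩ F)).filter fun S => ∀ T ∈ ℬ.image (· ∩ F), S ⊆ T → S = T

/-- The matroid with bases `ℬ` on `E` is a direct sum of series-parallel matroids. -/
def IsDirectSumOfSeriesParallel (E : Finset ℕ) (ℬ : Finset (Finset ℕ)) : Prop :=
  ∃ parts : Finset (Finset ℕ),
    (↑parts : Set (Finset ℕ)).PairwiseDisjoint id ∧
    parts.sup id = E ∧
    (∀ S ∈ parts, IsSeriesParallel S (famRestrict ℬ S)) ∧
    ℬ = E.powerset.filter fun B => ∀ S ∈ parts, B ∩ S ∈ famRestrict ℬ S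

/-! ### Base polytopes -/

/-- The indicator vector of `B ⊆ E`, as a point of `ℝ^E`. -/
noncomputable def basisVector (E : Finset ℕ) (B : Finset ℕ) : ↑E → ℝ :=
  fun e => if (e : ℕ) ∈ B then 1 else 0

/-- The base polytope of the matroid with bases `ℬ` on `E`:
the convex hull in `ℝ^E` of the indicator vectors of the bases. -/
noncomputable def basePolytope (E : Finset ℕ) (ℬ : Finset (Finset ℕ)) : Set (↑E → ℝ) :=
  convexHull ℝ (basisVector E '' (↑ℬ : Set (Finset ℕ)))

/-- The indicator function `ℝ^E → ℤ` of the base polytope. -/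
noncomputable def polyInd (E : Finset ℕ) (ℬ : Finset (Finset ℕ)) : (↑E → ℝ) → ℤ :=
  fun x => if x ∈ basePolytope E ℬ then 1 else 0

/-- The indicator function `ℝ^E → ℤ` of the relative interior of the base polytope. -/
noncomputable def relintInd (E : Finset ℕ) (ℬ : Finset (Finset ℕ)) : (↑E → ℝ) → ℤ :=
  fun x => if x ∈ intrinsicInterior ℝ (basePolytope E ℬ) then 1 else 0

/-! ### Cyclic flats and the cyclic chain lattice -/

/-- `F` is a flat of the matroid with bases `ℬ` on `E`. -/
def IsFlat (E : Finset ℕ) (ℬ : Finset (Finset ℕ)) (F : Finset ℕ) : Prop :=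
  F ⊆ E ∧ ∀ e ∈ E, famRank ℬ (insert e F) = famRank ℬ F → e ∈ F

/-- `F` is a cyclic flat: a flat whose restriction has no coloops. -/
def IsCyclicFlat (E : Finset ℕ) (ℬ : Finset (Finset ℕ)) (F : Finset ℕ) : Prop :=
  IsFlat E ℬ F ∧ ∀ e ∈ F, ¬ (∀ S ∈ famRestrict ℬ F, e ∈ S)

/-- The set of cyclic flats. -/
noncomputable def cyclicFlats (E : Finset ℕ) (ℬ : Finset (Finset ℕ)) : Finset (Finset ℕ) :=
  E.powerset.filter (IsCyclicFlat E ℬ)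

/-- A chain of cyclic flats containing the minimum and maximum of the lattice of
cyclic flats; these are the elements (other than the top `1̂`) of the cyclic
chain lattice. -/
def IsCyclicChain (E : Finset ℕ) (ℬ : Finset (Finset ℕ)) (C : Finset (Finset ℕ)) : Prop :=
  ↑C ⊆ (cyclicFlats E ℬ : Set (Finset ℕ)) ∧ IsChain (· ⊆ ·) (↑C : Set (Finset ℕ)) ∧
    (∃ F ∈ C, ∀ G ∈ cyclicFlats E ℬ, F ⊆ G) ∧
    (∃ F ∈ C, ∀ G ∈ cyclicFlats E ℬ, G ⊆ F)

/-- The set of chains of cyclic flats containing the minimum and the maximum. -/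
noncomputable def cyclicChains (E : Finset ℕ) (ℬ : Finset (Finset ℕ)) :
    Finset (Finset (Finset ℕ)) :=
  (cyclicFlats E ℬ).powerset.filter (IsCyclicChain E ℬ)

/-- The rank function `A ↦ min_{Z ∈ C} (rk_M(Z) + |A ∖ Z|)` associated to a chain `C`. -/
noncomputable def chainRank (ℬ : Finset (Finset ℕ)) (C : Finset (Finset ℕ))
    (A : Finset ℕ) : ℕ :=
  if h : C.Nonempty then C.inf' h fun Z => famRank ℬ Z + (A \ Z).card else A.card

/-- The bases of the matroid on `E` with rank function `rk`:
the subsets `B ⊆ E` with `rk B = |B| = rk E`. -/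
noncomputable def basesOfRank (E : Finset ℕ) (rk : Finset ℕ → ℕ) : Finset (Finset ℕ) :=
  E.powerset.filter fun B => rk B = B.card ∧ rk B = rk E

/-- The bases of the Schubert matroid `S_C` associated to a chain `C` of cyclic flats. -/
noncomputable def chainSchubert (E : Finset ℕ) (ℬ : Finset (Finset ℕ))
    (C : Finset (Finset ℕ)) : Finset (Finset ℕ) :=
  basesOfRank E (chainRank ℬ C)

/-- The point reached by `path(S)` after `k` steps. -/
def pathPoint (S : Finset ℕ) (k : ℕ) : ℕ × ℕ :=
  (k - (S ∩ Finset.Icc 1 k).card, (S ∩ Finset.Icc 1 k).card)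


/-- The indicator vector of `B ⊆ α`, as a point of `ℝ^α`. -/
noncomputable def basisVectorOn (α : Type) [Fintype α] [DecidableEq α] (B : Finset α) :
    α → ℝ :=
  fun a => if a ∈ B then 1 else 0

/-- The base polytope, in `ℝ^α`, of the matroid with bases `ℬ` on the ground set `α`. -/
noncomputable def basePolytopeOn (α : Type) [Fintype α] [DecidableEq α]
    (ℬ : Finset (Finset α)) : Set (α → ℝ) :=
  convexHull ℝ (basisVectorOn α '' (↑ℬ : Set (Finset α)))

/-- The indicator function `ℝ^α → ℤ` of the relative interior of the base polytope. -/
noncomputable def relintIndOn (α : Type) [Fintype α] [DecidableEq α]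
    (ℬ : Finset (Finset α)) : (α → ℝ) → ℤ :=
  fun x => if x ∈ intrinsicInterior ℝ (basePolytopeOn α ℬ) then 1 else 0

/-- `ℬ` is the family of bases of a Schubert matroid on `α`, for some linear ordering of
`α` and some choice of the defining subset `U`. -/
def IsSchubertFamilyOn (α : Type) [Fintype α] [DecidableEq α]
    (ℬ : Finset (Finset α)) : Prop :=
  ∃ (L : LinearOrder α) (U : Finset α),
    ℬ = Finset.univ.powerset.filter fun B => B.card = U.card ∧ @galeLe α L U B

/-- `ℬ` is the family of bases of a matroid on the ground set `α`. -/
def IsBasisFamilyOn (α : Type) [Fintype α] [DecidableEq α]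
    (ℬ : Finset (Finset α)) : Prop :=
  ℬ.Nonempty ∧
    ∀ B₁ ∈ ℬ, ∀ B₂ ∈ ℬ, ∀ x ∈ B₁ \ B₂, ∃ y ∈ B₂ \ B₁, insert y (B₁.erase x) ∈ ℬ

set_option linter.unusedSectionVars false


section MatroidPart
variable {α : Type} [Fintype α] [DecidableEq α]

lemma bf_card_le {ℬ : Finset (Finset α)} (h : IsBasisFamilyOn α ℬ) :
    ∀ (n : ℕ) (B₁ : Finset α) (B₂ : Finset α), B₁ ∈ ℬ → B₂ ∈ ℬ → (B₂ \ B₁).card = n →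
      B₂.card ≤ B₁.card := by
  intro n
  induction n with
  | zero =>
    intro B₁ B₂ _ _ h0
    rw [Finset.card_eq_zero, Finset.sdiff_eq_empty_iff_subset] at h0
    exact Finset.card_le_card h0
  | succ n ih =>
    intro B₁ B₂ h1 h2 hc
    obtain ⟨x, hx⟩ : (B₂ \ B₁).Nonempty := by
      rw [← Finset.card_pos]; omega
    obtain ⟨y, hy, hB⟩ := h.2 B₂ h2 B₁ h1 x hx
    rw [Finset.mem_sdiff] at hx hy
    have e1 : (insert y (B₂.erase x)).card = B₂.card := by
      rw [Finset.card_insert_of_notMem (by simp [hy.2]), Finset.card_erase_add_one hx.1]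
    have e2 : (insert y (B₂.erase x)) \ B₁ = (B₂ \ B₁).erase x := by
      ext z
      simp only [Finset.mem_sdiff, Finset.mem_insert, Finset.mem_erase]
      constructor
      · rintro ⟨rfl | hz, hz'⟩
        · exact absurd hy.1 hz'
        · exact ⟨hz.1, hz.2, hz'⟩
      · rintro ⟨a, b, c⟩
        exact ⟨Or.inr ⟨a, b⟩, c⟩
    have e3 := ih B₁ _ h1 hB (by
      rw [e2, Finset.card_erase_of_mem (by simp [hx]), hc]; rfl)
    omega

lemma bf_card_eq {ℬ : Finset (Finset α)} (h : IsBasisFamilyOn α ℬ) {B₁ B₂ : Finset α}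
    (h1 : B₁ ∈ ℬ) (h2 : B₂ ∈ ℬ) : B₁.card = B₂.card :=
  le_antisymm (bf_card_le h _ _ _ h2 h1 rfl) (bf_card_le h _ _ _ h1 h2 rfl)

/-- One augmentation step of the greedy algorithm. -/
lemma bf_augment {ℬ : Finset (Finset α)} (h : IsBasisFamilyOn α ℬ) (X : Finset α)
    {B : Finset α} (hB : B ∈ ℬ) :
    ∀ (n : ℕ) (B' : Finset α), B' ∈ ℬ → (B' \ B).card = n → (B ∩ X).card < (B' ∩ X).card →
      ∃ x y, x ∈ B ∧ x ∉ X ∧ y ∉ B ∧ y ∈ X ∧ insert y (B.erase x) ∈ ℬ := by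
  intro n
  induction n with
  | zero =>
    intro B' _ h0 hlt
    rw [Finset.card_eq_zero, Finset.sdiff_eq_empty_iff_subset] at h0
    have := Finset.card_le_card (Finset.inter_subset_inter_right h0 (u := X))
    omega
  | succ n ih =>
    intro B' hB' hc hlt
    by_cases hx : ∃ x, x ∈ B' \ B ∧ x ∉ X
    · obtain ⟨x, hx, hxX⟩ := hx
      obtain ⟨y, hy, hB2⟩ := h.2 B' hB' B hB x hx
      refine ih _ hB2 ?_ ?_
      · rw [Finset.mem_sdiff] at hx hy
        have e2 : (insert y (B'.erase x)) \ B = (B' \ B).erase x := by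
          ext z
          simp only [Finset.mem_sdiff, Finset.mem_insert, Finset.mem_erase]
          constructor
          · rintro ⟨rfl | hz, hz'⟩
            · exact absurd hy.1 hz'
            · exact ⟨hz.1, hz.2, hz'⟩
          · rintro ⟨a, b, c⟩
            exact ⟨Or.inr ⟨a, b⟩, c⟩
        rw [e2, Finset.card_erase_of_mem (by simp [hx]), hc]; rfl
      · refine lt_of_lt_of_le hlt (Finset.card_le_card ?_)
        intro z hz
        rw [Finset.mem_inter] at hz
        simp only [Finset.mem_inter, Finset.mem_insert, Finset.mem_erase]
        exact ⟨Or.inr ⟨fun e => hxX (e ▸ hz.2), hz.1⟩, hz.2⟩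
    · push Not at hx
      -- some element of B outside both sets
      have : ∃ x, x ∈ B \ B' ∧ x ∉ X := by
        by_contra hcon
        push Not at hcon
        have s1 : B' \ X ⊆ B \ X := by
          intro z hz
          rw [Finset.mem_sdiff] at hz ⊢
          refine ⟨?_, hz.2⟩
          by_contra hzB
          exact hz.2 (hx z (by simp [hz.1, hzB]))
        have s2 : B \ X ⊆ B' \ X := by
          intro z hz
          rw [Finset.mem_sdiff] at hz ⊢
          refine ⟨?_, hz.2⟩
          by_contra hzB
          exact hz.2 (hcon z (by simp [hz.1, hzB]))
        have s3 : B \ X = B' \ X := le_antisymm s2 s1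
        have c1 := Finset.card_inter_add_card_sdiff B X
        have c2 := Finset.card_inter_add_card_sdiff B' X
        have c3 := bf_card_eq h hB hB'
        rw [s3] at c1
        omega
      obtain ⟨x, hx1, hxX⟩ := this
      obtain ⟨y, hy, hB2⟩ := h.2 B hB B' hB' x hx1
      exact ⟨x, y, (Finset.mem_sdiff.1 hx1).1, hxX, (Finset.mem_sdiff.1 hy).2, hx y hy, hB2⟩

lemma bf_greedy {ℬ : Finset (Finset α)} (h : IsBasisFamilyOn α ℬ) (𝒳 : Finset (Finset α))
    (hc : ∀ X ∈ 𝒳, ∀ Y ∈ 𝒳, X ⊆ Y ∨ Y ⊆ X) :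
    ∃ B ∈ ℬ, ∀ X ∈ 𝒳, ∀ B' ∈ ℬ, (B' ∩ X).card ≤ (B ∩ X).card := by
  obtain ⟨B, hB, hmax⟩ := Finset.exists_max_image ℬ (fun B => ∑ X ∈ 𝒳, (B ∩ X).card) h.1
  refine ⟨B, hB, ?_⟩
  intro X hX B' hB'
  by_contra hlt
  push Not at hlt
  obtain ⟨x, y, hxB, hxX, hyB, hyX, hB2⟩ := bf_augment h X hB _ B' hB' rfl hlt
  have key : ∀ Y : Finset α, ((insert y (B.erase x)) ∩ Y).card + (if x ∈ Y then 1 else 0) =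
      (B ∩ Y).card + (if y ∈ Y then 1 else 0) := by
    intro Y
    have hyn : y ∉ B.erase x := by simp [hyB]
    have e1 : ((B.erase x) ∩ Y).card + (if x ∈ Y then 1 else 0) = (B ∩ Y).card := by
      rw [Finset.erase_inter]
      split_ifs with hxY
      · exact Finset.card_erase_add_one (by simp [hxB, hxY])
      · rw [Finset.erase_eq_of_notMem (by simp [hxY])]; rfl
    have e2 : ((insert y (B.erase x)) ∩ Y).card =
        ((B.erase x) ∩ Y).card + (if y ∈ Y then 1 else 0) := by
      split_ifs with hyY
      · rw [Finset.insert_inter_of_mem hyY, Finset.card_insert_of_notMem (by simp [hyB])]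
      · rw [Finset.insert_inter_of_notMem hyY]; rfl
    omega
  have hlt2 : ∑ Y ∈ 𝒳, (B ∩ Y).card < ∑ Y ∈ 𝒳, ((insert y (B.erase x)) ∩ Y).card := by
    refine Finset.sum_lt_sum ?_ ⟨X, hX, ?_⟩
    · intro Y hY
      have k := key Y
      by_cases hxY : x ∈ Y
      · have : y ∈ Y := by
          rcases hc X hX Y hY with h1 | h1
          · exact h1 hyX
          · exact absurd (h1 hxY) hxX
        simp only [hxY, this, if_true] at k
        omega
      · simp only [hxY, if_false] at k
        omega
    · have k := key X
      simp only [hxX, hyX, if_true, if_false] at k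
      omega
  exact absurd (hmax _ hB2) (not_le.2 hlt2)

/-- Rank function of a family of bases. -/
def rk (ℬ : Finset (Finset α)) (X : Finset α) : ℕ := ℬ.sup fun B => (B ∩ X).card

lemma le_rk {ℬ : Finset (Finset α)} {B : Finset α} (hB : B ∈ ℬ) (X : Finset α) :
    (B ∩ X).card ≤ rk ℬ X := Finset.le_sup (f := fun B => (B ∩ X).card) hB

lemma rk_le {ℬ : Finset (Finset α)} {X : Finset α} {n : ℕ}
    (h : ∀ B ∈ ℬ, (B ∩ X).card ≤ n) : rk ℬ X ≤ n := Finset.sup_le h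

lemma rk_greedy {ℬ : Finset (Finset α)} (h : IsBasisFamilyOn α ℬ) (𝒳 : Finset (Finset α))
    (hc : ∀ X ∈ 𝒳, ∀ Y ∈ 𝒳, X ⊆ Y ∨ Y ⊆ X) :
    ∃ B ∈ ℬ, ∀ X ∈ 𝒳, (B ∩ X).card = rk ℬ X := by
  obtain ⟨B, hB, hm⟩ := bf_greedy h 𝒳 hc
  exact ⟨B, hB, fun X hX => le_antisymm (le_rk hB X) (rk_le (hm X hX))⟩

lemma rk_submod {ℬ : Finset (Finset α)} (h : IsBasisFamilyOn α ℬ) (X Y : Finset α) :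
    rk ℬ (X ∪ Y) + rk ℬ (X ∩ Y) ≤ rk ℬ X + rk ℬ Y := by
  obtain ⟨B, hB, hm⟩ := rk_greedy h {X ∩ Y, X ∪ Y} (by
    have : X ∩ Y ⊆ X ∪ Y := fun z hz => by
      rw [Finset.mem_inter] at hz; exact Finset.mem_union_left _ hz.1
    intro A hA A' hA'
    simp only [Finset.mem_insert, Finset.mem_singleton] at hA hA'
    rcases hA with rfl | rfl <;> rcases hA' with rfl | rfl <;> simp [this])
  rw [← hm (X ∪ Y) (by simp), ← hm (X ∩ Y) (by simp)]
  have h1 := le_rk hB X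
  have h2 := le_rk hB Y
  have h3 := Finset.card_union_add_card_inter (B ∩ X) (B ∩ Y)
  rw [← Finset.inter_union_distrib_left, ← Finset.inter_inter_distrib_left] at h3
  omega

lemma rk_univ {ℬ : Finset (Finset α)} (h : IsBasisFamilyOn α ℬ) {B : Finset α} (hB : B ∈ ℬ) :
    rk ℬ Finset.univ = B.card := by
  refine le_antisymm (rk_le fun B' hB' => ?_) ?_
  · rw [Finset.inter_univ, bf_card_eq h hB' hB]
  · simpa using le_rk hB Finset.univ

end MatroidPart



section GeometryPart
variable {α : Type} [Fintype α] [DecidableEq α]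

/-- Sum of the coordinates in `X`, as a linear functional. -/
noncomputable def sumL (X : Finset α) : (α → ℝ) →ₗ[ℝ] ℝ := ∑ a ∈ X, LinearMap.proj a

lemma sumL_apply (X : Finset α) (x : α → ℝ) : sumL X x = ∑ a ∈ X, x a := by
  simp [sumL, LinearMap.sum_apply]

lemma sum_basisVectorOn (B X : Finset α) :
    ∑ a ∈ X, basisVectorOn α B a = ((B ∩ X).card : ℝ) := by
  unfold basisVectorOn
  rw [Finset.sum_ite_mem, Finset.sum_const, Finset.inter_comm]
  simp

/-- Affine subspace given by linear equations. -/
def eqSub {κ : Type} (m : κ → ((α → ℝ) →ₗ[ℝ] ℝ)) (c : κ → ℝ) : AffineSubspace ℝ (α → ℝ) where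
  carrier := {x | ∀ k, m k x = c k}
  smul_vsub_vadd_mem' := by
    intro t p q r hp hq hr k
    simp only [vsub_eq_sub, vadd_eq_add, map_add, map_smul, map_sub]
    rw [hp k, hq k, hr k]
    simp

lemma relint_eq {κ ι : Type} [Finite ι] (m : κ → ((α → ℝ) →ₗ[ℝ] ℝ)) (c : κ → ℝ)
    (l : ι → ((α → ℝ) →ₗ[ℝ] ℝ)) (b : ι → ℝ) (P : Set (α → ℝ))
    (hP : P = {x | (∀ k, m k x = c k) ∧ ∀ i, l i x ≤ b i})
    (p : α → ℝ) (hp : (∀ k, m k p = c k) ∧ ∀ i, l i p < b i) :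
    intrinsicInterior ℝ P = {x | (∀ k, m k x = c k) ∧ ∀ i, l i x < b i} := by
  have hPm : ∀ x, x ∈ P ↔ ((∀ k, m k x = c k) ∧ ∀ i, l i x ≤ b i) := by
    intro x; rw [hP]; rfl
  have hpP : p ∈ P := by rw [hP]; exact ⟨hp.1, fun i => (hp.2 i).le⟩
  have hspan : affineSpan ℝ P ≤ eqSub m c := by
    rw [affineSpan_le]
    intro x hx
    rw [hP] at hx
    exact hx.1
  ext x
  constructor
  · intro hx
    have hxP := intrinsicInterior_subset hx
    rw [mem_intrinsicInterior] at hx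
    obtain ⟨y, hy, rfl⟩ := hx
    have hxP' := (hPm _).1 hxP
    refine ⟨hxP'.1, fun i => lt_of_le_of_ne (hxP'.2 i) fun heq => ?_⟩
    let f : ℝ → affineSpan ℝ P := fun t =>
      ⟨AffineMap.lineMap p (y : α → ℝ) t,
        AffineMap.lineMap_mem t (subset_affineSpan ℝ P hpP) y.2⟩
    have hf : Continuous f := by
      refine Continuous.subtype_mk ?_ _
      exact AffineMap.lineMap_continuous
    have hf1 : f 1 = y := by
      apply Subtype.ext
      simp [f]
    have hnhds : ∀ᶠ t in nhds (1 : ℝ), f t ∈ interior ((↑) ⁻¹' P : Set (affineSpan ℝ P)) := by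
      apply hf.continuousAt.eventually_mem
      rw [hf1]
      exact isOpen_interior.mem_nhds hy
    have h2 : ∃ t : ℝ, 1 < t ∧ f t ∈ interior ((↑) ⁻¹' P : Set (affineSpan ℝ P)) := by
      have h3 := (hnhds.filter_mono (nhdsWithin_le_nhds (s := Set.Ioi (1 : ℝ)))).and
        self_mem_nhdsWithin
      obtain ⟨t, ht⟩ := h3.exists
      exact ⟨t, ht.2, ht.1⟩
    obtain ⟨t, ht, hft⟩ := h2
    have h4' : f t ∈ ((↑) ⁻¹' P : Set (affineSpan ℝ P)) := interior_subset hft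
    have h4 : (f t : α → ℝ) ∈ P := h4'
    have h5 := ((hPm _).1 h4).2 i
    have h6 : l i (f t : α → ℝ) = l i p + t * (l i (y : α → ℝ) - l i p) := by
      simp only [f, AffineMap.lineMap_apply, vsub_eq_sub, vadd_eq_add, map_add, map_smul, map_sub,
        smul_eq_mul]
      ring
    rw [h6, heq] at h5
    nlinarith [hp.2 i]
  · intro hx
    have hxP : x ∈ P := by rw [hP]; exact ⟨hx.1, fun i => (hx.2 i).le⟩
    rw [mem_intrinsicInterior]
    refine ⟨⟨x, subset_affineSpan ℝ P hxP⟩, ?_, rfl⟩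
    rw [mem_interior]
    refine ⟨{y | ∀ i, l i (y : α → ℝ) < b i}, ?_, ?_, hx.2⟩
    · intro y hy
      have hy2 : (y : α → ℝ) ∈ eqSub m c := hspan y.2
      show (y : α → ℝ) ∈ P
      rw [hPm]
      exact ⟨hy2, fun i => (hy i).le⟩
    · rw [Set.ofPred_forall]
      refine isOpen_iInter_of_finite fun i => ?_
      refine isOpen_lt ?_ continuous_const
      exact (LinearMap.continuous_of_finiteDimensional (l i)).comp continuous_subtype_val

/-- Layer cake inequality. -/
lemma layer_cake (d : α → ℝ) : ∀ (n : ℕ) (s : Finset α) (h : α → ℝ), s.card = n →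
    (∀ a ∈ s, 0 ≤ h a) → (∀ t, ∑ a ∈ s with t ≤ h a, d a ≤ 0) → ∑ a ∈ s, h a * d a ≤ 0 := by
  intro n
  induction n using Nat.strong_induction_on with
  | _ n ih =>
    intro s h hn hpos hlev
    rcases s.eq_empty_or_nonempty with rfl | hne
    · simp
    obtain ⟨a0, ha0, hmin⟩ := Finset.exists_min_image s h hne
    set m := h a0 with hm
    have hlt : (s.filter fun a => m < h a).card < n := by
      rw [← hn]
      refine Finset.card_lt_card (Finset.filter_ssubset.2 ⟨a0, ha0, by simp [hm]⟩)
    have h1 := ih _ hlt (s.filter fun a => m < h a) (fun a => h a - m) rfl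
      (fun a ha => by
        rw [Finset.mem_filter] at ha
        linarith [ha.2]) (by
      intro t
      rcases le_or_gt t 0 with ht | ht
      · have e : (s.filter fun a => m < h a).filter (fun a => t ≤ h a - m) =
          s.filter fun a => m < h a := by
          apply Finset.filter_true_of_mem
          intro a ha
          rw [Finset.mem_filter] at ha
          linarith [ha.2]
        rw [e]
        rcases (s.filter fun a => m < h a).eq_empty_or_nonempty with he | hne2
        · rw [he]; simp
        · obtain ⟨a1, ha1, hmin1⟩ := Finset.exists_min_image _ h hne2
          have := hlev (h a1)
          convert this using 2
          ext a
          simp only [Finset.mem_filter]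
          rw [Finset.mem_filter] at ha1
          constructor
          · intro ha
            exact ⟨ha.1, hmin1 a (by simp [ha.1, ha.2])⟩
          · intro ha
            exact ⟨ha.1, lt_of_lt_of_le ha1.2 ha.2⟩
      · have := hlev (t + m)
        convert this using 2
        ext a
        simp only [Finset.mem_filter]
        constructor
        · rintro ⟨⟨h1, h2⟩, h3⟩
          exact ⟨h1, by linarith⟩
        · rintro ⟨h1, h2⟩
          exact ⟨⟨h1, by linarith⟩, by linarith⟩)
    have h2 : ∑ a ∈ s, d a ≤ 0 := by
      have := hlev m
      rwa [Finset.filter_true_of_mem (fun a ha => hmin a ha)] at this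
    have h3 : ∑ a ∈ s, h a * d a = m * ∑ a ∈ s, d a + ∑ a ∈ s, (h a - m) * d a := by
      rw [Finset.mul_sum, ← Finset.sum_add_distrib]
      apply Finset.sum_congr rfl
      intro a _
      ring
    have h4 : ∑ a ∈ s, (h a - m) * d a = ∑ a ∈ s with m < h a, (h a - m) * d a := by
      rw [Finset.sum_filter]
      apply Finset.sum_congr rfl
      intro a ha
      split_ifs with hlt
      · rfl
      · have : h a = m := le_antisymm (not_lt.1 hlt) (hmin a ha)
        rw [this]; ring
    have h5 : m * ∑ a ∈ s, d a ≤ 0 := mul_nonpos_of_nonneg_of_nonpos (hpos a0 ha0) h2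
    rw [h3, h4]
    linarith

lemma isClosed_base (ℬ : Finset (Finset α)) : IsClosed (basePolytopeOn α ℬ) :=
  (((Finset.finite_toSet ℬ).image _).isCompact_convexHull (𝕜 := ℝ)).isClosed

lemma vertex_mem {ℬ : Finset (Finset α)} {B : Finset α} (hB : B ∈ ℬ) :
    basisVectorOn α B ∈ basePolytopeOn α ℬ :=
  subset_convexHull ℝ _ ⟨B, hB, rfl⟩

lemma convex_le (X : Finset α) (k : ℝ) : Convex ℝ {x : α → ℝ | ∑ a ∈ X, x a ≤ k} := by
  have := convex_halfSpace_le (𝕜 := ℝ) (sumL X).isLinear k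
  simpa only [sumL_apply] using this

lemma convex_ge (X : Finset α) (k : ℝ) : Convex ℝ {x : α → ℝ | k ≤ ∑ a ∈ X, x a} := by
  have := convex_halfSpace_ge (𝕜 := ℝ) (sumL X).isLinear k
  simpa only [sumL_apply] using this

/-- If a linear sum bound holds at all vertices, it holds on the polytope. -/
lemma base_le {ℬ : Finset (Finset α)} {X : Finset α} {k : ℝ}
    (h : ∀ B ∈ ℬ, ((B ∩ X).card : ℝ) ≤ k) {x : α → ℝ} (hx : x ∈ basePolytopeOn α ℬ) :
    ∑ a ∈ X, x a ≤ k := by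
  refine convexHull_min ?_ (convex_le X k) hx
  rintro _ ⟨B, hB, rfl⟩
  show ∑ a ∈ X, basisVectorOn α B a ≤ k
  rw [sum_basisVectorOn]
  exact h B hB

lemma base_ge {ℬ : Finset (Finset α)} {X : Finset α} {k : ℝ}
    (h : ∀ B ∈ ℬ, k ≤ ((B ∩ X).card : ℝ)) {x : α → ℝ} (hx : x ∈ basePolytopeOn α ℬ) :
    k ≤ ∑ a ∈ X, x a := by
  refine convexHull_min ?_ (convex_ge X k) hx
  rintro _ ⟨B, hB, rfl⟩
  show k ≤ ∑ a ∈ X, basisVectorOn α B a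
  rw [sum_basisVectorOn]
  exact h B hB

/-- Edmonds' description of the base polytope. -/
lemma edmonds {ℬ : Finset (Finset α)} (h : IsBasisFamilyOn α ℬ) (x : α → ℝ) :
    x ∈ basePolytopeOn α ℬ ↔ (∀ X : Finset α, ∑ a ∈ X, x a ≤ rk ℬ X) ∧
      ∑ a, x a = rk ℬ Finset.univ := by
  obtain ⟨B0, hB0⟩ := h.1
  constructor
  · intro hx
    refine ⟨fun X => base_le (fun B hB => by exact_mod_cast le_rk hB X) hx, ?_⟩
    refine le_antisymm (base_le (fun B hB => by exact_mod_cast le_rk hB _) hx)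
      (base_ge (fun B hB => ?_) hx)
    rw [rk_univ h hB, Finset.inter_univ]
  · rintro ⟨hle, heq⟩
    by_contra hx
    obtain ⟨f, u, hfu, hux⟩ := geometric_hahn_banach_closed_point (convex_convexHull ℝ _)
      (isClosed_base ℬ) hx
    have hf : ∀ y : α → ℝ, f y = ∑ a, f (Pi.single a 1) * y a := by
      intro y
      conv_lhs => rw [← Finset.univ_sum_single y]
      rw [map_sum]
      apply Finset.sum_congr rfl
      intro a _
      have : (Pi.single a (y a) : α → ℝ) = (y a) • (Pi.single a 1 : α → ℝ) := by
        rw [← Pi.single_smul]; simp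
      rw [this, map_smul, smul_eq_mul, mul_comm]
    set w : α → ℝ := fun a => f (Pi.single a 1) with hw
    obtain ⟨B, hB, hm⟩ := rk_greedy h (Finset.univ.filter fun X : Finset α =>
      ∃ t, X = Finset.univ.filter fun a => t ≤ w a) (by
        intro X hX Y hY
        rw [Finset.mem_filter] at hX hY
        obtain ⟨-, s, rfl⟩ := hX
        obtain ⟨-, t, rfl⟩ := hY
        rcases le_total s t with hst | hst
        · right
          intro a ha
          simp only [Finset.mem_filter, Finset.mem_univ, true_and] at ha ⊢
          linarith
        · left
          intro a ha
          simp only [Finset.mem_filter, Finset.mem_univ, true_and] at ha ⊢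
          linarith)
    have hBu := hfu _ (vertex_mem hB)
    obtain ⟨C, hC⟩ : ∃ C : ℝ, ∀ a, C ≤ w a := by
      obtain ⟨C, hC⟩ := (Set.finite_range w).bddBelow
      exact ⟨C, fun a => hC ⟨a, rfl⟩⟩
    have hd0 : ∑ a, (x a - basisVectorOn α B a) = 0 := by
      rw [Finset.sum_sub_distrib, heq, sum_basisVectorOn, rk_univ h hB]
      simp
    have hlc := layer_cake (fun a => x a - basisVectorOn α B a) _ Finset.univ (fun a => w a - C) rfl
      (fun a _ => by linarith [hC a]) (by
        intro t
        rw [Finset.sum_sub_distrib, sum_basisVectorOn, hm]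
        · linarith [hle (Finset.univ.filter fun a => t ≤ w a - C)]
        · simp only [Finset.mem_filter, Finset.mem_univ, true_and]
          refine ⟨t + C, ?_⟩
          ext a
          simp only [Finset.mem_filter, Finset.mem_univ, true_and]
          constructor <;> intro h <;> linarith)
    have e1 : ∑ a, (w a - C) * (x a - basisVectorOn α B a) =
        f x - f (basisVectorOn α B) - C * ∑ a, (x a - basisVectorOn α B a) := by
      rw [hf x, hf (basisVectorOn α B), ← Finset.sum_sub_distrib, Finset.mul_sum,
        ← Finset.sum_sub_distrib]
      apply Finset.sum_congr rfl
      intro a _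
      ring
    rw [e1, hd0] at hlc
    linarith

end GeometryPart



section NestedPart
variable {α : Type} [Fintype α] [DecidableEq α]

/-- A chain of sets with upper bounds. -/
def NChain (𝒞 : Finset (Finset α × ℤ)) : Prop := ∀ p ∈ 𝒞, ∀ q ∈ 𝒞, p.1 ⊆ q.1 ∨ q.1 ⊆ p.1

/-- Bases of a nested matroid described by a chain with bounds. -/
noncomputable def nestB (𝒞 : Finset (Finset α × ℤ)) (r : ℕ) : Finset (Finset α) :=
  Finset.univ.filter fun B => B.card = r ∧ ∀ p ∈ 𝒞, ((B ∩ p.1).card : ℤ) ≤ p.2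

lemma mem_nestB {𝒞 : Finset (Finset α × ℤ)} {r : ℕ} {B : Finset α} :
    B ∈ nestB 𝒞 r ↔ B.card = r ∧ ∀ p ∈ 𝒞, ((B ∩ p.1).card : ℤ) ≤ p.2 := by
  simp [nestB]

lemma card_exchange {B Y : Finset α} {x y : α} (hx : x ∈ B) (hy : y ∉ B) :
    ((insert y (B.erase x)) ∩ Y).card + (if x ∈ Y then 1 else 0) =
      (B ∩ Y).card + (if y ∈ Y then 1 else 0) := by
  have e1 : ((B.erase x) ∩ Y).card + (if x ∈ Y then 1 else 0) = (B ∩ Y).card := by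
    rw [Finset.erase_inter]
    split_ifs with hxY
    · exact Finset.card_erase_add_one (by simp [hx, hxY])
    · rw [Finset.erase_eq_of_notMem (by simp [hxY])]; rfl
  have e2 : ((insert y (B.erase x)) ∩ Y).card =
      ((B.erase x) ∩ Y).card + (if y ∈ Y then 1 else 0) := by
    split_ifs with hyY
    · rw [Finset.insert_inter_of_mem hyY, Finset.card_insert_of_notMem (by simp [hy])]
    · rw [Finset.insert_inter_of_notMem hyY]; rfl
  omega

/-- Exchange preserving all constraints. -/
lemma nest_exchange {𝒞 : Finset (Finset α × ℤ)} {r : ℕ} {B : Finset α} (hB : B ∈ nestB 𝒞 r)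
    {x y : α} (hx : x ∈ B) (hy : y ∉ B)
    (h : ∀ p ∈ 𝒞, x ∉ p.1 → y ∈ p.1 → ((B ∩ p.1).card : ℤ) < p.2) :
    insert y (B.erase x) ∈ nestB 𝒞 r := by
  rw [mem_nestB] at hB ⊢
  constructor
  · have := card_exchange (Y := Finset.univ) hx hy
    simp only [Finset.mem_univ, if_true, Finset.inter_univ] at this
    omega
  · intro p hp
    have h1 := card_exchange (Y := p.1) hx hy
    have h2 := hB.2 p hp
    have h3 := h p hp
    by_cases hxp : x ∈ p.1 <;> by_cases hyp : y ∈ p.1 <;> simp only [hxp, hyp, if_true, if_false] at h1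
    · omega
    · omega
    · have := h3 hxp hyp
      omega
    · omega

lemma nest_bf {𝒞 : Finset (Finset α × ℤ)} (hc : NChain 𝒞) {r : ℕ} (hne : (nestB 𝒞 r).Nonempty) :
    IsBasisFamilyOn α (nestB 𝒞 r) := by
  refine ⟨hne, ?_⟩
  intro B₁ h1 B₂ h2 x hx
  rw [Finset.mem_sdiff] at hx
  -- the set of tight constraints avoiding x
  set 𝒯 := 𝒞.filter fun p => x ∉ p.1 ∧ ((B₁ ∩ p.1).card : ℤ) = p.2 with h𝒯
  have hex : ∃ X : Finset α, x ∉ X ∧ (∀ p ∈ 𝒯, p.1 ⊆ X) ∧ (B₂ ∩ X).card ≤ (B₁ ∩ X).card := by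
    rcases 𝒯.eq_empty_or_nonempty with he | hne'
    · exact ⟨∅, by simp, by simp [he], by simp⟩
    · obtain ⟨q, hq, hmax⟩ := Finset.exists_max_image 𝒯 (fun p => p.1.card) hne'
      have hq' := hq
      rw [h𝒯, Finset.mem_filter] at hq'
      refine ⟨q.1, hq'.2.1, ?_, ?_⟩
      · intro p hp
        have hp' := hp
        rw [h𝒯, Finset.mem_filter] at hp'
        rcases hc p hp'.1 q hq'.1 with h | h
        · exact h
        · exact (Finset.eq_of_subset_of_card_le h (hmax p hp)).symm.subset
      · have := (mem_nestB.1 h2).2 q hq'.1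
        have := hq'.2.2
        omega
  obtain ⟨X, hxX, hTX, hcard⟩ := hex
  have hy : ∃ y, y ∈ B₂ \ B₁ ∧ y ∉ X := by
    by_contra hcon
    push Not at hcon
    have hs : B₂ \ X ⊆ (B₁ \ X).erase x := by
      intro z hz
      rw [Finset.mem_sdiff] at hz
      rw [Finset.mem_erase, Finset.mem_sdiff]
      refine ⟨fun e => hx.2 (e ▸ hz.1), ?_, hz.2⟩
      by_contra hzB
      exact hz.2 (hcon z (by simp [hz.1, hzB]))
    have c0 := Finset.card_le_card hs
    have hxm : x ∈ B₁ \ X := by simp [hx.1, hxX]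
    have c3 := Finset.card_erase_add_one hxm
    have c1 := Finset.card_inter_add_card_sdiff B₁ X
    have c2 := Finset.card_inter_add_card_sdiff B₂ X
    have := (mem_nestB.1 h1).1
    have := (mem_nestB.1 h2).1
    omega
  obtain ⟨y, hy, hyX⟩ := hy
  refine ⟨y, hy, nest_exchange h1 hx.1 (Finset.mem_sdiff.1 hy).2 ?_⟩
  intro p hp hxp hyp
  refine lt_of_le_of_ne ((mem_nestB.1 h1).2 p hp) fun he => hyX ?_
  exact hTX p (by rw [h𝒯, Finset.mem_filter]; exact ⟨hp, hxp, he⟩) hyp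

lemma forall₂_iff_countP {β : Type} [LinearOrder β] : ∀ (l₁ l₂ : List β), l₁.length = l₂.length →
    l₁.Pairwise (· ≤ ·) → l₂.Pairwise (· ≤ ·) →
    (List.Forall₂ (· ≤ ·) l₁ l₂ ↔
      ∀ a, l₂.countP (fun z => decide (z ≤ a)) ≤ l₁.countP (fun z => decide (z ≤ a))) := by
  intro l₁
  induction l₁ with
  | nil =>
    intro l₂ hl _ _
    have : l₂ = [] := by
      rw [← List.length_eq_zero_iff]; simpa using hl.symm
    subst this
    simp
  | cons x t₁ ih =>
    intro l₂ hl s1 s2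
    cases l₂ with
    | nil => simp at hl
    | cons y t₂ =>
      rw [List.pairwise_cons] at s1 s2
      have hl' : t₁.length = t₂.length := by simpa using hl
      rw [List.forall₂_cons, ih t₂ hl' s1.2 s2.2]
      simp only [List.countP_cons]
      constructor
      · rintro ⟨hxy, h⟩ a
        have := h a
        by_cases hya : y ≤ a
        · simp only [hya, le_trans hxy hya, decide_true, if_true]; omega
        · simp only [hya, decide_false]
          simp only [Bool.false_eq_true, if_false]
          omega
      · intro h
        have hxy : x ≤ y := by
          by_contra hlt
          have h1 := h y
          have h0 : t₁.countP (fun z => decide (z ≤ y)) = 0 := by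
            rw [List.countP_eq_zero]
            intro z hz
            have := s1.1 z hz
            simp only [decide_eq_true_eq, not_le]
            exact lt_of_lt_of_le (not_le.1 hlt) this
          simp [h0, hlt] at h1
        refine ⟨hxy, fun a => ?_⟩
        have h1 := h a
        by_cases hya : y ≤ a
        · simp only [hya, le_trans hxy hya, decide_true, if_true] at h1; omega
        · have h0 : t₂.countP (fun z => decide (z ≤ a)) = 0 := by
            rw [List.countP_eq_zero]
            intro z hz
            have := s2.1 z hz
            simp only [decide_eq_true_eq, not_le]
            exact lt_of_lt_of_le (not_le.1 hya) this
          omega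

lemma gale_iff {β : Type} [LinearOrder β] (U B : Finset β) (h : B.card = U.card) :
    galeLe U B ↔ ∀ a, (B.filter (· ≤ a)).card ≤ (U.filter (· ≤ a)).card := by
  have key : ∀ (V : Finset β) (a : β),
      (V.sort (· ≤ ·)).countP (fun z => decide (z ≤ a)) = (V.filter (· ≤ a)).card := by
    intro V a
    rw [← Multiset.coe_countP (p := fun z => z ≤ a), Finset.sort_eq, Multiset.countP_eq_card_filter]
    rfl
  unfold galeLe
  rw [forall₂_iff_countP _ _ (by simp [h]) (Finset.pairwise_sort _ _) (Finset.pairwise_sort _ _)]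
  simp only [key]

lemma schubert_nest {ℬ : Finset (Finset α)} (h : IsSchubertFamilyOn α ℬ) :
    ∃ 𝒞 r, NChain 𝒞 ∧ (nestB 𝒞 r).Nonempty ∧ ℬ = nestB 𝒞 r := by
  obtain ⟨L, U, rfl⟩ := h
  set 𝒞 : Finset (Finset α × ℤ) := Finset.univ.image fun a : α =>
    ((Finset.univ.filter fun z => z ≤ a), ((U.filter fun z => z ≤ a).card : ℤ)) with h𝒞
  have hmem : ∀ B : Finset α, B ∈ nestB 𝒞 U.card ↔ B.card = U.card ∧
      ∀ a, (B.filter (· ≤ a)).card ≤ (U.filter (· ≤ a)).card := by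
    intro B
    rw [mem_nestB]
    refine and_congr_right fun _ => ?_
    simp only [h𝒞, Finset.mem_image, Finset.mem_univ, true_and, forall_exists_index,
      forall_apply_eq_imp_iff, Nat.cast_le]
    refine forall_congr' fun a => ?_
    have : B ∩ (Finset.univ.filter fun z => z ≤ a) = B.filter fun z => z ≤ a := by
      ext z; simp
    rw [this]
  refine ⟨𝒞, U.card, ?_, ⟨U, (hmem U).2 ⟨rfl, fun a => le_rfl⟩⟩, ?_⟩
  · intro p hp q hq
    simp only [h𝒞, Finset.mem_image, Finset.mem_univ, true_and] at hp hq
    obtain ⟨a, rfl⟩ := hp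
    obtain ⟨b, rfl⟩ := hq
    rcases le_total a b with hab | hab
    · left; intro z hz
      simp only [Finset.mem_filter, Finset.mem_univ, true_and] at hz ⊢
      exact le_trans hz hab
    · right; intro z hz
      simp only [Finset.mem_filter, Finset.mem_univ, true_and] at hz ⊢
      exact le_trans hz hab
  · ext B
    rw [hmem]
    simp only [Finset.powerset_univ, Finset.mem_filter, Finset.mem_univ, true_and]
    exact and_congr_right fun hB => gale_iff U B hB

lemma nest_schubert {𝒞 : Finset (Finset α × ℤ)} (hc : NChain 𝒞) {r : ℕ}
    (hne : (nestB 𝒞 r).Nonempty) : IsSchubertFamilyOn α (nestB 𝒞 r) := by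
  -- a linear order for which the sets of the chain are initial segments
  let f : α → ℕ := fun a => (𝒞.filter fun p => a ∉ p.1).card
  let g : α → ℕ ×ₗ Fin (Fintype.card α) := fun a => toLex (f a, Fintype.equivFin α a)
  have hg : Function.Injective g := by
    intro a b hab
    have := congrArg (fun z => (ofLex z).2) hab
    simpa [g] using this
  let L : LinearOrder α := LinearOrder.lift' g hg
  have hL : ∀ a b : α, L.le a b ↔ g a ≤ g b := fun a b => Iff.rfl
  have hlow : ∀ p ∈ 𝒞, ∀ a ∈ p.1, ∀ b, L.le b a → b ∈ p.1 := by
    intro p hp a ha b hba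
    by_contra hb
    have hlt : f a < f b := by
      apply Finset.card_lt_card
      rw [Finset.ssubset_iff_of_subset]
      · exact ⟨p, by simp [hp, hb], by simp [ha]⟩
      · intro q hq
        rw [Finset.mem_filter] at hq ⊢
        refine ⟨hq.1, fun hbq => ?_⟩
        rcases hc p hp q hq.1 with h | h
        · exact hq.2 (h ha)
        · exact hb (h hbq)
    rw [hL, Prod.Lex.le_iff] at hba
    simp only [g, ofLex_toLex] at hba
    omega
  obtain ⟨U, hU, hUm⟩ := bf_greedy (nest_bf hc hne)
    (Finset.univ.image fun a : α => Finset.univ.filter fun z => L.le z a) (by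
      intro X hX Y hY
      simp only [Finset.mem_image, Finset.mem_univ, true_and] at hX hY
      obtain ⟨a, rfl⟩ := hX
      obtain ⟨b, rfl⟩ := hY
      rcases L.le_total a b with hab | hab
      · left; intro z hz
        simp only [Finset.mem_filter, Finset.mem_univ, true_and] at hz ⊢
        exact L.le_trans _ _ _ hz hab
      · right; intro z hz
        simp only [Finset.mem_filter, Finset.mem_univ, true_and] at hz ⊢
        exact L.le_trans _ _ _ hz hab)
  have h_int : ∀ (B : Finset α) (a : α), B ∩ (Finset.univ.filter fun z => L.le z a) =
      B.filter fun z => L.le z a := by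
    intro B a; ext z; simp
  refine ⟨L, U, ?_⟩
  ext B
  simp only [Finset.powerset_univ, Finset.mem_filter, Finset.mem_univ, true_and]
  have hUr := (mem_nestB.1 hU).1
  constructor
  · intro hB
    have hcard : B.card = U.card := by rw [(mem_nestB.1 hB).1, hUr]
    refine ⟨hcard, (gale_iff U B hcard).2 fun a => ?_⟩
    have := hUm _ (Finset.mem_image.2 ⟨a, Finset.mem_univ _, rfl⟩) B hB
    rw [h_int, h_int] at this
    convert this using 2
  · rintro ⟨hcard, hgale⟩
    rw [gale_iff U B hcard] at hgale
    rw [mem_nestB]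
    refine ⟨by rw [hcard, hUr], ?_⟩
    intro p hp
    refine le_trans ?_ ((mem_nestB.1 hU).2 p hp)
    rcases p.1.eq_empty_or_nonempty with he | hne'
    · simp [he]
    · obtain ⟨m, hm, hmax⟩ := Finset.exists_max_image p.1 g hne'
      have hpm : p.1 = Finset.univ.filter fun z => L.le z m := by
        ext z
        simp only [Finset.mem_filter, Finset.mem_univ, true_and]
        exact ⟨fun hz => (hL _ _).2 (hmax z hz), fun hz => hlow p hp m hm z hz⟩
      rw [hpm, h_int, h_int]
      have := hgale m
      norm_cast

end NestedPart



section NestPoly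
variable {α : Type} [Fintype α] [DecidableEq α]

lemma exists_pos_le {ι : Type} (s : Finset ι) (f : ι → ℝ) (h : ∀ i ∈ s, 0 < f i) :
    ∃ t : ℝ, 0 < t ∧ ∀ i ∈ s, t ≤ f i := by
  induction s using Finset.induction_on with
  | empty => exact ⟨1, one_pos, by simp⟩
  | insert a s ha ih =>
    obtain ⟨t, ht, h1⟩ := ih fun i hi => h i (Finset.mem_insert_of_mem hi)
    refine ⟨min t (f a), lt_min ht (h a (Finset.mem_insert_self _ _)), ?_⟩
    intro i hi
    rcases Finset.mem_insert.1 hi with rfl | hi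
    · exact min_le_right _ _
    · exact (min_le_left _ _).trans (h1 i hi)

/-- The polytope cut out by the inequalities of a nested matroid. -/
def nestP (𝒞 : Finset (Finset α × ℤ)) (r : ℕ) : Set (α → ℝ) :=
  {x | (∀ a, 0 ≤ x a ∧ x a ≤ 1) ∧ ∑ a, x a = r ∧ ∀ p ∈ 𝒞, ∑ a ∈ p.1, x a ≤ (p.2 : ℝ)}

lemma int_sum (x : α → ℝ) (X : Finset α) (h : ∀ a ∈ X, x a = 0 ∨ x a = 1) :
    ∃ k : ℤ, ∑ a ∈ X, x a = k := by
  refine ⟨∑ a ∈ X, if x a = 1 then 1 else 0, ?_⟩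
  push_cast
  refine Finset.sum_congr rfl fun a ha => ?_
  rcases h a ha with h | h <;> simp [h]

lemma nonint_sum (x : α → ℝ) (X : Finset α) (e : α) (he : e ∈ X) (h0 : 0 < x e) (h1 : x e < 1)
    (h : ∀ a ∈ X, a ≠ e → x a = 0 ∨ x a = 1) (k : ℤ) : ∑ a ∈ X, x a ≠ k := by
  intro hk
  obtain ⟨m, hm⟩ := int_sum x (X.erase e) fun a ha =>
    h a (Finset.mem_of_mem_erase ha) (Finset.ne_of_mem_erase ha)
  rw [← Finset.add_sum_erase X x he, hm] at hk
  have h2 : (0 : ℝ) < ((k - m : ℤ) : ℝ) := by push_cast; linarith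
  have h3 : ((k - m : ℤ) : ℝ) < (1 : ℤ) := by push_cast; linarith
  have h2' : 0 < k - m := by exact_mod_cast h2
  have h3' : k - m < 1 := by exact_mod_cast h3
  omega

lemma nestP_perturb {𝒞 : Finset (Finset α × ℤ)} {r : ℕ} {x : α → ℝ} (hx : x ∈ nestP 𝒞 r)
    {e₁ e₂ : α} (hne : e₁ ≠ e₂) (h1 : 0 < x e₁ ∧ x e₁ < 1) (h2 : 0 < x e₂ ∧ x e₂ < 1)
    (hs : ∀ p ∈ 𝒞, ¬ (e₁ ∈ p.1 ↔ e₂ ∈ p.1) → ∑ a ∈ p.1, x a < (p.2 : ℝ)) :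
    x ∉ Set.extremePoints ℝ (nestP 𝒞 r) := by
  intro hext
  obtain ⟨t₀, ht₀, h₀⟩ := exists_pos_le (𝒞.filter fun p => ¬ (e₁ ∈ p.1 ↔ e₂ ∈ p.1))
    (fun p => (p.2 : ℝ) - ∑ a ∈ p.1, x a) (by
      intro p hp
      rw [Finset.mem_filter] at hp
      have := hs p hp.1 hp.2
      linarith)
  obtain ⟨t, ht, t0, t1, t2, t3, t4⟩ : ∃ t : ℝ, 0 < t ∧ t ≤ t₀ ∧ t ≤ x e₁ ∧ t ≤ 1 - x e₁ ∧
      t ≤ x e₂ ∧ t ≤ 1 - x e₂ := by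
    refine ⟨min t₀ (min (min (x e₁) (1 - x e₁)) (min (x e₂) (1 - x e₂))), ?_, ?_, ?_, ?_, ?_, ?_⟩
    · refine lt_min ht₀ (lt_min (lt_min h1.1 (by linarith)) (lt_min h2.1 (by linarith)))
    all_goals simp
  set v : α → ℝ := fun a => (if a = e₁ then 1 else 0) - (if a = e₂ then 1 else 0) with hv
  have key : ∀ s : ℝ, |s| ≤ t → x + s • v ∈ nestP 𝒞 r := by
    intro s hst
    obtain ⟨hs1, hs2⟩ := abs_le.1 hst
    have hsum : ∀ X : Finset α, ∑ a ∈ X, (x + s • v) a =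
        ∑ a ∈ X, x a + s * ((if e₁ ∈ X then 1 else 0) - (if e₂ ∈ X then 1 else 0)) := by
      intro X
      simp only [Pi.add_apply, Pi.smul_apply, smul_eq_mul, hv, Finset.sum_add_distrib,
        ← Finset.mul_sum, Finset.sum_sub_distrib, Finset.sum_ite_eq']
    refine ⟨?_, ?_, ?_⟩
    · intro a
      simp only [Pi.add_apply, Pi.smul_apply, smul_eq_mul, hv]
      by_cases ha1 : a = e₁
      · subst ha1; simp only [if_true, if_neg hne]; constructor <;> linarith
      · by_cases ha2 : a = e₂
        · subst ha2; simp only [if_true, if_neg ha1]; constructor <;> linarith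
        · simp only [if_neg ha1, if_neg ha2]; simpa using hx.1 a
    · rw [hsum]; simp [hx.2.1]
    · intro p hp
      rw [hsum]
      by_cases hsep : (e₁ ∈ p.1 ↔ e₂ ∈ p.1)
      · simp only [hsep, sub_self, mul_zero, add_zero]; exact hx.2.2 p hp
      · have := h₀ p (by simp only [Finset.mem_filter]; exact ⟨hp, hsep⟩)
        by_cases q1 : e₁ ∈ p.1 <;> by_cases q2 : e₂ ∈ p.1 <;> simp [q1, q2] at hsep ⊢ <;> linarith
  have := (mem_extremePoints.1 hext).2 _ (key t (by rw [abs_of_pos ht]))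
    _ (key (-t) (by rw [abs_neg, abs_of_pos ht]))
    ⟨1/2, 1/2, by norm_num, by norm_num, by norm_num, by
      ext a; simp only [Pi.add_apply, Pi.smul_apply, smul_eq_mul]; ring⟩
  have h3 := congrFun this.1 e₁
  simp [hv, hne] at h3
  exact ht.ne' h3

lemma nestP_extreme {𝒞 : Finset (Finset α × ℤ)} {r : ℕ} (hc : NChain 𝒞) {x : α → ℝ}
    (hext : x ∈ Set.extremePoints ℝ (nestP 𝒞 r)) : ∃ B ∈ nestB 𝒞 r, basisVectorOn α B = x := by
  have hx := hext.1
  by_cases hFr : ∀ a, x a = 0 ∨ x a = 1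
  · have hB : basisVectorOn α (Finset.univ.filter fun a => x a = 1) = x := by
      ext a
      rcases hFr a with h | h <;> simp [basisVectorOn, h]
    refine ⟨_, ?_, hB⟩
    rw [mem_nestB]
    have hs := fun X => sum_basisVectorOn (Finset.univ.filter fun a => x a = 1) X
    rw [hB] at hs
    constructor
    · have := hs Finset.univ
      rw [hx.2.1, Finset.inter_univ] at this
      exact_mod_cast this.symm
    · intro p hp
      have := hx.2.2 p hp
      rw [hs p.1] at this
      exact_mod_cast this
  · exfalso
    push Not at hFr
    obtain ⟨e, he0, he1⟩ := hFr
    have hfr : ∀ a, ¬ (x a = 0 ∨ x a = 1) → 0 < x a ∧ x a < 1 := by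
      intro a ha
      push Not at ha
      exact ⟨lt_of_le_of_ne (hx.1 a).1 (Ne.symm ha.1), lt_of_le_of_ne (hx.1 a).2 ha.2⟩
    set Fr : Finset α := Finset.univ.filter fun a => ¬ (x a = 0 ∨ x a = 1) with hFrdef
    have memFr : ∀ a, a ∈ Fr ↔ ¬ (x a = 0 ∨ x a = 1) := by intro a; simp [hFrdef]
    have hone : ∀ X : Finset α, (X ∩ Fr).card = 1 → ∀ k : ℤ, ∑ a ∈ X, x a ≠ k := by
      intro X hX k
      obtain ⟨e, he⟩ := Finset.card_eq_one.1 hX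
      have hee : e ∈ X ∩ Fr := by rw [he]; simp
      rw [Finset.mem_inter, memFr] at hee
      refine nonint_sum x X e hee.1 (hfr e hee.2).1 (hfr e hee.2).2 ?_ k
      intro a ha hne
      by_contra hcon
      have : a ∈ X ∩ Fr := by rw [Finset.mem_inter, memFr]; exact ⟨ha, hcon⟩
      rw [he, Finset.mem_singleton] at this
      exact hne this
    have huniv : 2 ≤ (Finset.univ ∩ Fr).card := by
      have h1 : (Finset.univ ∩ Fr).card ≠ 1 := fun h =>
        hone _ h r (by rw [hx.2.1]; simp)
      have h0 : 0 < (Finset.univ ∩ Fr).card := Finset.card_pos.2 ⟨e, by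
        rw [Finset.mem_inter, memFr]; exact ⟨Finset.mem_univ _, by push Not; exact ⟨he0, he1⟩⟩⟩
      omega
    obtain ⟨X, hX, hmin⟩ := Finset.exists_min_image
      ((insert Finset.univ (𝒞.image Prod.fst)).filter fun X => 2 ≤ (X ∩ Fr).card) Finset.card
      ⟨Finset.univ, by rw [Finset.mem_filter]; exact ⟨by simp, huniv⟩⟩
    rw [Finset.mem_filter] at hX
    obtain ⟨e₁, h1, e₂, h2, hne⟩ := Finset.one_lt_card.1 hX.2
    rw [Finset.mem_inter, memFr] at h1 h2
    refine nestP_perturb hx hne (hfr _ h1.2) (hfr _ h2.2) ?_ hext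
    intro p hp hsep
    have hle := hx.2.2 p hp
    refine lt_of_le_of_ne hle ?_
    refine hone p.1 ?_ p.2
    have hpos : 0 < (p.1 ∩ Fr).card := by
      rw [Finset.card_pos]
      by_cases q1 : e₁ ∈ p.1
      · exact ⟨e₁, by rw [Finset.mem_inter, memFr]; exact ⟨q1, h1.2⟩⟩
      · exact ⟨e₂, by rw [Finset.mem_inter, memFr]; exact ⟨by tauto, h2.2⟩⟩
    by_contra hcon
    have hcard := hmin p.1 (by
      rw [Finset.mem_filter]
      exact ⟨Finset.mem_insert_of_mem (Finset.mem_image_of_mem _ hp), by omega⟩)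
    have hcomp : X ⊆ p.1 ∨ p.1 ⊆ X := by
      rcases Finset.mem_insert.1 hX.1 with h | h
      · right; rw [h]; exact Finset.subset_univ _
      · obtain ⟨q, hq, rfl⟩ := Finset.mem_image.1 h
        exact hc q hq p hp
    have hsub : X ⊆ p.1 := by
      rcases hcomp with h | h
      · exact h
      · rw [Finset.eq_of_subset_of_card_le h hcard]
    exact hsep ⟨fun _ => hsub h2.1, fun _ => hsub h1.1⟩

lemma nestP_convex (𝒞 : Finset (Finset α × ℤ)) (r : ℕ) : Convex ℝ (nestP 𝒞 r) := by
  intro x hx y hy a b ha hb hab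
  have hsum : ∀ X : Finset α, ∑ i ∈ X, (a • x + b • y) i =
      a * ∑ i ∈ X, x i + b * ∑ i ∈ X, y i := by
    intro X
    simp [Finset.sum_add_distrib, Finset.mul_sum]
  refine ⟨fun i => ?_, ?_, fun p hp => ?_⟩
  · have h1 := hx.1 i
    have h2 := hy.1 i
    simp only [Pi.add_apply, Pi.smul_apply, smul_eq_mul]
    constructor <;> nlinarith
  · rw [hsum, hx.2.1, hy.2.1, ← add_mul, hab, one_mul]
  · rw [hsum]
    have h1 := hx.2.2 p hp
    have h2 := hy.2.2 p hp
    have h3 : (p.2 : ℝ) = a * p.2 + b * p.2 := by rw [← add_mul, hab, one_mul]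
    rw [h3]
    exact add_le_add (mul_le_mul_of_nonneg_left h1 ha) (mul_le_mul_of_nonneg_left h2 hb)

lemma nestP_compact (𝒞 : Finset (Finset α × ℤ)) (r : ℕ) : IsCompact (nestP 𝒞 r) := by
  have hcl : IsClosed (nestP 𝒞 r) := by
    simp only [nestP, Set.ofPred_and, Set.ofPred_forall]
    refine IsClosed.inter ?_ (IsClosed.inter ?_ ?_)
    · refine isClosed_iInter fun a => IsClosed.inter ?_ ?_
      · exact isClosed_le (by fun_prop) (by fun_prop)
      · exact isClosed_le (by fun_prop) (by fun_prop)
    · exact isClosed_eq (by fun_prop) (by fun_prop)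
    · exact isClosed_iInter fun p => isClosed_iInter fun hp => isClosed_le (by fun_prop) (by fun_prop)
  refine (isCompact_Icc (a := (0 : α → ℝ)) (b := 1)).of_isClosed_subset hcl ?_
  intro x hx
  exact ⟨fun a => (hx.1 a).1, fun a => (hx.1 a).2⟩

lemma nest_poly {𝒞 : Finset (Finset α × ℤ)} {r : ℕ} (hc : NChain 𝒞) :
    basePolytopeOn α (nestB 𝒞 r) = nestP 𝒞 r := by
  apply Set.Subset.antisymm
  · refine convexHull_min ?_ (nestP_convex 𝒞 r)
    rintro _ ⟨B, hB, rfl⟩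
    rw [Finset.mem_coe, mem_nestB] at hB
    refine ⟨fun a => ?_, ?_, fun p hp => ?_⟩
    · by_cases h : a ∈ B <;> simp [basisVectorOn, h]
    · rw [sum_basisVectorOn, Finset.inter_univ, hB.1]
    · rw [sum_basisVectorOn]
      exact_mod_cast hB.2 p hp
  · rw [← closure_convexHull_extremePoints (nestP_compact 𝒞 r) (nestP_convex 𝒞 r)]
    refine closure_minimal ?_ (isClosed_base _)
    refine convexHull_mono ?_
    intro x hx
    obtain ⟨B, hB, rfl⟩ := nestP_extreme hc hx
    exact ⟨B, hB, rfl⟩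

end NestPoly



section SchOpen
variable {α : Type} [Fintype α] [DecidableEq α]

/-- The relatively open cell with prescribed loops and coloops. -/
def Qset (L K : Finset α) (r : ℕ) : Set (α → ℝ) :=
  {x | ∑ a, x a = r ∧ (∀ a ∈ L, x a = 0) ∧ (∀ a ∈ K, x a = 1) ∧
    ∀ a, a ∉ L → a ∉ K → 0 < x a ∧ x a < 1}

/-- The closed version of `Qset` with additional weak inequalities. -/
def Cset (L K : Finset α) (r : ℕ) (T : Finset (Finset α × ℤ)) : Set (α → ℝ) :=
  {x | ∑ a, x a = r ∧ (∀ a ∈ L, x a = 0) ∧ (∀ a ∈ K, x a = 1) ∧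
    (∀ a, a ∉ L → a ∉ K → 0 ≤ x a ∧ x a ≤ 1) ∧ ∀ p ∈ T, ∑ a ∈ p.1, x a ≤ (p.2 : ℝ)}

/-- `Qset` with additional strict inequalities. -/
def Oset (L K : Finset α) (r : ℕ) (T : Finset (Finset α × ℤ)) : Set (α → ℝ) :=
  {x | x ∈ Qset L K r ∧ ∀ p ∈ T, ∑ a ∈ p.1, x a < (p.2 : ℝ)}

lemma relint_Cset (L K : Finset α) (r : ℕ) (T : Finset (Finset α × ℤ)) (p : α → ℝ)
    (hp : p ∈ Oset L K r T) : intrinsicInterior ℝ (Cset L K r T) = Oset L K r T := by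
  have := relint_eq (κ := Unit ⊕ ↥L ⊕ ↥K)
    (ι := {a : α // a ∉ L ∧ a ∉ K} ⊕ {a : α // a ∉ L ∧ a ∉ K} ⊕ ↥T)
    (Sum.elim (fun _ => sumL Finset.univ) (Sum.elim (fun a => sumL {a.1}) (fun a => sumL {a.1})))
    (Sum.elim (fun _ => (r : ℝ)) (Sum.elim (fun _ => 0) (fun _ => 1)))
    (Sum.elim (fun a => - sumL {a.1}) (Sum.elim (fun a => sumL {a.1}) (fun q => sumL q.1.1)))
    (Sum.elim (fun _ => (0 : ℝ)) (Sum.elim (fun _ => 1) (fun q => (q.1.2 : ℝ))))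
    (Cset L K r T) ?_ p ?_
  · rw [this]
    ext x
    simp only [Sum.forall, Sum.elim_inl, Sum.elim_inr, sumL_apply, LinearMap.neg_apply,
      Finset.sum_singleton, Subtype.forall, Oset, Qset, Set.mem_setOf_eq, forall_const, neg_lt_zero]
    constructor
    · rintro ⟨⟨h1, h2, h3⟩, h4, h5, h6⟩
      exact ⟨⟨h1, h2, h3, fun a h h' => ⟨h4 a ⟨h, h'⟩, h5 a ⟨h, h'⟩⟩⟩, h6⟩
    · rintro ⟨⟨h1, h2, h3, h4⟩, h6⟩
      exact ⟨⟨h1, h2, h3⟩, fun a h => (h4 a h.1 h.2).1, fun a h => (h4 a h.1 h.2).2, h6⟩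
  · ext x
    simp only [Sum.forall, Sum.elim_inl, Sum.elim_inr, sumL_apply, LinearMap.neg_apply,
      Finset.sum_singleton, Subtype.forall, Cset, Set.mem_setOf_eq, forall_const, neg_nonpos]
    constructor
    · rintro ⟨h1, h2, h3, h4, h6⟩
      exact ⟨⟨h1, h2, h3⟩, fun a h => (h4 a h.1 h.2).1, fun a h => (h4 a h.1 h.2).2, h6⟩
    · rintro ⟨⟨h1, h2, h3⟩, h4, h5, h6⟩
      exact ⟨h1, h2, h3, fun a h h' => ⟨h4 a ⟨h, h'⟩, h5 a ⟨h, h'⟩⟩, h6⟩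
  · obtain ⟨⟨h1, h2, h3, h4⟩, h6⟩ := hp
    simp only [Sum.forall, Sum.elim_inl, Sum.elim_inr, sumL_apply, LinearMap.neg_apply,
      Finset.sum_singleton, Subtype.forall, forall_const, neg_lt_zero]
    exact ⟨⟨h1, h2, h3⟩, fun a h => (h4 a h.1 h.2).1, fun a h => (h4 a h.1 h.2).2, h6⟩

lemma sch_open (L K : Finset α) (r : ℕ) (T : Finset (Finset α × ℤ))
    (hLK : Disjoint L K) (hT : NChain T) (hTL : ∀ p ∈ T, Disjoint p.1 L)
    (hTK : ∀ p ∈ T, Disjoint p.1 K) (p : α → ℝ) (hp : p ∈ Oset L K r T) :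
    ∃ ℬ, IsSchubertFamilyOn α ℬ ∧ intrinsicInterior ℝ (basePolytopeOn α ℬ) = Oset L K r T := by
  set 𝒞 : Finset (Finset α × ℤ) :=
    insert (L, 0) (insert (Kᶜ, (r : ℤ) - K.card) (T.image fun q => (L ∪ q.1, q.2))) with h𝒞
  have hLKc : L ⊆ Kᶜ := by
    intro a ha
    rw [Finset.mem_compl]
    exact Finset.disjoint_left.1 hLK ha
  have hTKc : ∀ q ∈ T, L ∪ q.1 ⊆ Kᶜ := by
    intro q hq
    refine Finset.union_subset hLKc ?_
    intro a ha
    rw [Finset.mem_compl]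
    exact Finset.disjoint_left.1 (hTK q hq) ha
  have hc : NChain 𝒞 := by
    intro q hq q' hq'
    simp only [h𝒞, Finset.mem_insert, Finset.mem_image] at hq hq'
    rcases hq with rfl | rfl | ⟨u, hu, rfl⟩ <;> rcases hq' with rfl | rfl | ⟨u', hu', rfl⟩
    · left; exact subset_rfl
    · left; exact hLKc
    · left; exact Finset.subset_union_left
    · right; exact hLKc
    · left; exact subset_rfl
    · right; exact hTKc _ hu'
    · right; exact Finset.subset_union_left
    · left; exact hTKc _ hu
    · rcases hT u hu u' hu' with h | h
      · left; exact Finset.union_subset_union_right h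
      · right; exact Finset.union_subset_union_right h
  have hsumK : ∀ x : α → ℝ, ∑ a ∈ K, x a + ∑ a ∈ Kᶜ, x a = ∑ a, x a := fun x =>
    Finset.sum_add_sum_compl K x
  have hsumT : ∀ x : α → ℝ, (∀ a ∈ L, x a = 0) → ∀ q ∈ T, ∑ a ∈ L ∪ q.1, x a = ∑ a ∈ q.1, x a := by
    intro x hx q hq
    rw [Finset.sum_union (hTL q hq).symm, Finset.sum_eq_zero hx, zero_add]
  have hP : nestP 𝒞 r = Cset L K r T := by
    ext x
    constructor
    · rintro ⟨h1, h2, h3⟩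
      have hL : ∀ a ∈ L, x a = 0 := by
        have := h3 (L, 0) (by simp [h𝒞])
        have h4 : ∑ a ∈ L, x a = 0 :=
          le_antisymm (by simpa using this) (Finset.sum_nonneg fun a _ => (h1 a).1)
        exact (Finset.sum_eq_zero_iff_of_nonneg fun a _ => (h1 a).1).1 h4
      have hK : ∀ a ∈ K, x a = 1 := by
        have h3' := h3 (Kᶜ, (r : ℤ) - K.card) (by simp [h𝒞])
        simp only [Int.cast_sub, Int.cast_natCast] at h3'
        have h4 := hsumK x
        rw [h2] at h4
        have h5 : ∑ a ∈ K, (1 - x a) = 0 := by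
          refine le_antisymm ?_ (Finset.sum_nonneg fun a _ => by linarith [(h1 a).2])
          rw [Finset.sum_sub_distrib]
          simp only [Finset.sum_const, nsmul_eq_mul, mul_one]
          linarith
        intro a ha
        have := (Finset.sum_eq_zero_iff_of_nonneg fun a _ => by linarith [(h1 a).2]).1 h5 a ha
        linarith
      refine ⟨h2, hL, hK, fun a _ _ => h1 a, fun q hq => ?_⟩
      rw [← hsumT x hL q hq]
      exact h3 (L ∪ q.1, q.2) (by
        simp only [h𝒞, Finset.mem_insert, Finset.mem_image]
        exact Or.inr (Or.inr ⟨q, hq, rfl⟩))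
    · rintro ⟨h2, hL, hK, h1, h3⟩
      refine ⟨fun a => ?_, h2, fun q hq => ?_⟩
      · by_cases ha : a ∈ L
        · simp [hL a ha]
        · by_cases ha' : a ∈ K
          · simp [hK a ha']
          · exact h1 a ha ha'
      · simp only [h𝒞, Finset.mem_insert, Finset.mem_image] at hq
        rcases hq with rfl | rfl | ⟨u, hu, rfl⟩
        · simp [Finset.sum_eq_zero hL]
        · have h4 := hsumK x
          rw [h2, Finset.sum_congr rfl hK] at h4
          simp only [Finset.sum_const, nsmul_eq_mul, mul_one] at h4
          simp only [Int.cast_sub, Int.cast_natCast]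
          linarith
        · simp only [hsumT x hL u hu]
          exact h3 u hu
  have hpC : p ∈ Cset L K r T := by
    obtain ⟨⟨h1, h2, h3, h4⟩, h6⟩ := hp
    exact ⟨h1, h2, h3, fun a h h' => ⟨(h4 a h h').1.le, (h4 a h h').2.le⟩, fun q hq => (h6 q hq).le⟩
  have hne : (nestB 𝒞 r).Nonempty := by
    by_contra hcon
    rw [Finset.not_nonempty_iff_eq_empty] at hcon
    have := nest_poly (r := r) hc
    rw [hcon, hP] at this
    rw [← this] at hpC
    simp [basePolytopeOn] at hpC
  refine ⟨nestB 𝒞 r, nest_schubert hc hne, ?_⟩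
  rw [nest_poly hc, hP, relint_Cset L K r T p hp]

end SchOpen



section Mobius
variable {α : Type} [Fintype α] [DecidableEq α]

/-- Möbius-type recursion over a family of sets. -/
noncomputable def mob (𝓛 : Finset α → Prop) (Y : Finset α) : ℤ :=
  if Y = ∅ then 1 else - ∑ Z ∈ Y.ssubsets.attach, if 𝓛 Z.1 then mob 𝓛 Z.1 else 0
termination_by Y.card
decreasing_by exact Finset.card_lt_card (Finset.mem_ssubsets.1 Z.2)

lemma mob_empty (𝓛 : Finset α → Prop) : mob 𝓛 ∅ = 1 := by
  rw [mob]; simp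

lemma mob_eq (𝓛 : Finset α → Prop) (Y : Finset α) (hY : Y ≠ ∅) :
    mob 𝓛 Y = - ∑ Z ∈ Y.ssubsets, if 𝓛 Z then mob 𝓛 Z else 0 := by
  rw [mob, if_neg hY, Finset.sum_attach Y.ssubsets (fun Z => if 𝓛 Z then mob 𝓛 Z else 0)]

lemma mob_sum (𝓛 : Finset α → Prop) (T : Finset α) (hT : T ≠ ∅) (h : 𝓛 T) :
    ∑ Z ∈ T.powerset.filter 𝓛, mob 𝓛 Z = 0 := by
  rw [Finset.sum_filter]
  have h1 := mob_eq 𝓛 T hT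
  have h2 : T ∈ T.powerset := by simp
  rw [← Finset.add_sum_erase _ _ h2, if_pos h]
  have h3 : T.powerset.erase T = T.ssubsets := rfl
  rw [h3, h1]
  ring

lemma weisner (𝓛 : Finset α → Prop) (A : Finset α) (hA : A ≠ ∅)
    (hcl : ∀ X, 𝓛 X → 𝓛 (X ∪ A)) (T : Finset α) (hT : 𝓛 T) (hAT : A ⊆ T) :
    ∑ X ∈ T.powerset.filter (fun X => 𝓛 X ∧ X ∪ A = T), mob 𝓛 X = 0 := by
  induction T using Finset.strongInduction with
  | H T ih =>
    have hne : T ≠ ∅ := by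
      rintro rfl
      exact hA (Finset.subset_empty.1 hAT)
    have h0 := mob_sum 𝓛 T hne hT
    have hmap : ∀ X ∈ T.powerset.filter 𝓛, X ∪ A ∈ T.powerset := by
      intro X hX
      rw [Finset.mem_filter, Finset.mem_powerset] at hX
      rw [Finset.mem_powerset]
      exact Finset.union_subset hX.1 hAT
    rw [← Finset.sum_fiberwise_of_maps_to hmap] at h0
    rw [Finset.sum_eq_single T] at h0
    · rw [← h0]
      refine Finset.sum_congr ?_ fun _ _ => rfl
      ext X
      simp only [Finset.mem_filter]
      tauto
    · intro T' hT' hne'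
      rw [Finset.mem_powerset] at hT'
      by_cases hcase : 𝓛 T' ∧ A ⊆ T'
      · rw [← ih T' (lt_of_le_of_ne hT' hne') hcase.1 hcase.2]
        refine Finset.sum_congr ?_ fun _ _ => rfl
        ext X
        simp only [Finset.mem_filter, Finset.mem_powerset]
        constructor
        · rintro ⟨⟨h1, h2⟩, h3⟩
          exact ⟨h3 ▸ Finset.subset_union_left, h2, h3⟩
        · rintro ⟨h1, h2, h3⟩
          exact ⟨⟨h1.trans hT', h2⟩, h3⟩
      · apply Finset.sum_eq_zero
        intro X hX
        exfalso
        simp only [Finset.mem_filter, Finset.mem_powerset] at hX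
        exact hcase ⟨hX.2 ▸ hcl X hX.1.2, hX.2 ▸ Finset.subset_union_right⟩
    · intro h; simp at h

lemma mob_zero_of (𝓛 : Finset α → Prop) (A : Finset α) (hA : A ≠ ∅)
    (hcl : ∀ X, 𝓛 X → 𝓛 (X ∪ A)) (T : Finset α) (hT : 𝓛 T) (hAT : A ⊆ T)
    (h : ∀ X, 𝓛 X → X ∪ A = T → X = T) : mob 𝓛 T = 0 := by
  have h1 := weisner 𝓛 A hA hcl T hT hAT
  have h2 : T.powerset.filter (fun X => 𝓛 X ∧ X ∪ A = T) = {T} := by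
    ext X
    simp only [Finset.mem_filter, Finset.mem_powerset, Finset.mem_singleton]
    constructor
    · rintro ⟨_, h1, h2⟩; exact h X h1 h2
    · rintro rfl; exact ⟨subset_rfl, hT, Finset.union_eq_left.2 hAT⟩
  rw [h2, Finset.sum_singleton] at h1
  exact h1

lemma mob_dichotomy (𝓛 : Finset α → Prop) (h0 : 𝓛 ∅) (hU : ∀ X Y, 𝓛 X → 𝓛 Y → 𝓛 (X ∪ Y))
    (hI : ∀ X Y, 𝓛 X → 𝓛 Y → 𝓛 (X ∩ Y)) (T : Finset α) (hT : 𝓛 T) :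
    ((∀ X, 𝓛 X → X ⊆ T → 𝓛 (T \ X)) ∧ mob 𝓛 T * mob 𝓛 T = 1) ∨
    ((¬ ∀ X, 𝓛 X → X ⊆ T → 𝓛 (T \ X)) ∧ mob 𝓛 T = 0) := by
  induction T using Finset.strongInduction with
  | H T ih =>
    by_cases hne : T = ∅
    · left
      subst hne
      exact ⟨fun X _ _ => by simpa using h0, by rw [mob_empty]; rfl⟩
    obtain ⟨A, hA, hmin⟩ := Finset.exists_min_image
      (T.powerset.filter fun X => 𝓛 X ∧ X ≠ ∅) Finset.card ⟨T, by simp [hT, hne]⟩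
    simp only [Finset.mem_filter, Finset.mem_powerset] at hA hmin
    obtain ⟨hAT, hAL, hAne⟩ := hA
    have hatom : ∀ X, 𝓛 X → X ∩ A = ∅ ∨ A ⊆ X := by
      intro X hX
      by_cases hXA : X ∩ A = ∅
      · exact Or.inl hXA
      · right
        have := hmin (X ∩ A) ⟨Finset.inter_subset_right.trans hAT, hI _ _ hX hAL, hXA⟩
        have := Finset.eq_of_subset_of_card_le Finset.inter_subset_right this
        exact Finset.inter_eq_right.1 this
    by_cases hTA : 𝓛 (T \ A)
    · have hlt : T \ A ⊂ T := by
        refine Finset.sdiff_ssubset hAT (Finset.nonempty_iff_ne_empty.2 hAne)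
      have hw := weisner 𝓛 A hAne (fun X hX => hU _ _ hX hAL) T hT hAT
      have h2 : T.powerset.filter (fun X => 𝓛 X ∧ X ∪ A = T) = {T, T \ A} := by
        ext X
        simp only [Finset.mem_filter, Finset.mem_powerset, Finset.mem_singleton,
          Finset.mem_insert]
        constructor
        · rintro ⟨_, h1, h2⟩
          rcases hatom X h1 with h | h
          · right
            rw [← h2, Finset.union_sdiff_right]
            rw [eq_comm, Finset.sdiff_eq_self_iff_disjoint, Finset.disjoint_iff_inter_eq_empty]
            exact h
          · left; rw [← h2]; exact (Finset.union_eq_left.2 h).symm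
        · rintro (rfl | rfl)
          · exact ⟨subset_rfl, hT, Finset.union_eq_left.2 hAT⟩
          · exact ⟨Finset.sdiff_subset, hTA, Finset.sdiff_union_of_subset hAT⟩
      rw [h2, Finset.sum_pair hlt.ne'] at hw
      have hm : mob 𝓛 T = - mob 𝓛 (T \ A) := by linarith
      have hiff : (∀ X, 𝓛 X → X ⊆ T → 𝓛 (T \ X)) ↔
          (∀ X, 𝓛 X → X ⊆ T \ A → 𝓛 ((T \ A) \ X)) := by
        constructor
        · intro h X hX hXT
          have h3 := hI _ _ (h X hX (hXT.trans Finset.sdiff_subset)) hTA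
          convert h3 using 1
          ext a; simp only [Finset.mem_sdiff, Finset.mem_inter]; tauto
        · intro h X hX hXT
          have h3 := h _ (hI _ _ hX hTA) Finset.inter_subset_right
          rcases hatom X hX with h4 | h4
          · have h5 := hU _ _ h3 hAL
            convert h5 using 1
            ext a
            have h6 : a ∈ X → a ∉ A := by
              intro h7 h8
              have : a ∈ X ∩ A := by simp [h7, h8]
              rw [h4] at this; simp at this
            have h7 : a ∈ A → a ∈ T := fun h => hAT h
            simp only [Finset.mem_sdiff, Finset.mem_inter, Finset.mem_union]; tauto
          · convert h3 using 1
            ext a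
            have h7 : a ∈ A → a ∈ X := fun h => h4 h
            simp only [Finset.mem_sdiff, Finset.mem_inter]; tauto
      rw [hiff, hm]
      rcases ih _ hlt hTA with ⟨h3, h4⟩ | ⟨h3, h4⟩
      · left; exact ⟨h3, by rw [← h4]; ring⟩
      · right; exact ⟨h3, by rw [h4]; rfl⟩
    · right
      refine ⟨fun h => hTA (h A hAL hAT), ?_⟩
      refine mob_zero_of 𝓛 A hAne (fun X hX => hU _ _ hX hAL) T hT hAT ?_
      intro X hX hXA
      rcases hatom X hX with h | h
      · exfalso
        apply hTA
        have : T \ A = X := by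
          rw [← hXA, Finset.union_sdiff_right, Finset.sdiff_eq_self_iff_disjoint,
            Finset.disjoint_iff_inter_eq_empty]
          exact h
        rw [this]; exact hX
      · rw [← hXA]; exact (Finset.union_eq_left.2 h).symm

end Mobius



section Spanning
variable {α : Type} [Fintype α] [DecidableEq α]

/-- The span of the Schubert indicator functions. -/
noncomputable def schSpan (α : Type) [Fintype α] [DecidableEq α] :
    Submodule ℤ ((α → ℝ) → ℤ) :=
  Submodule.span ℤ {f : (α → ℝ) → ℤ | ∃ ℬ, IsSchubertFamilyOn α ℬ ∧ f = relintIndOn α ℬ}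

/-- The family of violated or tight sets. -/
def badL (E' : Finset α) (ρ : Finset α → ℕ) (x : α → ℝ) (X : Finset α) : Prop :=
  X ⊆ E' ∧ (ρ X : ℝ) ≤ ∑ a ∈ X, x a

lemma Oset_span (L K : Finset α) (r : ℕ) (T : Finset (Finset α × ℤ))
    (hLK : Disjoint L K) (hT : NChain T) (hTL : ∀ p ∈ T, Disjoint p.1 L)
    (hTK : ∀ p ∈ T, Disjoint p.1 K) :
    (fun x => if x ∈ Oset L K r T then 1 else 0 : (α → ℝ) → ℤ) ∈ schSpan α := by
  by_cases h : ∃ p, p ∈ Oset L K r T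
  · obtain ⟨p, hp⟩ := h
    obtain ⟨ℬ, hℬ, hO⟩ := sch_open L K r T hLK hT hTL hTK p hp
    apply Submodule.subset_span
    refine ⟨ℬ, hℬ, ?_⟩
    unfold relintIndOn
    rw [hO]
  · push Not at h
    have : (fun x => if x ∈ Oset L K r T then 1 else 0 : (α → ℝ) → ℤ) = 0 := by
      ext x; simp [h x]
    rw [this]; exact Submodule.zero_mem _

lemma mob_span (L K : Finset α) (r : ℕ) (ρ : Finset α → ℕ) (hLK : Disjoint L K)
    (Y : Finset α) (hY : Y ⊆ (L ∪ K)ᶜ) (D : Finset (Finset α))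
    (hD : ∀ X ∈ D, ∀ Z ∈ D, X ⊆ Z ∨ Z ⊆ X) (hDY : ∀ X ∈ D, Y ⊆ X)
    (hDE : ∀ X ∈ D, X ⊆ (L ∪ K)ᶜ) :
    (fun x => if x ∈ Qset L K r ∧ ∀ X ∈ D, ∑ a ∈ X, x a < (ρ X : ℝ) then
      mob (badL (L ∪ K)ᶜ ρ x) Y else 0 : (α → ℝ) → ℤ) ∈ schSpan α := by
  induction Y using Finset.strongInduction generalizing D with
  | H Y ih =>
    by_cases hne : Y = ∅
    · subst hne
      have h1 := Oset_span L K r (D.image fun X => (X, (ρ X : ℤ))) hLK (by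
        intro p hp q hq
        obtain ⟨X, hX, rfl⟩ := Finset.mem_image.1 hp
        obtain ⟨Z, hZ, rfl⟩ := Finset.mem_image.1 hq
        exact hD X hX Z hZ) (by
        intro p hp
        obtain ⟨X, hX, rfl⟩ := Finset.mem_image.1 hp
        rw [Finset.disjoint_left]
        intro a ha hL
        have := hDE X hX ha
        simp [hL] at this) (by
        intro p hp
        obtain ⟨X, hX, rfl⟩ := Finset.mem_image.1 hp
        rw [Finset.disjoint_left]
        intro a ha hL
        have := hDE X hX ha
        simp [hL] at this)
      convert h1 using 2 with x
      rw [mob_empty]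
      refine if_congr ?_ rfl rfl
      simp [Oset]
    · have hrec : (fun x => if x ∈ Qset L K r ∧ ∀ X ∈ D, ∑ a ∈ X, x a < (ρ X : ℝ) then
          mob (badL (L ∪ K)ᶜ ρ x) Y else 0 : (α → ℝ) → ℤ) =
          - ∑ Z ∈ Y.ssubsets,
            ((fun x => if x ∈ Qset L K r ∧ ∀ X ∈ D, ∑ a ∈ X, x a < (ρ X : ℝ) then
              mob (badL (L ∪ K)ᶜ ρ x) Z else 0 : (α → ℝ) → ℤ) -
            (fun x => if x ∈ Qset L K r ∧ ∀ X ∈ insert Z D, ∑ a ∈ X, x a < (ρ X : ℝ) then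
              mob (badL (L ∪ K)ᶜ ρ x) Z else 0 : (α → ℝ) → ℤ)) := by
        ext x
        simp only [Pi.neg_apply, Finset.sum_apply, Pi.sub_apply]
        by_cases hx : x ∈ Qset L K r ∧ ∀ X ∈ D, ∑ a ∈ X, x a < (ρ X : ℝ)
        · rw [if_pos hx, mob_eq _ _ hne]
          congr 1
          refine Finset.sum_congr rfl fun Z hZ => ?_
          rw [if_pos hx]
          have hZE : Z ⊆ (L ∪ K)ᶜ := (Finset.mem_ssubsets.1 hZ).1.trans hY
          by_cases hb : ∑ a ∈ Z, x a < (ρ Z : ℝ)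
          · rw [if_neg (by unfold badL; intro h; linarith [h.2]), if_pos, sub_self]
            refine ⟨hx.1, ?_⟩
            intro X hX
            rcases Finset.mem_insert.1 hX with rfl | hX
            · exact hb
            · exact hx.2 X hX
          · rw [if_pos ⟨hZE, not_lt.1 hb⟩, if_neg, sub_zero]
            intro h
            exact hb (h.2 Z (Finset.mem_insert_self _ _))
        · rw [if_neg hx, eq_comm, neg_eq_zero]
          refine Finset.sum_eq_zero fun Z hZ => ?_
          rw [if_neg hx, if_neg, sub_self]
          intro h
          exact hx ⟨h.1, fun X hX => h.2 X (Finset.mem_insert_of_mem hX)⟩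
      rw [hrec]
      refine Submodule.neg_mem _ (Submodule.sum_mem _ fun Z hZ => Submodule.sub_mem _ ?_ ?_)
      all_goals
        rw [Finset.mem_ssubsets] at hZ
        have hZE : Z ⊆ (L ∪ K)ᶜ := hZ.1.trans hY
      · exact ih Z hZ hZE D hD (fun X hX => hZ.1.trans (hDY X hX)) hDE
      · refine ih Z hZ hZE (insert Z D) ?_ ?_ ?_
        · intro X hX W hW
          rcases Finset.mem_insert.1 hX with hX1 | hX1 <;>
            rcases Finset.mem_insert.1 hW with hW1 | hW1
          · left; rw [hX1, hW1]
          · left; rw [hX1]; exact hZ.1.trans (hDY W hW1)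
          · right; rw [hW1]; exact hZ.1.trans (hDY X hX1)
          · exact hD X hX1 W hW1
        · intro X hX
          rcases Finset.mem_insert.1 hX with rfl | hX
          · exact subset_rfl
          · exact hZ.1.trans (hDY X hX)
        · intro X hX
          rcases Finset.mem_insert.1 hX with rfl | hX
          · exact hZE
          · exact hDE X hX

/-- The barycentre of the bases. -/
noncomputable def bary (ℬ : Finset (Finset α)) : α → ℝ :=
  fun a => (∑ B ∈ ℬ, basisVectorOn α B a) / (ℬ.card : ℝ)

lemma bary_sum (ℬ : Finset (Finset α)) (X : Finset α) :
    ∑ a ∈ X, bary ℬ a = (∑ B ∈ ℬ, ((B ∩ X).card : ℝ)) / (ℬ.card : ℝ) := by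
  unfold bary
  rw [← Finset.sum_div, Finset.sum_comm]
  simp only [sum_basisVectorOn]

lemma bary_mem {ℬ : Finset (Finset α)} (h : ℬ.Nonempty) : bary ℬ ∈ basePolytopeOn α ℬ := by
  have hc : (ℬ.card : ℝ) ≠ 0 := by
    have := h.card_pos
    positivity
  have := Convex.sum_mem (convex_convexHull ℝ (basisVectorOn α '' (↑ℬ : Set (Finset α))))
    (t := ℬ) (w := fun _ => (1 : ℝ) / ℬ.card) (z := fun B => basisVectorOn α B)
    (fun _ _ => by positivity) (by simp [hc]) (fun B hB => vertex_mem hB)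
  have hb : bary ℬ = ∑ B ∈ ℬ, ((1 : ℝ) / ℬ.card) • basisVectorOn α B := by
    ext a
    simp only [bary, Finset.sum_apply, Pi.smul_apply, smul_eq_mul, ← Finset.mul_sum]
    ring
  rw [hb]
  exact this

lemma bary_lt {ℬ : Finset (Finset α)} {X : Finset α} {k : ℝ}
    (h : ∀ B ∈ ℬ, ((B ∩ X).card : ℝ) ≤ k) (h' : ∃ B ∈ ℬ, ((B ∩ X).card : ℝ) < k) :
    ∑ a ∈ X, bary ℬ a < k := by
  obtain ⟨B, hB, hlt⟩ := h'
  have hc : (0 : ℝ) < ℬ.card := by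
    have : 0 < ℬ.card := Finset.card_pos.2 ⟨B, hB⟩
    positivity
  rw [bary_sum, div_lt_iff₀ hc]
  have := Finset.sum_lt_sum h ⟨B, hB, hlt⟩
  simpa [mul_comm] using this

lemma bary_gt {ℬ : Finset (Finset α)} {X : Finset α} {k : ℝ}
    (h : ∀ B ∈ ℬ, k ≤ ((B ∩ X).card : ℝ)) (h' : ∃ B ∈ ℬ, k < ((B ∩ X).card : ℝ)) :
    k < ∑ a ∈ X, bary ℬ a := by
  obtain ⟨B, hB, hlt⟩ := h'
  have hc : (0 : ℝ) < ℬ.card := by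
    have : 0 < ℬ.card := Finset.card_pos.2 ⟨B, hB⟩
    positivity
  rw [bary_sum, lt_div_iff₀ hc]
  have := Finset.sum_lt_sum h ⟨B, hB, hlt⟩
  simpa [mul_comm] using this

/-- Separators: every basis meets `X` in the same number of elements. -/
def Sep (ℬ : Finset (Finset α)) (X : Finset α) : Prop := ∀ B ∈ ℬ, (B ∩ X).card = rk ℬ X

/-- The loops. -/
noncomputable def loopsOf (ℬ : Finset (Finset α)) : Finset α :=
  Finset.univ.filter fun a => ∀ B ∈ ℬ, a ∉ B

/-- The coloops. -/
noncomputable def coloopsOf (ℬ : Finset (Finset α)) : Finset α :=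
  Finset.univ.filter fun a => ∀ B ∈ ℬ, a ∈ B

lemma relint_matroid {ℬ : Finset (Finset α)} (h : IsBasisFamilyOn α ℬ) :
    intrinsicInterior ℝ (basePolytopeOn α ℬ) =
      {x | (∀ X, Sep ℬ X → ∑ a ∈ X, x a = (rk ℬ X : ℝ)) ∧
        ∀ X, ¬ Sep ℬ X → ∑ a ∈ X, x a < (rk ℬ X : ℝ)} := by
  have huniv : Sep ℬ Finset.univ := by
    intro B hB
    rw [Finset.inter_univ, rk_univ h hB]
  have hnon : ∀ X, ¬ Sep ℬ X → ∃ B ∈ ℬ, ((B ∩ X).card : ℝ) < rk ℬ X := by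
    intro X hX
    unfold Sep at hX
    push Not at hX
    obtain ⟨B, hB, hne⟩ := hX
    exact ⟨B, hB, by exact_mod_cast lt_of_le_of_ne (le_rk hB X) hne⟩
  have hsepP : ∀ x ∈ basePolytopeOn α ℬ, ∀ X, Sep ℬ X → ∑ a ∈ X, x a = rk ℬ X := by
    intro x hx X hX
    refine le_antisymm ?_ ?_
    · exact base_le (fun B hB => by exact_mod_cast le_rk hB X) hx
    · exact base_ge (fun B hB => by exact_mod_cast (hX B hB).ge) hx
  have := relint_eq (κ := {X : Finset α // Sep ℬ X}) (ι := {X : Finset α // ¬ Sep ℬ X})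
    (fun X => sumL X.1) (fun X => (rk ℬ X.1 : ℝ)) (fun X => sumL X.1) (fun X => (rk ℬ X.1 : ℝ))
    (basePolytopeOn α ℬ) ?_ (bary ℬ) ?_
  · rw [this]
    ext x
    simp [sumL_apply]
  · ext x
    simp only [sumL_apply, Subtype.forall]
    constructor
    · intro hx
      exact ⟨hsepP x hx, fun X _ => ((edmonds h x).1 hx).1 X⟩
    · rintro ⟨h1, h2⟩
      rw [edmonds h]
      refine ⟨fun X => ?_, h1 _ huniv⟩
      by_cases hX : Sep ℬ X
      · exact (h1 X hX).le
      · exact h2 X hX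
  · simp only [sumL_apply, Subtype.forall]
    refine ⟨hsepP _ (bary_mem h.1), fun X hX => ?_⟩
    exact bary_lt (fun B hB => by exact_mod_cast le_rk hB X) (hnon X hX)

end Spanning



section SpanningMain
variable {α : Type} [Fintype α] [DecidableEq α]

lemma mem_loopsOf {ℬ : Finset (Finset α)} {a : α} : a ∈ loopsOf ℬ ↔ ∀ B ∈ ℬ, a ∉ B := by
  simp [loopsOf]

lemma mem_coloopsOf {ℬ : Finset (Finset α)} {a : α} : a ∈ coloopsOf ℬ ↔ ∀ B ∈ ℬ, a ∈ B := by
  simp [coloopsOf]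

lemma disj_LK {ℬ : Finset (Finset α)} (h : ℬ.Nonempty) :
    Disjoint (loopsOf ℬ) (coloopsOf ℬ) := by
  obtain ⟨B, hB⟩ := h
  rw [Finset.disjoint_left]
  intro a h1 h2
  exact mem_loopsOf.1 h1 B hB (mem_coloopsOf.1 h2 B hB)

lemma sum_split (L K : Finset α) (hLK : Disjoint L K) (x : α → ℝ) (hL : ∀ a ∈ L, x a = 0)
    (hK : ∀ a ∈ K, x a = 1) (X : Finset α) :
    ∑ a ∈ X, x a = ((X ∩ K).card : ℝ) + ∑ a ∈ X ∩ (L ∪ K)ᶜ, x a := by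
  have h1 : X = (X ∩ L) ∪ ((X ∩ K) ∪ (X ∩ (L ∪ K)ᶜ)) := by
    ext a; simp only [Finset.mem_union, Finset.mem_inter, Finset.mem_compl]; tauto
  have hd : ∀ a, a ∈ L → a ∉ K := fun a ha => Finset.disjoint_left.1 hLK ha
  conv_lhs => rw [h1]
  rw [Finset.sum_union, Finset.sum_union]
  · rw [Finset.sum_eq_zero (s := X ∩ L) fun a ha => hL a (Finset.mem_inter.1 ha).2,
      Finset.sum_congr (s₁ := X ∩ K) rfl fun a ha => hK a (Finset.mem_inter.1 ha).2]
    simp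
  · rw [Finset.disjoint_left]; intro a
    simp only [Finset.mem_union, Finset.mem_inter, Finset.mem_compl]; tauto
  · rw [Finset.disjoint_left]; intro a
    have := hd a
    simp only [Finset.mem_union, Finset.mem_inter, Finset.mem_compl]; tauto

lemma basis_split {ℬ : Finset (Finset α)} {B : Finset α} (hB : B ∈ ℬ) (X : Finset α) :
    (B ∩ X).card = (X ∩ coloopsOf ℬ).card + (B ∩ (X ∩ (loopsOf ℬ ∪ coloopsOf ℬ)ᶜ)).card := by
  have := sum_split (loopsOf ℬ) (coloopsOf ℬ) (disj_LK ⟨B, hB⟩) (basisVectorOn α B)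
    (fun a ha => by simp [basisVectorOn, mem_loopsOf.1 ha B hB])
    (fun a ha => by simp [basisVectorOn, mem_coloopsOf.1 ha B hB]) X
  rw [sum_basisVectorOn, sum_basisVectorOn] at this
  exact_mod_cast this

lemma rk_eq_of_const {ℬ : Finset (Finset α)} (hne : ℬ.Nonempty) {X : Finset α} {c : ℕ}
    (h : ∀ B ∈ ℬ, (B ∩ X).card = c) : rk ℬ X = c := by
  obtain ⟨B, hB⟩ := hne
  exact le_antisymm (rk_le fun B hB => (h B hB).le) ((h B hB) ▸ le_rk hB X)

lemma card_sdiff_inter {B X Y : Finset α} (h : X ⊆ Y) :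
    (B ∩ (Y \ X)).card + (B ∩ X).card = (B ∩ Y).card := by
  rw [← Finset.card_union_of_disjoint]
  · congr 1
    ext a
    have : a ∈ X → a ∈ Y := fun h' => h h'
    simp only [Finset.mem_union, Finset.mem_inter, Finset.mem_sdiff]; tauto
  · rw [Finset.disjoint_left]; intro a
    simp only [Finset.mem_inter, Finset.mem_sdiff]; tauto

lemma relint_sub_Q {ℬ : Finset (Finset α)} (h : IsBasisFamilyOn α ℬ) {x : α → ℝ}
    (hx : x ∈ intrinsicInterior ℝ (basePolytopeOn α ℬ)) :
    x ∈ Qset (loopsOf ℬ) (coloopsOf ℬ) (rk ℬ Finset.univ) := by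
  rw [relint_matroid h] at hx
  obtain ⟨h1, h2⟩ := hx
  have huniv : Sep ℬ Finset.univ := by
    intro B hB
    rw [Finset.inter_univ, rk_univ h hB]
  refine ⟨h1 _ huniv, ?_, ?_, ?_⟩
  · intro a ha
    have hc : ∀ B ∈ ℬ, (B ∩ {a}).card = 0 := by
      intro B hB
      rw [Finset.inter_singleton_of_notMem (mem_loopsOf.1 ha B hB)]; rfl
    have hr := rk_eq_of_const h.1 hc
    have := h1 {a} (fun B hB => by rw [hr, hc B hB])
    rw [hr] at this
    simpa using this
  · intro a ha
    have hc : ∀ B ∈ ℬ, (B ∩ {a}).card = 1 := by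
      intro B hB
      rw [Finset.inter_singleton_of_mem (mem_coloopsOf.1 ha B hB)]; rfl
    have hr := rk_eq_of_const h.1 hc
    have := h1 {a} (fun B hB => by rw [hr, hc B hB])
    rw [hr] at this
    simpa using this
  · intro a hL hK
    rw [mem_loopsOf] at hL
    rw [mem_coloopsOf] at hK
    push Not at hL hK
    obtain ⟨B, hB, haB⟩ := hL
    obtain ⟨B', hB', haB'⟩ := hK
    constructor
    · have hn : ¬ Sep ℬ {a}ᶜ := by
        intro hs
        have e := (hs B hB).trans (hs B' hB').symm
        have e1 := bf_card_eq h hB hB'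
        have e2 : B ∩ {a}ᶜ = B.erase a := by ext b; simp [and_comm]
        have e3 : B' ∩ {a}ᶜ = B'.erase a := by ext b; simp [and_comm]
        rw [e2, e3, Finset.erase_eq_of_notMem haB', ← e1] at e
        have := Finset.card_erase_lt_of_mem haB
        omega
      have h3 := h2 _ hn
      have h4 : ∑ b ∈ {a}, x b + ∑ b ∈ {a}ᶜ, x b = ∑ b, x b := Finset.sum_add_sum_compl {a} x
      rw [h1 _ huniv, Finset.sum_singleton] at h4
      have h5 : rk ℬ {a}ᶜ ≤ rk ℬ Finset.univ := rk_le fun B hB => 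
        (Finset.card_le_card (Finset.inter_subset_inter_left (Finset.subset_univ _))).trans
          (le_rk hB _)
      have h6 : (rk ℬ {a}ᶜ : ℝ) ≤ rk ℬ Finset.univ := by exact_mod_cast h5
      linarith
    · have hn : ¬ Sep ℬ {a} := by
        intro hs
        have e := (hs B hB).trans (hs B' hB').symm
        rw [Finset.inter_singleton_of_mem haB, Finset.inter_singleton_of_notMem haB'] at e
        simp at e
      have h3 := h2 _ hn
      have h5 : rk ℬ {a} ≤ 1 := rk_le fun B hB => 
        (Finset.card_le_card Finset.inter_subset_right).trans (by simp)
      have h6 : (rk ℬ {a} : ℝ) ≤ 1 := by exact_mod_cast h5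
      rw [Finset.sum_singleton] at h3
      linarith

lemma rk_empty' (ℬ : Finset (Finset α)) : rk ℬ ∅ = 0 :=
  Nat.le_zero.1 (rk_le fun B _ => by simp)

lemma mob_matroid {ℬ : Finset (Finset α)} (h : IsBasisFamilyOn α ℬ) {x : α → ℝ}
    (hQ : x ∈ Qset (loopsOf ℬ) (coloopsOf ℬ) (rk ℬ Finset.univ)) :
    (x ∈ intrinsicInterior ℝ (basePolytopeOn α ℬ) ∧
      mob (badL (loopsOf ℬ ∪ coloopsOf ℬ)ᶜ (rk ℬ) x) (loopsOf ℬ ∪ coloopsOf ℬ)ᶜ *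
        mob (badL (loopsOf ℬ ∪ coloopsOf ℬ)ᶜ (rk ℬ) x) (loopsOf ℬ ∪ coloopsOf ℬ)ᶜ = 1) ∨
    (x ∉ intrinsicInterior ℝ (basePolytopeOn α ℬ) ∧
      mob (badL (loopsOf ℬ ∪ coloopsOf ℬ)ᶜ (rk ℬ) x) (loopsOf ℬ ∪ coloopsOf ℬ)ᶜ = 0) := by
  have hsub : ∀ X Y : Finset α, (rk ℬ (X ∪ Y) : ℝ) + rk ℬ (X ∩ Y) ≤ rk ℬ X + rk ℬ Y := by
    intro X Y; exact_mod_cast rk_submod h X Y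
  have hsplit := sum_split _ _ (disj_LK h.1) x hQ.2.1 hQ.2.2.1
  have hbs : ∀ B ∈ ℬ, ∀ X, (B ∩ X).card = (X ∩ coloopsOf ℬ).card +
    (B ∩ (X ∩ (loopsOf ℬ ∪ coloopsOf ℬ)ᶜ)).card := fun B hB X => basis_split hB X
  set K := coloopsOf ℬ
  set E' := (loopsOf ℬ ∪ K)ᶜ with hE'
  have hsum := hQ.1
  have hrkU : ∀ B ∈ ℬ, (B ∩ Finset.univ).card = rk ℬ Finset.univ := by
    intro B hB
    rw [Finset.inter_univ, rk_univ h hB]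
  have hsepE : Sep ℬ E' := by
    have : ∀ B ∈ ℬ, (B ∩ E').card = rk ℬ Finset.univ - K.card := by
      intro B hB
      have h1 := hbs B hB Finset.univ
      rw [hrkU B hB, Finset.univ_inter, Finset.univ_inter] at h1
      omega
    intro B hB
    rw [rk_eq_of_const h.1 this, this B hB]
  have hgE : ∑ a ∈ E', x a = rk ℬ E' := by
    have h1 := hsplit Finset.univ
    rw [hsum, Finset.univ_inter, Finset.univ_inter] at h1
    obtain ⟨B, hB⟩ := h.1
    have h2 := hbs B hB Finset.univ
    rw [hrkU B hB, Finset.univ_inter, Finset.univ_inter, hsepE B hB] at h2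
    rw [h2] at h1
    push_cast at h1
    linarith
  have hbadE : badL E' (rk ℬ) x E' := ⟨subset_rfl, hgE.ge⟩
  have hsumUI : ∀ X Y : Finset α, ∑ a ∈ X ∪ Y, x a + ∑ a ∈ X ∩ Y, x a =
      ∑ a ∈ X, x a + ∑ a ∈ Y, x a := fun X Y => Finset.sum_union_inter
  by_cases hg : ∀ X ⊆ E', ∑ a ∈ X, x a ≤ rk ℬ X
  · have hU : ∀ X Y, badL E' (rk ℬ) x X → badL E' (rk ℬ) x Y → badL E' (rk ℬ) x (X ∪ Y) := by
      rintro X Y ⟨h1, h2⟩ ⟨h3, h4⟩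
      refine ⟨Finset.union_subset h1 h3, ?_⟩
      have := hg (X ∩ Y) (Finset.inter_subset_left.trans h1)
      linarith [hsub X Y, hsumUI X Y]
    have hI : ∀ X Y, badL E' (rk ℬ) x X → badL E' (rk ℬ) x Y → badL E' (rk ℬ) x (X ∩ Y) := by
      rintro X Y ⟨h1, h2⟩ ⟨h3, h4⟩
      refine ⟨Finset.inter_subset_left.trans h1, ?_⟩
      have := hg (X ∪ Y) (Finset.union_subset h1 h3)
      linarith [hsub X Y, hsumUI X Y]
    have hdich := mob_dichotomy (badL E' (rk ℬ) x)
      ⟨Finset.empty_subset _, by simp [rk_empty']⟩ hU hI E' hbadE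
    have hrkge : ∀ X, ((X ∩ K).card : ℝ) + rk ℬ (X ∩ E') ≤ rk ℬ X := by
      intro X
      obtain ⟨B, hB, hBX⟩ := rk_greedy h {X ∩ E'} (by simp)
      have h1 := hBX (X ∩ E') (by simp)
      have h2 := hbs B hB X
      have h3 := le_rk hB X
      rw [h2, h1] at h3
      exact_mod_cast h3
    have hle : ∀ X, ∑ a ∈ X, x a ≤ rk ℬ X := by
      intro X
      have h3 := hrkge X
      rw [hsplit X]
      linarith [hg (X ∩ E') Finset.inter_subset_right]
    have hsep : ∀ X, Sep ℬ X → ∑ a ∈ X, x a = rk ℬ X := by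
      intro X hX
      have hc : ∀ B ∈ ℬ, (B ∩ (Finset.univ \ X)).card = rk ℬ Finset.univ - rk ℬ X := by
        intro B hB
        have := card_sdiff_inter (B := B) (Finset.subset_univ X)
        rw [hX B hB, hrkU B hB] at this
        omega
      have hle' : rk ℬ X ≤ rk ℬ Finset.univ := by
        obtain ⟨B, hB⟩ := h.1
        rw [← hX B hB, ← hrkU B hB]
        exact Finset.card_le_card (Finset.inter_subset_inter_left (Finset.subset_univ _))
      have h1 := rk_eq_of_const h.1 hc
      have h2 := hle (Finset.univ \ X)
      rw [h1, Nat.cast_sub hle'] at h2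
      have h3 := Finset.sum_sdiff (f := x) (Finset.subset_univ X)
      rw [hsum] at h3
      linarith [hle X]
    rw [relint_matroid h]
    by_cases hrel : ∀ X, ¬ Sep ℬ X → ∑ a ∈ X, x a < (rk ℬ X : ℝ)
    · left
      refine ⟨⟨hsep, hrel⟩, ?_⟩
      rcases hdich with hd | hd
      · exact hd.2
      · exfalso
        apply hd.1
        rintro X ⟨hX1, hX2⟩ _
        have hsX : Sep ℬ X := by
          by_contra hcon
          linarith [hrel X hcon]
        have hsEX : Sep ℬ (E' \ X) := by
          have hc : ∀ B ∈ ℬ, (B ∩ (E' \ X)).card = rk ℬ E' - rk ℬ X := by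
            intro B hB
            have := card_sdiff_inter (B := B) hX1
            rw [hsX B hB, hsepE B hB] at this
            omega
          intro B hB
          rw [rk_eq_of_const h.1 hc, hc B hB]
        exact ⟨Finset.sdiff_subset, (hsep _ hsEX).ge⟩
    · right
      refine ⟨fun hx => hrel hx.2, ?_⟩
      rcases hdich with hd | hd
      · exfalso
        push Not at hrel
        obtain ⟨X, hXn, hX⟩ := hrel
        apply hXn
        have htX : ∑ a ∈ X, x a = rk ℬ X := le_antisymm (hle X) hX
        have hXE : badL E' (rk ℬ) x (X ∩ E') := by
          refine ⟨Finset.inter_subset_right, ?_⟩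
          have h1 := hrkge X
          have h2 := hsplit X
          linarith
        have h3 := (hd.1 _ hXE hXE.1).2
        intro B hB
        refine le_antisymm (le_rk hB X) ?_
        have h4 := card_sdiff_inter (B := B) hXE.1
        rw [hsepE B hB] at h4
        have h4' : ((B ∩ (E' \ (X ∩ E'))).card : ℝ) + (B ∩ (X ∩ E')).card = rk ℬ E' := by
          exact_mod_cast h4
        have h5 : ((B ∩ (E' \ (X ∩ E'))).card : ℝ) ≤ rk ℬ (E' \ (X ∩ E')) := by
          exact_mod_cast le_rk hB _
        have h6 := Finset.sum_sdiff (f := x) hXE.1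
        have h7 := hsplit X
        have h8 : ((B ∩ X).card : ℝ) = (X ∩ K).card + (B ∩ (X ∩ E')).card := by
          exact_mod_cast hbs B hB X
        have : (rk ℬ X : ℝ) ≤ (B ∩ X).card := by linarith
        exact_mod_cast this
      · exact hd.2
  · right
    constructor
    · intro hx
      apply hg
      intro X _
      rw [relint_matroid h] at hx
      by_cases hX : Sep ℬ X
      · exact (hx.1 X hX).le
      · exact (hx.2 X hX).le
    · push Not at hg
      obtain ⟨X₀, hX₀, hpos⟩ := hg
      obtain ⟨M, hM, hMmax⟩ := Finset.exists_max_image E'.powerset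
        (fun X => ∑ a ∈ X, x a - rk ℬ X) ⟨X₀, Finset.mem_powerset.2 hX₀⟩
      obtain ⟨A, hA, hAmin⟩ := Finset.exists_min_image
        (E'.powerset.filter fun X => ∑ a ∈ M, x a - (rk ℬ M : ℝ) ≤ ∑ a ∈ X, x a - rk ℬ X)
        Finset.card ⟨M, by simp only [Finset.mem_filter]; exact ⟨hM, le_rfl⟩⟩
      simp only [Finset.mem_filter, Finset.mem_powerset] at hA hAmin hMmax
      have hAge := hMmax X₀ hX₀
      refine mob_zero_of _ A ?_ ?_ E' hbadE hA.1 ?_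
      · rintro rfl
        have := hA.2
        simp [rk_empty'] at this
        linarith
      · rintro X ⟨hX1, hX2⟩
        refine ⟨Finset.union_subset hX1 hA.1, ?_⟩
        have := hMmax (X ∩ A) (Finset.inter_subset_left.trans hX1)
        linarith [hsub X A, hsumUI X A, hA.2]
      · rintro X ⟨hX1, hX2⟩ hXA
        have h1 := hsumUI X A
        have h2 := hsub X A
        rw [hXA] at h1 h2
        have h3 := hAmin (X ∩ A) ⟨Finset.inter_subset_left.trans hX1, by linarith [hA.2]⟩
        have h4 := Finset.eq_of_subset_of_card_le Finset.inter_subset_right h3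
        rw [← hXA]
        exact (Finset.union_eq_left.2 (Finset.inter_eq_right.1 h4)).symm

lemma matroid_span {ℬ : Finset (Finset α)} (h : IsBasisFamilyOn α ℬ) :
    relintIndOn α ℬ ∈ schSpan α := by
  by_cases hne : ∃ p, p ∈ intrinsicInterior ℝ (basePolytopeOn α ℬ)
  · obtain ⟨p, hp⟩ := hne
    have hF := mob_span (loopsOf ℬ) (coloopsOf ℬ) (rk ℬ Finset.univ) (rk ℬ) (disj_LK h.1)
      (loopsOf ℬ ∪ coloopsOf ℬ)ᶜ subset_rfl ∅ (by simp) (by simp) (by simp)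
    set ε := mob (badL (loopsOf ℬ ∪ coloopsOf ℬ)ᶜ (rk ℬ) p) (loopsOf ℬ ∪ coloopsOf ℬ)ᶜ with hε
    have hbad : ∀ x ∈ intrinsicInterior ℝ (basePolytopeOn α ℬ),
        badL (loopsOf ℬ ∪ coloopsOf ℬ)ᶜ (rk ℬ) x =
        fun X => X ⊆ (loopsOf ℬ ∪ coloopsOf ℬ)ᶜ ∧ Sep ℬ X := by
      intro x hx
      rw [relint_matroid h] at hx
      ext X
      unfold badL
      by_cases hX : Sep ℬ X
      · simp [hX, hx.1 X hX]
      · simp [hX, hx.2 X hX]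
    have hε1 : ε * ε = 1 := by
      rcases mob_matroid h (relint_sub_Q h hp) with h1 | h1
      · exact h1.2
      · exact absurd hp h1.1
    have : relintIndOn α ℬ = ε • (fun x => if x ∈ Qset (loopsOf ℬ) (coloopsOf ℬ)
        (rk ℬ Finset.univ) ∧ ∀ X ∈ (∅ : Finset (Finset α)), ∑ a ∈ X, x a < (rk ℬ X : ℝ) then
        mob (badL (loopsOf ℬ ∪ coloopsOf ℬ)ᶜ (rk ℬ) x) (loopsOf ℬ ∪ coloopsOf ℬ)ᶜ else 0 :
          (α → ℝ) → ℤ) := by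
      ext x
      simp only [relintIndOn, Pi.smul_apply, smul_eq_mul]
      by_cases hx : x ∈ intrinsicInterior ℝ (basePolytopeOn α ℬ)
      · rw [if_pos hx, if_pos ⟨relint_sub_Q h hx, by simp⟩, hbad x hx, ← hbad p hp, ← hε, hε1]
      · rw [if_neg hx]
        by_cases hQ : x ∈ Qset (loopsOf ℬ) (coloopsOf ℬ) (rk ℬ Finset.univ)
        · rw [if_pos ⟨hQ, by simp⟩]
          rcases mob_matroid h hQ with h1 | h1
          · exact absurd h1.1 hx
          · rw [h1.2, mul_zero]
        · rw [if_neg (fun h => hQ h.1), mul_zero]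
    rw [this]
    exact Submodule.smul_mem _ _ hF
  · push Not at hne
    have : relintIndOn α ℬ = 0 := by
      ext x; simp [relintIndOn, hne x]
    rw [this]; exact Submodule.zero_mem _

lemma span_part : Submodule.span ℤ
        {f : (α → ℝ) → ℤ | ∃ ℬ, IsSchubertFamilyOn α ℬ ∧ f = relintIndOn α ℬ}
      = Submodule.span ℤ
          {f : (α → ℝ) → ℤ | ∃ ℬ, IsBasisFamilyOn α ℬ ∧ f = relintIndOn α ℬ} := by
  apply le_antisymm
  · apply Submodule.span_mono
    rintro f ⟨ℬ, hℬ, rfl⟩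
    obtain ⟨𝒞, r, hc, hne, rfl⟩ := schubert_nest hℬ
    exact ⟨_, nest_bf hc hne, rfl⟩
  · rw [Submodule.span_le]
    rintro f ⟨ℬ, hℬ, rfl⟩
    exact matroid_span hℬ

end SpanningMain



section Euler

lemma open_interval {C : Set ℝ} (ho : IsOpen C) (hc : Convex ℝ C) (hne : C.Nonempty) {M : ℝ}
    (hb : ∀ x ∈ C, -M < x ∧ x < M) : ∃ u v, u < v ∧ C = Set.Ioo u v := by
  have hbb : BddBelow C := ⟨-M, fun x hx => (hb x hx).1.le⟩
  have hba : BddAbove C := ⟨M, fun x hx => (hb x hx).2.le⟩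
  have hsub : C ⊆ Set.Ioo (sInf C) (sSup C) := by
    intro x hx
    obtain ⟨ε, hε, hball⟩ := Metric.isOpen_iff.1 ho x hx
    have h1 : x - ε / 2 ∈ C := hball (by
      rw [Metric.mem_ball, Real.dist_eq, abs_lt]; constructor <;> linarith)
    have h2 : x + ε / 2 ∈ C := hball (by
      rw [Metric.mem_ball, Real.dist_eq, abs_lt]; constructor <;> linarith)
    exact ⟨by linarith [csInf_le hbb h1], by linarith [le_csSup hba h2]⟩
  have hconn : IsConnected C := ⟨hne, hc.isPreconnected⟩
  refine ⟨sInf C, sSup C, ?_, hsub.antisymm (hconn.Ioo_csInf_csSup_subset hbb hba)⟩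
  obtain ⟨x, hx⟩ := hne
  exact (hsub hx).1.trans (hsub hx).2

lemma right_limit (u v l : ℝ) (huv : u < v) :
    ∀ᶠ t in nhdsWithin l (Set.Ioi l), (if t ∈ Set.Ioo u v then (1 : ℤ) else 0) =
      (if l ∈ Set.Ioo u v then 1 else 0) + (if u = l then 1 else 0) := by
  rcases lt_trichotomy u l with h | h | h
  · by_cases hv : l < v
    · filter_upwards [Ioo_mem_nhdsGT hv] with t ht
      rw [if_pos ⟨h.trans ht.1, ht.2⟩, if_pos ⟨h, hv⟩, if_neg h.ne]; rfl
    · filter_upwards [self_mem_nhdsWithin] with t ht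
      rw [if_neg, if_neg (fun h => hv h.2), if_neg h.ne]; · rfl
      intro h'
      exact hv (lt_trans ht h'.2)
  · subst h
    filter_upwards [Ioo_mem_nhdsGT huv] with t ht
    rw [if_pos ht, if_neg (fun h => lt_irrefl _ h.1), if_pos rfl]; rfl
  · filter_upwards [Ioo_mem_nhdsGT h] with t ht
    rw [if_neg (fun h' => lt_asymm h'.1 ht.2), if_neg (fun h' => lt_asymm h'.1 h), if_neg h.ne']
    rfl

lemma euler_one {ι : Type} (s : Finset ι) (C : ι → Set ℝ) (a : ι → ℤ)
    (ho : ∀ i ∈ s, IsOpen (C i)) (hc : ∀ i ∈ s, Convex ℝ (C i))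
    (h : ∀ x, ∑ i ∈ s, a i * (if x ∈ C i then 1 else 0) = 0) :
    ∑ i ∈ s, a i * (if (C i).Nonempty then 1 else 0) = 0 := by
  set s' := s.filter fun i => (C i).Nonempty with hs'
  have hgoal : ∑ i ∈ s, a i * (if (C i).Nonempty then 1 else 0) = ∑ i ∈ s', a i := by
    rw [hs', Finset.sum_filter]
    refine Finset.sum_congr rfl fun i _ => ?_
    split_ifs <;> simp
  rw [hgoal]
  have hne : ∀ i ∈ s', (C i).Nonempty := fun i hi => (Finset.mem_filter.1 hi).2
  choose! q hq using hne
  set M := ∑ i ∈ s', |q i| + 1 with hM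
  have hqM : ∀ i ∈ s', -M < q i ∧ q i < M := by
    intro i hi
    have h1 : |q i| ≤ ∑ i ∈ s', |q i| := Finset.single_le_sum (fun i _ => abs_nonneg (q i)) hi
    exact abs_lt.1 (by linarith)
  have h_int : ∀ i ∈ s', ∃ u v, u < v ∧ C i ∩ Set.Ioo (-M) M = Set.Ioo u v := by
    intro i hi
    have his := (Finset.mem_filter.1 hi).1
    refine open_interval ((ho i his).inter isOpen_Ioo) ((hc i his).inter (convex_Ioo _ _))
      ⟨q i, hq i hi, hqM i hi⟩ (M := M) ?_
    rintro x ⟨_, h1, h2⟩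
    exact ⟨h1, h2⟩
  choose! u v huv hC using h_int
  have hrel : ∀ x, ∑ i ∈ s', a i * (if x ∈ Set.Ioo (u i) (v i) then 1 else 0) = 0 := by
    intro x
    by_cases hx : x ∈ Set.Ioo (-M) M
    · refine Eq.trans ?_ (h x)
      rw [hs', Finset.sum_filter]
      refine Finset.sum_congr rfl fun i hi => ?_
      by_cases hn : (C i).Nonempty
      · rw [if_pos hn]
        congr 1
        refine if_congr ?_ rfl rfl
        rw [← hC i (Finset.mem_filter.2 ⟨hi, hn⟩)]
        exact ⟨fun h => h.1, fun h => ⟨h, hx⟩⟩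
      · rw [if_neg hn, if_neg (fun h => hn ⟨x, h⟩), mul_zero]
    · refine Finset.sum_eq_zero fun i hi => ?_
      rw [if_neg (fun h => hx (((hC i hi).symm ▸ h : x ∈ C i ∩ Set.Ioo (-M) M)).2), mul_zero]
  have hl : ∀ l, ∑ i ∈ s' with u i = l, a i = 0 := by
    intro l
    have hev : ∀ᶠ t in nhdsWithin l (Set.Ioi l), ∀ i ∈ s',
        (if t ∈ Set.Ioo (u i) (v i) then (1 : ℤ) else 0) =
        (if l ∈ Set.Ioo (u i) (v i) then 1 else 0) + (if u i = l then 1 else 0) := by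
      rw [Filter.eventually_all_finset]
      intro i hi
      exact right_limit _ _ _ (huv i hi)
    obtain ⟨t, ht⟩ := hev.exists
    have h1 := hrel t
    rw [Finset.sum_congr rfl fun i hi => by rw [ht i hi]] at h1
    simp only [mul_add, Finset.sum_add_distrib, hrel l, zero_add] at h1
    refine Eq.trans ?_ h1
    rw [Finset.sum_filter]
    refine Finset.sum_congr rfl fun i _ => ?_
    split_ifs <;> simp
  rw [← Finset.sum_fiberwise_of_maps_to (g := u) (t := s'.image u)
    (fun i hi => Finset.mem_image_of_mem u hi)]
  exact Finset.sum_eq_zero fun l _ => hl l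

lemma euler_fin (n : ℕ) {ι : Type} (s : Finset ι) (C : ι → Set (Fin n → ℝ)) (a : ι → ℤ)
    (ho : ∀ i ∈ s, IsOpen (C i)) (hc : ∀ i ∈ s, Convex ℝ (C i))
    (h : ∀ x, ∑ i ∈ s, a i * (if x ∈ C i then 1 else 0) = 0) :
    ∑ i ∈ s, a i * (if (C i).Nonempty then 1 else 0) = 0 := by
  induction n with
  | zero =>
    refine Eq.trans ?_ (h 0)
    refine Finset.sum_congr rfl fun i _ => ?_
    congr 1
    refine if_congr ?_ rfl rfl
    constructor
    · rintro ⟨x, hx⟩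
      rwa [Subsingleton.elim (0 : Fin 0 → ℝ) x]
    · exact fun h => ⟨0, h⟩
  | succ n ih =>
    have hslice : ∀ t : ℝ, ∑ i ∈ s, a i *
        (if t ∈ (fun x : Fin (n + 1) → ℝ => x 0) '' (C i) then 1 else 0) = 0 := by
      intro t
      have hcont : Continuous fun y : Fin n → ℝ => (Fin.cons t y : Fin (n + 1) → ℝ) := by
        refine continuous_pi fun j => ?_
        refine Fin.cases ?_ (fun j => ?_) j
        · simpa using continuous_const
        · simpa using continuous_apply j
      have h1 := ih (fun i => {y | (Fin.cons t y : Fin (n + 1) → ℝ) ∈ C i})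
        (fun i hi => (ho i hi).preimage hcont) (by
          intro i hi y hy z hz b c hb hc' hbc
          have := hc i hi hy hz hb hc' hbc
          have e1 : (Fin.cons t (b • y + c • z) : Fin (n + 1) → ℝ) =
              b • (Fin.cons t y : Fin (n + 1) → ℝ) + c • (Fin.cons t z : Fin (n + 1) → ℝ) := by
            ext j
            refine Fin.cases ?_ (fun j => ?_) j
            · simp [← add_mul, hbc]
            · simp
          show (Fin.cons t (b • y + c • z) : Fin (n + 1) → ℝ) ∈ C i
          rw [e1]
          exact this) (fun y => h _)
      refine Eq.trans ?_ h1
      refine Finset.sum_congr rfl fun i _ => ?_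
      congr 1
      refine if_congr ?_ rfl rfl
      constructor
      · rintro ⟨x, hx, rfl⟩
        exact ⟨Fin.tail x, by simpa using hx⟩
      · rintro ⟨y, hy⟩
        exact ⟨_, hy, by simp⟩
    have h2 := euler_one s (fun i => (fun x : Fin (n + 1) → ℝ => x 0) '' (C i)) a
      (fun i hi => isOpenMap_eval 0 _ (ho i hi))
      (fun i hi => (hc i hi).linear_image (LinearMap.proj 0)) hslice
    simpa using h2

lemma euler_aff {α : Type} [Fintype α] (W : Submodule ℝ (α → ℝ)) (p : α → ℝ) {ι : Type}
    (s : Finset ι) (U : ι → Set (α → ℝ)) (a : ι → ℤ)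
    (ho : ∀ i ∈ s, IsOpen (U i)) (hc : ∀ i ∈ s, Convex ℝ (U i))
    (h : ∀ x, x - p ∈ W → ∑ i ∈ s, a i * (if x ∈ U i then 1 else 0) = 0) :
    ∑ i ∈ s, a i * (if ∃ x, x - p ∈ W ∧ x ∈ U i then 1 else 0) = 0 := by
  set e := (Module.finBasis ℝ W).equivFun.symm with he
  set ψ : (Fin (Module.finrank ℝ W) → ℝ) →ₗ[ℝ] (α → ℝ) := W.subtype ∘ₗ e.toLinearMap with hψ
  have hψW : ∀ y, ψ y ∈ W := fun y => (e y).2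
  have hcont : Continuous fun y => p + ψ y :=
    continuous_const.add ψ.continuous_of_finiteDimensional
  have h1 := euler_fin _ s (fun i => {y | p + ψ y ∈ U i}) a
    (fun i hi => (ho i hi).preimage hcont) (by
      intro i hi y hy z hz b c hb hc' hbc
      have := hc i hi hy hz hb hc' hbc
      have e1 : p + ψ (b • y + c • z) = b • (p + ψ y) + c • (p + ψ z) := by
        rw [map_add, map_smul, map_smul, smul_add, smul_add]
        have hp : p = b • p + c • p := by rw [← add_smul, hbc, one_smul]
        conv_lhs => rw [hp]
        abel
      show p + ψ (b • y + c • z) ∈ U i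
      rw [e1]
      exact this) (fun y => h _ (by simpa using hψW y))
  refine Eq.trans ?_ h1
  refine Finset.sum_congr rfl fun i _ => ?_
  congr 1
  refine if_congr ?_ rfl rfl
  constructor
  · rintro ⟨x, hx, hxU⟩
    refine ⟨e.symm ⟨x - p, hx⟩, ?_⟩
    show p + ψ _ ∈ U i
    simpa [hψ] using hxU
  · rintro ⟨y, hy⟩
    exact ⟨_, by simpa using hψW y, hy⟩

end Euler



section Indep
variable {α : Type} [Fintype α] [DecidableEq α]

lemma nest_tight {𝒞 : Finset (Finset α × ℤ)} {r : ℕ} (hc : NChain 𝒞)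
    (hne : (nestB 𝒞 r).Nonempty) {p : Finset α × ℤ} (hp : p ∈ 𝒞)
    (ht : ∀ B ∈ nestB 𝒞 r, ((B ∩ p.1).card : ℤ) = p.2) :
    p.1 ⊆ loopsOf (nestB 𝒞 r) ∨ p.1ᶜ ⊆ coloopsOf (nestB 𝒞 r) := by
  by_contra hcon
  push Not at hcon
  obtain ⟨h1, h2⟩ := hcon
  rw [Finset.not_subset] at h1 h2
  obtain ⟨e, he, heL⟩ := h1
  obtain ⟨f, hf, hfK⟩ := h2
  rw [mem_loopsOf] at heL
  rw [mem_coloopsOf] at hfK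
  push Not at heL hfK
  obtain ⟨B₁, hB₁, heB₁⟩ := heL
  obtain ⟨B₂, hB₂, hfB₂⟩ := hfK
  have hcard : ∀ B ∈ nestB 𝒞 r, (B ∩ p.1).card + (B ∩ p.1ᶜ).card = r := by
    intro B hB
    rw [← (mem_nestB.1 hB).1, ← Finset.sdiff_eq_inter_compl]
    exact Finset.card_inter_add_card_sdiff B p.1
  -- choose an element to remove from `B₁`
  have hlt : (B₁ ∩ p.1ᶜ).card < (p.1ᶜ).card := by
    have e1 : (B₁ ∩ p.1ᶜ).card = (B₂ ∩ p.1ᶜ).card := by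
      have a1 := ht _ hB₁
      have a2 := ht _ hB₂
      have a3 := hcard _ hB₁
      have a4 := hcard _ hB₂
      omega
    rw [e1]
    refine Finset.card_lt_card ⟨Finset.inter_subset_right, fun h => ?_⟩
    exact hfB₂ (Finset.mem_inter.1 (h hf)).1
  obtain ⟨f', hf', hf'B⟩ : ∃ f' ∈ p.1ᶜ, f' ∉ B₁ := by
    by_contra hcon
    push Not at hcon
    have : B₁ ∩ p.1ᶜ = p.1ᶜ := Finset.inter_eq_right.2 hcon
    rw [this] at hlt
    exact lt_irrefl _ hlt
  rw [Finset.mem_compl] at hf'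
  have hex := nest_exchange hB₁ heB₁ hf'B (by
    intro q hq heq hfq
    rcases hc q hq p hp with h | h
    · exact absurd (h hfq) hf'
    · exact absurd (h he) heq)
  have h3 := card_exchange (Y := p.1) heB₁ hf'B
  rw [if_pos he, if_neg hf'] at h3
  have h4 := ht _ hex
  have h5 := ht _ hB₁
  omega

/-- The constraints of a nested matroid which are not always tight. -/
noncomputable def strictPart (𝒞 : Finset (Finset α × ℤ)) (r : ℕ) : Finset (Finset α × ℤ) :=
  𝒞.filter fun p => ∃ B ∈ nestB 𝒞 r, ((B ∩ p.1).card : ℤ) < p.2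

lemma base_loop {ℬ : Finset (Finset α)} {x : α → ℝ} (hx : x ∈ basePolytopeOn α ℬ) {a : α}
    (ha : a ∈ loopsOf ℬ) : x a = 0 := by
  have h1 := base_le (X := {a}) (k := 0) (fun B hB => by
    rw [Finset.inter_singleton_of_notMem (mem_loopsOf.1 ha B hB)]; simp) hx
  have h2 := base_ge (X := {a}) (k := 0) (fun B hB => by
    rw [Finset.inter_singleton_of_notMem (mem_loopsOf.1 ha B hB)]; simp) hx
  rw [Finset.sum_singleton] at h1 h2
  linarith

lemma base_coloop {ℬ : Finset (Finset α)} {x : α → ℝ} (hx : x ∈ basePolytopeOn α ℬ) {a : α}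
    (ha : a ∈ coloopsOf ℬ) : x a = 1 := by
  have h1 := base_le (X := {a}) (k := 1) (fun B hB => by
    rw [Finset.inter_singleton_of_mem (mem_coloopsOf.1 ha B hB)]; simp) hx
  have h2 := base_ge (X := {a}) (k := 1) (fun B hB => by
    rw [Finset.inter_singleton_of_mem (mem_coloopsOf.1 ha B hB)]; simp) hx
  rw [Finset.sum_singleton] at h1 h2
  linarith

lemma nest_Cset {𝒞 : Finset (Finset α × ℤ)} {r : ℕ} (hc : NChain 𝒞)
    (hne : (nestB 𝒞 r).Nonempty) :
    basePolytopeOn α (nestB 𝒞 r) =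
      Cset (loopsOf (nestB 𝒞 r)) (coloopsOf (nestB 𝒞 r)) r (strictPart 𝒞 r) := by
  apply Set.Subset.antisymm
  · intro x hx
    have hx' := hx
    rw [nest_poly hc] at hx'
    exact ⟨hx'.2.1, fun a ha => base_loop hx ha, fun a ha => base_coloop hx ha,
      fun a _ _ => hx'.1 a, fun p hp => hx'.2.2 p (Finset.mem_filter.1 hp).1⟩
  · rintro x ⟨h1, hL, hK, h2, h3⟩
    rw [nest_poly hc]
    refine ⟨fun a => ?_, h1, fun p hp => ?_⟩
    · by_cases ha : a ∈ loopsOf (nestB 𝒞 r)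
      · simp [hL a ha]
      · by_cases ha' : a ∈ coloopsOf (nestB 𝒞 r)
        · simp [hK a ha']
        · exact h2 a ha ha'
    · by_cases hs : p ∈ strictPart 𝒞 r
      · exact h3 p hs
      · have ht : ∀ B ∈ nestB 𝒞 r, ((B ∩ p.1).card : ℤ) = p.2 := by
          intro B hB
          refine le_antisymm ((mem_nestB.1 hB).2 p hp) ?_
          by_contra hlt
          exact hs (Finset.mem_filter.2 ⟨hp, B, hB, not_le.1 hlt⟩)
        obtain ⟨B, hB⟩ := id hne
        have htB := ht B hB
        rcases nest_tight hc hne hp ht with h | h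
        · rw [Finset.sum_eq_zero fun a ha => hL a (h ha), ← htB]
          simp
        · have e1 : ∑ a ∈ p.1, x a + ∑ a ∈ p.1ᶜ, x a = ∑ a, x a := Finset.sum_add_sum_compl p.1 x
          rw [h1, Finset.sum_congr (s₁ := p.1ᶜ) rfl fun a ha => hK a (h ha)] at e1
          have e2 : (B ∩ p.1).card + (p.1ᶜ).card = r := by
            have e3 : B ∩ p.1ᶜ = p.1ᶜ :=
              Finset.inter_eq_right.2 fun a ha => mem_coloopsOf.1 (h ha) B hB
            rw [← (mem_nestB.1 hB).1, ← e3, ← Finset.sdiff_eq_inter_compl]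
            exact Finset.card_inter_add_card_sdiff B p.1
          have e2' : ((B ∩ p.1).card : ℝ) + (p.1ᶜ).card = r := by exact_mod_cast e2
          have htB' : ((B ∩ p.1).card : ℝ) = p.2 := by exact_mod_cast htB
          simp only [Finset.sum_const, nsmul_eq_mul, mul_one] at e1
          linarith

lemma bary_Oset {𝒞 : Finset (Finset α × ℤ)} {r : ℕ} (hc : NChain 𝒞)
    (hne : (nestB 𝒞 r).Nonempty) :
    bary (nestB 𝒞 r) ∈
      Oset (loopsOf (nestB 𝒞 r)) (coloopsOf (nestB 𝒞 r)) r (strictPart 𝒞 r) := by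
  have hb := bary_mem hne
  rw [nest_Cset hc hne] at hb
  obtain ⟨h1, h2, h3, h4, h5⟩ := hb
  refine ⟨⟨h1, h2, h3, ?_⟩, ?_⟩
  · intro a haL haK
    rw [mem_loopsOf] at haL
    rw [mem_coloopsOf] at haK
    push Not at haL haK
    obtain ⟨B₁, hB₁, haB₁⟩ := haL
    obtain ⟨B₂, hB₂, haB₂⟩ := haK
    constructor
    · have := bary_gt (ℬ := nestB 𝒞 r) (X := {a}) (k := 0) (fun B _ => by positivity)
        ⟨B₁, hB₁, by rw [Finset.inter_singleton_of_mem haB₁]; simp⟩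
      simpa using this
    · have := bary_lt (ℬ := nestB 𝒞 r) (X := {a}) (k := 1) (fun B _ => by
        have : (B ∩ {a}).card ≤ 1 := (Finset.card_le_card Finset.inter_subset_right).trans (by simp)
        exact_mod_cast this)
        ⟨B₂, hB₂, by rw [Finset.inter_singleton_of_notMem haB₂]; simp⟩
      simpa using this
  · intro p hp
    obtain ⟨hp1, B, hB, hlt⟩ := Finset.mem_filter.1 hp
    exact bary_lt (fun B hB => by exact_mod_cast (mem_nestB.1 hB).2 p hp1)
      ⟨B, hB, by exact_mod_cast hlt⟩

lemma nest_relint {𝒞 : Finset (Finset α × ℤ)} {r : ℕ} (hc : NChain 𝒞)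
    (hne : (nestB 𝒞 r).Nonempty) :
    intrinsicInterior ℝ (basePolytopeOn α (nestB 𝒞 r)) =
      Oset (loopsOf (nestB 𝒞 r)) (coloopsOf (nestB 𝒞 r)) r (strictPart 𝒞 r) := by
  rw [nest_Cset hc hne]
  exact relint_Cset _ _ _ _ _ (bary_Oset hc hne)

lemma key_lemma {ι P : Type} [PartialOrder P] (s : Finset ι) (key : ι → P) (a : ι → ℤ)
    (h : ∀ κ, ∑ i ∈ s with κ ≤ key i, a i = 0) (κ : P) : ∑ i ∈ s with key i = κ, a i = 0 := by
  by_contra hcon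
  have hbad : ((s.image key).filter fun κ => ∑ i ∈ s with key i = κ, a i ≠ 0).Nonempty := by
    refine ⟨κ, Finset.mem_filter.2 ⟨?_, hcon⟩⟩
    by_contra hk
    apply hcon
    rw [Finset.filter_false_of_mem, Finset.sum_empty]
    intro i hi hik
    exact hk (Finset.mem_image.2 ⟨i, hi, hik⟩)
  obtain ⟨m, hm⟩ := Finset.exists_maximal hbad
  have hm1 := (Finset.mem_filter.1 hm.1)
  apply hm1.2
  have h1 := h m
  rw [← Finset.sum_fiberwise_of_maps_to (g := key) (t := s.image key)
    (fun i hi => Finset.mem_image_of_mem key (Finset.mem_filter.1 hi).1)] at h1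
  rw [Finset.sum_eq_single_of_mem m hm1.1] at h1
  · rw [← h1]
    refine Finset.sum_congr ?_ fun _ _ => rfl
    ext i
    simp only [Finset.mem_filter]
    constructor
    · rintro ⟨h2, h3⟩; exact ⟨⟨h2, h3.ge⟩, h3⟩
    · rintro ⟨⟨h2, _⟩, h3⟩; exact ⟨h2, h3⟩
  · intro κ' hκ' hne
    by_cases hle : m ≤ κ'
    · by_contra hcon2
      have hmem : κ' ∈ (s.image key).filter fun κ => ∑ i ∈ s with key i = κ, a i ≠ 0 := by
        refine Finset.mem_filter.2 ⟨hκ', fun h0 => hcon2 ?_⟩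
        rw [← h0]
        refine Finset.sum_congr ?_ fun _ _ => rfl
        ext i
        simp only [Finset.mem_filter]
        constructor
        · rintro ⟨⟨h2, _⟩, h3⟩; exact ⟨h2, h3⟩
        · rintro ⟨h2, h3⟩; exact ⟨⟨h2, by rw [h3]; exact hle⟩, h3⟩
      exact hne (le_antisymm (hm.2 hmem hle) hle)
    · apply Finset.sum_eq_zero
      intro i hi
      exfalso
      simp only [Finset.mem_filter] at hi
      exact hle (hi.2 ▸ hi.1.2)

end Indep



section IndepMain
variable {α : Type} [Fintype α] [DecidableEq α]

/-- Open convex set of strict inequalities. -/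
def Uset (L K : Finset α) (T : Finset (Finset α × ℤ)) (𝒳 : Finset (Finset α))
    (σ : Finset α → ℕ) : Set (α → ℝ) :=
  {x | (∀ a, a ∉ L → a ∉ K → 0 < x a ∧ x a < 1) ∧ (∀ p ∈ T, ∑ a ∈ p.1, x a < (p.2 : ℝ)) ∧
    ∀ X ∈ 𝒳, (σ X : ℝ) - 1 < ∑ a ∈ X, x a}

lemma Uset_open (L K : Finset α) (T : Finset (Finset α × ℤ)) (𝒳 : Finset (Finset α))
    (σ : Finset α → ℕ) : IsOpen (Uset L K T 𝒳 σ) := by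
  simp only [Uset, Set.ofPred_and, Set.ofPred_forall]
  refine IsOpen.inter ?_ (IsOpen.inter ?_ ?_)
  · refine isOpen_iInter_of_finite fun a => isOpen_iInter_of_finite fun _ =>
      isOpen_iInter_of_finite fun _ => IsOpen.inter ?_ ?_
    · exact isOpen_lt (by fun_prop) (by fun_prop)
    · exact isOpen_lt (by fun_prop) (by fun_prop)
  · exact isOpen_biInter_finset fun p _ => isOpen_lt (by fun_prop) (by fun_prop)
  · exact isOpen_biInter_finset fun p _ => isOpen_lt (by fun_prop) (by fun_prop)

lemma Uset_convex (L K : Finset α) (T : Finset (Finset α × ℤ)) (𝒳 : Finset (Finset α))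
    (σ : Finset α → ℕ) : Convex ℝ (Uset L K T 𝒳 σ) := by
  intro x hx y hy b c hb hc hbc
  have hsum : ∀ X : Finset α, ∑ i ∈ X, (b • x + c • y) i =
      b • ∑ i ∈ X, x i + c • ∑ i ∈ X, y i := by
    intro X
    simp [Finset.sum_add_distrib, Finset.mul_sum]
  refine ⟨fun a h1 h2 => ⟨?_, ?_⟩, fun p hp => ?_, fun X hX => ?_⟩
  · exact (convex_Ioi (0 : ℝ)) (hx.1 a h1 h2).1 (hy.1 a h1 h2).1 hb hc hbc
  · exact (convex_Iio (1 : ℝ)) (hx.1 a h1 h2).2 (hy.1 a h1 h2).2 hb hc hbc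
  · rw [hsum]
    exact (convex_Iio (p.2 : ℝ)) (hx.2.1 p hp) (hy.2.1 p hp) hb hc hbc
  · rw [hsum]
    exact (convex_Ioi ((σ X : ℝ) - 1)) (hx.2.2 X hX) (hy.2.2 X hX) hb hc hbc

/-- The direction space of the affine space of a cell. -/
def Wsub (L K : Finset α) : Submodule ℝ (α → ℝ) where
  carrier := {v | ∑ a, v a = 0 ∧ (∀ a ∈ L, v a = 0) ∧ ∀ a ∈ K, v a = 0}
  add_mem' := by
    rintro v w ⟨h1, h2, h3⟩ ⟨h4, h5, h6⟩
    refine ⟨?_, fun a ha => ?_, fun a ha => ?_⟩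
    · simp [Finset.sum_add_distrib, h1, h4]
    · simp [h2 a ha, h5 a ha]
    · simp [h3 a ha, h6 a ha]
  zero_mem' := by refine ⟨?_, ?_, ?_⟩ <;> simp
  smul_mem' := by
    rintro c v ⟨h1, h2, h3⟩
    refine ⟨?_, fun a ha => ?_, fun a ha => ?_⟩
    · simp [← Finset.mul_sum, h1]
    · simp [h2 a ha]
    · simp [h3 a ha]

lemma Wsub_iff {L K : Finset α} {r : ℕ} {p : α → ℝ} (hp : p ∈ Qset L K r) (x : α → ℝ) :
    x - p ∈ Wsub L K ↔ ∑ a, x a = r ∧ (∀ a ∈ L, x a = 0) ∧ ∀ a ∈ K, x a = 1 := by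
  have h0 : x - p ∈ Wsub L K ↔ ∑ a, (x - p) a = 0 ∧ (∀ a ∈ L, (x - p) a = 0) ∧
    ∀ a ∈ K, (x - p) a = 0 := Iff.rfl
  rw [h0]
  simp only [Pi.sub_apply, Finset.sum_sub_distrib, hp.1, sub_eq_zero]
  refine and_congr Iff.rfl (and_congr ?_ ?_)
  · exact forall₂_congr fun a ha => by rw [hp.2.1 a ha]
  · exact forall₂_congr fun a ha => by rw [hp.2.2.1 a ha]

lemma WU_iff {L K : Finset α} {r : ℕ} {p : α → ℝ} (hp : p ∈ Qset L K r) (x : α → ℝ)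
    (T : Finset (Finset α × ℤ)) (𝒳 : Finset (Finset α)) (σ : Finset α → ℕ) :
    x - p ∈ Wsub L K ∧ x ∈ Uset L K T 𝒳 σ ↔
      x ∈ Oset L K r T ∧ ∀ X ∈ 𝒳, (σ X : ℝ) - 1 < ∑ a ∈ X, x a := by
  rw [Wsub_iff hp]
  constructor
  · rintro ⟨⟨h1, h2, h3⟩, h4, h5, h6⟩
    exact ⟨⟨⟨h1, h2, h3, h4⟩, h5⟩, h6⟩
  · rintro ⟨⟨⟨h1, h2, h3, h4⟩, h5⟩, h6⟩
    exact ⟨⟨h1, h2, h3⟩, h4, h5, h6⟩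

lemma nonempty_iff {𝒞 : Finset (Finset α × ℤ)} {r : ℕ} (hc : NChain 𝒞)
    (hne : (nestB 𝒞 r).Nonempty) (𝒳 : Finset (Finset α))
    (h𝒳 : ∀ X ∈ 𝒳, ∀ Y ∈ 𝒳, X ⊆ Y ∨ Y ⊆ X) (σ : Finset α → ℕ) :
    (∃ x, x ∈ Oset (loopsOf (nestB 𝒞 r)) (coloopsOf (nestB 𝒞 r)) r (strictPart 𝒞 r) ∧
      ∀ X ∈ 𝒳, (σ X : ℝ) - 1 < ∑ a ∈ X, x a) ↔ ∀ X ∈ 𝒳, σ X ≤ rk (nestB 𝒞 r) X := by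
  constructor
  · rintro ⟨x, hx, h⟩ X hX
    rw [← nest_relint hc hne] at hx
    have h1 := base_le (k := rk (nestB 𝒞 r) X)
      (fun B hB => by exact_mod_cast le_rk hB X) (intrinsicInterior_subset hx)
    have h2 := h X hX
    have h3 : (σ X : ℝ) < ((rk (nestB 𝒞 r) X + 1 : ℕ) : ℝ) := by push_cast; linarith
    have h4 : σ X < rk (nestB 𝒞 r) X + 1 := by exact_mod_cast h3
    omega
  · intro h
    obtain ⟨B, hB, hBr⟩ := rk_greedy (nest_bf hc hne) 𝒳 h𝒳
    obtain ⟨⟨q1, q2, q3, q4⟩, q5⟩ := bary_Oset hc hne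
    have hv := vertex_mem hB
    rw [nest_Cset hc hne] at hv
    obtain ⟨v1, v2, v3, v4, v5⟩ := hv
    set q := bary (nestB 𝒞 r)
    set v := basisVectorOn α B with hvdef
    obtain ⟨t, ht0, ht1, ht⟩ : ∃ t : ℝ, 0 < t ∧ t ≤ 1 ∧ t * Fintype.card α < 1 := by
      refine ⟨1 / (Fintype.card α + 1), by positivity, ?_, ?_⟩
      · rw [div_le_one (by positivity)]
        have : (0 : ℝ) ≤ Fintype.card α := by positivity
        linarith
      · rw [div_mul_eq_mul_div, one_mul, div_lt_one (by positivity)]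
        linarith
    have hsum : ∀ X : Finset α, ∑ i ∈ X, ((1 - t) • v + t • q) i =
        (1 - t) * ∑ i ∈ X, v i + t * ∑ i ∈ X, q i := by
      intro X
      simp [Finset.sum_add_distrib, Finset.mul_sum]
    have happ : ∀ a, ((1 - t) • v + t • q) a = (1 - t) * v a + t * q a := fun a => rfl
    refine ⟨(1 - t) • v + t • q, ⟨⟨?_, ?_, ?_, ?_⟩, ?_⟩, ?_⟩
    · rw [hsum, v1, q1]; ring
    · intro a ha
      rw [happ, v2 a ha, q2 a ha]; ring
    · intro a ha
      rw [happ, v3 a ha, q3 a ha]; ring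
    · intro a h1 h2
      rw [happ]
      have a1 := v4 a h1 h2
      have a2 := q4 a h1 h2
      constructor
      · have := mul_pos ht0 a2.1
        have := mul_nonneg (sub_nonneg.2 ht1) a1.1
        linarith
      · have := mul_lt_mul_of_pos_left a2.2 ht0
        have := mul_le_mul_of_nonneg_left a1.2 (sub_nonneg.2 ht1)
        linarith
    · intro p hp
      rw [hsum]
      have := mul_lt_mul_of_pos_left (q5 p hp) ht0
      have := mul_le_mul_of_nonneg_left (v5 p hp) (sub_nonneg.2 ht1)
      linarith
    · intro X hX
      rw [hsum, hvdef, sum_basisVectorOn]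
      have hq : 0 ≤ ∑ a ∈ X, q a :=
        base_ge (k := 0) (fun B _ => by positivity) (bary_mem hne)
      have h1 : ((B ∩ X).card : ℝ) ≤ Fintype.card α := by
        exact_mod_cast Finset.card_le_univ _
      have h2 : (σ X : ℝ) ≤ (B ∩ X).card := by
        rw [hBr X hX]; exact_mod_cast h X hX
      have h3 := mul_nonneg ht0.le hq
      have h4 := mul_le_mul_of_nonneg_left h1 ht0.le
      linarith

lemma indep_aux {ι : Type} (β : ι → Finset (Finset α)) (hinj : Function.Injective β)
    (s : Finset ι) (hs : ∀ i ∈ s, IsSchubertFamilyOn α (β i)) (a : ι → ℤ)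
    (hrel : ∀ x, ∑ i ∈ s, a i * relintIndOn α (β i) x = 0) : ∀ i ∈ s, a i = 0 := by
  by_contra hcon
  push Not at hcon
  obtain ⟨j, hj, haj⟩ := hcon
  obtain ⟨i₀, hi₀, hmin⟩ := Finset.exists_min_image (s.filter fun i => a i ≠ 0)
    (fun i => (β i).card) ⟨j, Finset.mem_filter.2 ⟨hj, haj⟩⟩
  rw [Finset.mem_filter] at hi₀
  apply hi₀.2
  have hnest := fun i hi => schubert_nest (hs i hi)
  choose! 𝒞 r hc hne hβ using hnest
  set L := fun i => loopsOf (β i) with hL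
  set K := fun i => coloopsOf (β i) with hK
  have hO : ∀ i ∈ s, intrinsicInterior ℝ (basePolytopeOn α (β i)) =
      Oset (L i) (K i) (r i) (strictPart (𝒞 i) (r i)) := by
    intro i hi
    have := nest_relint (hc i hi) (hne i hi)
    rw [← hβ i hi] at this
    exact this
  have hp : bary (β i₀) ∈ Qset (L i₀) (K i₀) (r i₀) := by
    have := bary_Oset (hc i₀ hi₀.1) (hne i₀ hi₀.1)
    rw [← hβ i₀ hi₀.1] at this
    exact this.1
  -- same type
  have htype : ∀ i, ∀ x, x ∈ Qset (L i) (K i) (r i) → x ∈ Qset (L i₀) (K i₀) (r i₀) →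
      L i = L i₀ ∧ K i = K i₀ ∧ r i = r i₀ := by
    have aux : ∀ i, ∀ x, x ∈ Qset (L i) (K i) (r i) →
        L i = (Finset.univ.filter fun b => x b = 0) ∧
        K i = (Finset.univ.filter fun b => x b = 1) := by
      rintro i x ⟨h1, h2, h3, h4⟩
      constructor
      · ext b
        simp only [Finset.mem_filter, Finset.mem_univ, true_and]
        refine ⟨h2 b, fun hb => ?_⟩
        by_contra hbL
        by_cases hbK : b ∈ K i
        · have := h3 b hbK; rw [hb] at this; norm_num at this
        · have := (h4 b hbL hbK).1; linarith
      · ext b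
        simp only [Finset.mem_filter, Finset.mem_univ, true_and]
        refine ⟨h3 b, fun hb => ?_⟩
        by_contra hbK
        by_cases hbL : b ∈ L i
        · have := h2 b hbL; rw [hb] at this; norm_num at this
        · have := (h4 b hbL hbK).2; linarith
    intro i x hx hx0
    obtain ⟨h1, h2⟩ := aux i x hx
    obtain ⟨h3, h4⟩ := aux i₀ x hx0
    refine ⟨h1.trans h3.symm, h2.trans h4.symm, ?_⟩
    have := hx.1.symm.trans hx0.1
    exact_mod_cast this
  set s' := s.filter fun i => a i ≠ 0 ∧ L i = L i₀ ∧ K i = K i₀ ∧ r i = r i₀ with hs'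
  set 𝒳 := (𝒞 i₀).image Prod.fst with h𝒳
  have h𝒳c : ∀ X ∈ 𝒳, ∀ Y ∈ 𝒳, X ⊆ Y ∨ Y ⊆ X := by
    intro X hX Y hY
    obtain ⟨p, hp, rfl⟩ := Finset.mem_image.1 hX
    obtain ⟨q, hq, rfl⟩ := Finset.mem_image.1 hY
    exact hc i₀ hi₀.1 p hp q hq
  have hrel' : ∀ x ∈ Qset (L i₀) (K i₀) (r i₀), ∑ i ∈ s', a i *
      (if x ∈ Oset (L i₀) (K i₀) (r i₀) (strictPart (𝒞 i) (r i)) then 1 else 0) = 0 := by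
    intro x hx
    refine Eq.trans ?_ (hrel x)
    rw [hs', Finset.sum_filter]
    refine Finset.sum_congr rfl fun i hi => ?_
    by_cases hcase : a i ≠ 0 ∧ L i = L i₀ ∧ K i = K i₀ ∧ r i = r i₀
    · rw [if_pos hcase, relintIndOn, hO i hi]
      obtain ⟨_, h1, h2, h3⟩ := hcase
      rw [h1, h2, h3]
    · rw [if_neg hcase]
      by_cases ha : a i = 0
      · rw [ha, zero_mul]
      · rw [relintIndOn, hO i hi, if_neg, mul_zero]
        intro hxO
        exact hcase ⟨ha, htype i x hxO.1 hx⟩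
  have hN : ∀ σ : Finset α → ℕ, ∑ i ∈ s', a i * (if ∀ X ∈ 𝒳, σ X ≤ rk (β i) X then 1 else 0) = 0 := by
    intro σ
    have h1 := euler_aff (Wsub (L i₀) (K i₀)) (bary (β i₀)) s'
      (fun i => Uset (L i₀) (K i₀) (strictPart (𝒞 i) (r i)) 𝒳 σ) a
      (fun i _ => Uset_open _ _ _ _ _) (fun i _ => Uset_convex _ _ _ _ _) (by
        intro x hx
        by_cases hcase : x ∈ Qset (L i₀) (K i₀) (r i₀) ∧ ∀ X ∈ 𝒳, (σ X : ℝ) - 1 < ∑ a ∈ X, x a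
        · refine Eq.trans ?_ (hrel' x hcase.1)
          refine Finset.sum_congr rfl fun i _ => ?_
          congr 1
          refine if_congr ?_ rfl rfl
          have := WU_iff hp x (strictPart (𝒞 i) (r i)) 𝒳 σ
          constructor
          · intro hU
            exact (this.1 ⟨hx, hU⟩).1
          · intro hU
            exact (this.2 ⟨hU, hcase.2⟩).2
        · refine Finset.sum_eq_zero fun i _ => ?_
          rw [if_neg, mul_zero]
          intro hU
          have := (WU_iff hp x (strictPart (𝒞 i) (r i)) 𝒳 σ).1 ⟨hx, hU⟩
          exact hcase ⟨this.1.1, this.2⟩)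
    refine Eq.trans ?_ h1
    refine Finset.sum_congr rfl fun i hi => ?_
    congr 1
    refine if_congr ?_ rfl rfl
    obtain ⟨his, _, t1, t2, t3⟩ := Finset.mem_filter.1 hi
    have h2 := nonempty_iff (hc i his) (hne i his) 𝒳 h𝒳c σ
    rw [← hβ i his] at h2
    rw [← h2]
    refine exists_congr fun x => ?_
    rw [WU_iff hp, ← t1, ← t2, ← t3]
  have hkey := key_lemma s' (fun i X => if X ∈ 𝒳 then rk (β i) X else 0) a (by
    intro κ
    by_cases hκ : ∀ X, X ∉ 𝒳 → κ X = 0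
    · refine Eq.trans ?_ (hN κ)
      rw [Finset.sum_filter]
      refine Finset.sum_congr rfl fun i _ => ?_
      rw [mul_ite, mul_one, mul_zero]
      refine if_congr ?_ rfl rfl
      constructor
      · intro h X hX
        have := h X
        simpa [hX] using this
      · intro h X
        by_cases hX : X ∈ 𝒳
        · simpa [hX] using h X hX
        · simp [hX, hκ X hX]
    · push Not at hκ
      obtain ⟨X, hX, hX0⟩ := hκ
      rw [Finset.filter_false_of_mem, Finset.sum_empty]
      intro i _ hle
      have := hle X
      simp [hX] at this
      exact hX0 this) (fun X => if X ∈ 𝒳 then rk (β i₀) X else 0)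
  have hsingle : (s'.filter fun i => (fun X => if X ∈ 𝒳 then rk (β i) X else 0) =
      (fun X => if X ∈ 𝒳 then rk (β i₀) X else 0)) = {i₀} := by
    ext i
    rw [Finset.mem_filter, Finset.mem_singleton]
    constructor
    · rintro ⟨hi, heq⟩
      obtain ⟨his, hai, t1, t2, t3⟩ := Finset.mem_filter.1 hi
      apply hinj
      refine Finset.eq_of_subset_of_card_le ?_ (hmin i (Finset.mem_filter.2 ⟨his, hai⟩))
      intro B hB
      rw [hβ i₀ hi₀.1, mem_nestB]
      have hB' := hB
      rw [hβ i his, mem_nestB] at hB'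
      refine ⟨hB'.1.trans t3, fun p hp => ?_⟩
      have hpX : p.1 ∈ 𝒳 := Finset.mem_image_of_mem _ hp
      have h1 := congrFun heq p.1
      simp only [hpX, if_true] at h1
      have h2 := le_rk hB p.1
      rw [h1] at h2
      obtain ⟨B', hB', hBr⟩ := rk_greedy (nest_bf (hc i₀ hi₀.1) (hne i₀ hi₀.1)) {p.1} (by simp)
      have h3 := (mem_nestB.1 hB').2 p hp
      rw [hBr p.1 (by simp), ← hβ i₀ hi₀.1] at h3
      exact le_trans (by exact_mod_cast h2) h3
    · rintro rfl
      exact ⟨Finset.mem_filter.2 ⟨hi₀.1, hi₀.2, rfl, rfl, rfl⟩, rfl⟩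
  rw [← Finset.sum_singleton a i₀]
  refine Eq.trans ?_ hkey
  refine Finset.sum_congr ?_ fun _ _ => rfl
  rw [← hsingle]
  ext i
  simp only [Finset.mem_filter]

lemma indep_part (α : Type) [Fintype α] [DecidableEq α] : LinearIndependent ℤ
      (fun f : {f : (α → ℝ) → ℤ |
          ∃ ℬ, IsSchubertFamilyOn α ℬ ∧ f = relintIndOn α ℬ} => (f : (α → ℝ) → ℤ)) := by
  rw [linearIndependent_iff']
  intro s g hg
  have hex : ∀ f : {f : (α → ℝ) → ℤ | ∃ ℬ, IsSchubertFamilyOn α ℬ ∧ f = relintIndOn α ℬ},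
      ∃ ℬ, IsSchubertFamilyOn α ℬ ∧ f.1 = relintIndOn α ℬ := fun f => f.2
  choose β hβ1 hβ2 using hex
  refine indep_aux β ?_ s (fun i _ => hβ1 i) g ?_
  · intro f f' hff
    apply Subtype.ext
    rw [hβ2 f, hβ2 f', hff]
  · intro x
    have := congrFun hg x
    rw [Finset.sum_apply] at this
    refine Eq.trans ?_ this
    refine Finset.sum_congr rfl fun i _ => ?_
    rw [← hβ2 i]
    rfl

end IndepMain


/-- For a finite set `E` (here, the type `α`), the set of indicator
functions of relative interiors of base polytopes of Schubert matroids on `E` (over all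
linear orderings and all choices of `U`) is linearly independent over `ℤ`, and its
`ℤ`-linear span equals the `ℤ`-linear span of the indicator functions of relative
interiors of base polytopes of arbitrary matroids on `E`. -/
theorem statement9 (α : Type) [Fintype α] [DecidableEq α] :
    LinearIndependent ℤ
      (fun f : {f : (α → ℝ) → ℤ |
          ∃ ℬ, IsSchubertFamilyOn α ℬ ∧ f = relintIndOn α ℬ} => (f : (α → ℝ) → ℤ)) ∧
    Submodule.span ℤ
        {f : (α → ℝ) → ℤ | ∃ ℬ, IsSchubertFamilyOn α ℬ ∧ f = relintIndOn α ℬ}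
      = Submodule.span ℤ
          {f : (α → ℝ) → ℤ | ∃ ℬ, IsBasisFamilyOn α ℬ ∧ f = relintIndOn α ℬ} := by
  exact ⟨indep_part α, span_part⟩
end GPoly
end

section
/- Let 1 ≤ r ≤ n−1 and let M = SM({1,…,r}) be the uniform matroid U_{r,n} viewed as a Schubert matroid on [n]. Then, in ℤ[t], the sum over all bases B of M with e(B) = 1 and i(B) = 0 of (1+t)^{α(B)} equals Σ_{i=0}^{min(r−1, n−r−1)} C(n−2−i, i) · C(n−2−2i, r−1−i) · t^i. -/
open scoped Classical

namespace GPoly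

lemma rangeForallLe (l : List ℕ) : ∀ a : ℕ, l.Pairwise (· < ·) → (∀ x ∈ l, a ≤ x) →
    List.Forall₂ (· ≤ ·) (List.range' a l.length) l := by
  induction l with
  | nil => intro a _ _; simp
  | cons b l ih =>
    intro a h hb
    rw [List.pairwise_cons] at h
    simp only [List.length_cons, List.range'_succ]
    have hab : a ≤ b := hb b (by simp)
    refine List.Forall₂.cons hab (ih (a + 1) h.2 ?_)
    intro x hx
    have := h.1 x hx
    omega

lemma sort_Icc_one (r : ℕ) : (Finset.Icc 1 r).sort (· ≤ ·) = List.range' 1 r := by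
  apply List.Perm.eq_of_pairwise' (r := (· ≤ ·))
  · exact Finset.pairwise_sort _ _
  · exact (List.pairwise_lt_range' (s := 1) (n := r)).imp (fun h => le_of_lt h)
  · rw [List.perm_ext_iff_of_nodup (Finset.sort_nodup _ _) (List.nodup_range')]
    intro x
    simp only [Finset.mem_sort, Finset.mem_Icc, List.mem_range'_1]
    omega

lemma schubert_uniform (n r : ℕ) :
    schubertBases n r (Finset.Icc 1 r) = Finset.powersetCard r (Finset.Icc 1 n) := by
  ext B
  simp only [schubertBases, Finset.mem_filter, Finset.mem_powerset, Finset.mem_powersetCard]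
  constructor
  · rintro ⟨h, h', _⟩; exact ⟨h, h'⟩
  · rintro ⟨h, h'⟩
    refine ⟨h, h', ?_⟩
    unfold galeLe
    rw [sort_Icc_one]
    have := rangeForallLe (B.sort (· ≤ ·)) 1 (Finset.sortedLT_sort B).pairwise (by
      intro x hx
      exact (Finset.mem_Icc.1 (h ((Finset.mem_sort _).1 hx))).1)
    rwa [Finset.length_sort, h'] at this

lemma extActive_uniform (E : Finset ℕ) (r : ℕ) (B : Finset ℕ)
    (hB : B ∈ Finset.powersetCard r E) (e : ℕ) :
    ExtActive E (Finset.powersetCard r E) B e ↔ e ∈ E ∧ e ∉ B ∧ ∀ x ∈ B, e < x := by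
  rw [Finset.mem_powersetCard] at hB
  obtain ⟨hBE, hBc⟩ := hB
  unfold ExtActive
  refine and_congr_right fun heE => and_congr_right fun heB => ?_
  have hcard : (insert e B).card = r + 1 := by rw [Finset.card_insert_of_notMem heB, hBc]
  have hsub : insert e B ⊆ E := Finset.insert_subset heE hBE
  have hind : ∀ S ⊆ E, S.card ≤ r → famIndep (Finset.powersetCard r E) S := by
    intro S hS hc
    obtain ⟨T, h1, h2, h3⟩ := Finset.exists_subsuperset_card_eq hS hc
      (hBc ▸ Finset.card_le_card hBE)
    exact ⟨T, Finset.mem_powersetCard.2 ⟨h2, h3⟩, h1⟩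
  constructor
  · rintro ⟨C, hC, hcirc, heC, hmin⟩ x hx
    have hCeq : C = insert e B := by
      apply Finset.eq_of_subset_of_card_le hC
      by_contra hlt
      exact hcirc.1 (hind C (hC.trans hsub) (by omega))
    have := hmin x (by rw [hCeq]; exact Finset.mem_insert_of_mem hx)
    have hne : e ≠ x := fun h => heB (h ▸ hx)
    omega
  · intro h
    refine ⟨insert e B, subset_rfl, ⟨?_, ?_⟩, Finset.mem_insert_self _ _, ?_⟩
    · rintro ⟨B', hB', hsub'⟩
      have := Finset.card_le_card hsub'
      rw [(Finset.mem_powersetCard.1 hB').2] at this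
      omega
    · intro C' hC'
      have := Finset.card_lt_card hC'
      exact hind C' (hC'.1.trans hsub) (by omega)
    · intro x hx
      rcases Finset.mem_insert.1 hx with rfl | hx
      · exact le_rfl
      · exact (h x hx).le

lemma famDual_uniform (E : Finset ℕ) (r : ℕ) (hr : r ≤ E.card) :
    famDual E (Finset.powersetCard r E) = Finset.powersetCard (E.card - r) E := by
  ext S
  simp only [famDual, Finset.mem_image, Finset.mem_powersetCard]
  constructor
  · rintro ⟨B, ⟨hB, hc⟩, rfl⟩
    exact ⟨Finset.sdiff_subset, by rw [Finset.card_sdiff_of_subset hB, hc]⟩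
  · rintro ⟨hS, hc⟩
    refine ⟨E \ S, ⟨Finset.sdiff_subset, ?_⟩, Finset.sdiff_sdiff_eq_self hS⟩
    rw [Finset.card_sdiff_of_subset hS, hc]
    omega

lemma intActive_uniform (E : Finset ℕ) (r : ℕ) (B : Finset ℕ)
    (hB : B ∈ Finset.powersetCard r E) (i : ℕ) :
    IntActive E (Finset.powersetCard r E) B i ↔ i ∈ B ∧ ∀ x ∈ E \ B, i < x := by
  have hB' := Finset.mem_powersetCard.1 hB
  have hr : r ≤ E.card := hB'.2 ▸ Finset.card_le_card hB'.1
  have hD : E \ B ∈ Finset.powersetCard (E.card - r) E :=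
    Finset.mem_powersetCard.2 ⟨Finset.sdiff_subset, by
      rw [Finset.card_sdiff_of_subset hB'.1, hB'.2]⟩
  have key := extActive_uniform E (E.card - r) (E \ B) hD i
  unfold IntActive
  rw [famDual_uniform E r hr]
  unfold ExtActive at key
  constructor
  · rintro ⟨hi, h⟩
    exact ⟨hi, (key.1 ⟨hB'.1 hi, by simp [hi], h⟩).2.2⟩
  · rintro ⟨hi, h⟩
    exact ⟨hi, (key.2 ⟨hB'.1 hi, by simp [hi], h⟩).2.2⟩

lemma act_iff (n r : ℕ) (h1 : 1 ≤ r) (h2 : r ≤ n - 1) (B : Finset ℕ)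
    (hB : B ∈ Finset.powersetCard r (Finset.Icc 1 n)) :
    (extAct (Finset.Icc 1 n) (Finset.powersetCard r (Finset.Icc 1 n)) B = 1 ∧
      intAct (Finset.Icc 1 n) (Finset.powersetCard r (Finset.Icc 1 n)) B = 0) ↔
      1 ∉ B ∧ 2 ∈ B := by
  have hB' := Finset.mem_powersetCard.1 hB
  have hge : ∀ x ∈ B, 1 ≤ x := fun x hx => (Finset.mem_Icc.1 (hB'.1 hx)).1
  unfold extAct intAct
  rw [Finset.card_eq_zero, Finset.filter_eq_empty_iff, Finset.card_eq_one]
  simp only [intActive_uniform _ _ _ hB]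
  constructor
  · rintro ⟨⟨a, ha⟩, hint⟩
    have h1B : 1 ∉ B := by
      intro h
      refine hint (x := 1) (Finset.mem_Icc.2 (by omega)) ⟨h, ?_⟩
      intro x hx
      rw [Finset.mem_sdiff, Finset.mem_Icc] at hx
      have : x ≠ 1 := fun hh => hx.2 (hh ▸ h)
      omega
    refine ⟨h1B, ?_⟩
    by_contra h2B
    have hge3 : ∀ x ∈ B, 2 < x := by
      intro x hx
      have := hge x hx
      have : x ≠ 1 := fun hh => h1B (hh ▸ hx)
      have : x ≠ 2 := fun hh => h2B (hh ▸ hx)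
      omega
    have m1 : 1 ∈ ({a} : Finset ℕ) := by
      rw [← ha, Finset.mem_filter, extActive_uniform _ _ _ hB]
      refine ⟨Finset.mem_Icc.2 (by omega), Finset.mem_Icc.2 (by omega), h1B, ?_⟩
      intro x hx
      have := hge3 x hx
      omega
    have m2 : 2 ∈ ({a} : Finset ℕ) := by
      rw [← ha, Finset.mem_filter, extActive_uniform _ _ _ hB]
      exact ⟨Finset.mem_Icc.2 (by omega), Finset.mem_Icc.2 (by omega), h2B, hge3⟩
    rw [Finset.mem_singleton] at m1 m2
    omega
  · rintro ⟨h1B, h2B⟩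
    refine ⟨⟨1, ?_⟩, ?_⟩
    · ext x
      rw [Finset.mem_filter, extActive_uniform _ _ _ hB, Finset.mem_singleton]
      constructor
      · rintro ⟨hx, _, hxB, h⟩
        have := h 2 h2B
        have := (Finset.mem_Icc.1 hx).1
        omega
      · rintro rfl
        refine ⟨Finset.mem_Icc.2 (by omega), Finset.mem_Icc.2 (by omega), h1B, ?_⟩
        intro x hx
        have := hge x hx
        have : x ≠ 1 := fun hh => h1B (hh ▸ hx)
        omega
    · rintro x hx ⟨hxB, h⟩
      have := h 1 (by simp [h1B]; omega)
      have := hge x hxB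
      omega

/-- Number of `10` patterns of the indicator word of `S` on positions below `N`. -/
def wt (N : ℕ) (S : Finset ℕ) : ℕ := (S.filter fun i => i + 1 < N ∧ i + 1 ∉ S).card

/-- Weighted sum over `k`-subsets of `{a, …, a+m-1}`. -/
noncomputable def FF (a m k : ℕ) : Polynomial ℤ :=
  ∑ S ∈ Finset.powersetCard k (Finset.Ico a (a + m)), (1 + Polynomial.X) ^ wt (a + m) S

/-- The same with an extra zero at the end. -/
noncomputable def ZZ (a m k : ℕ) : Polynomial ℤ :=
  ∑ S ∈ Finset.powersetCard k (Finset.Ico a (a + m)), (1 + Polynomial.X) ^ wt (a + m + 1) S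

lemma sum_split_s12 (a m k : ℕ) (f : Finset ℕ → Polynomial ℤ) :
    ∑ S ∈ Finset.powersetCard (k + 1) (Finset.Ico a (a + (m + 1))), f S =
      ∑ S ∈ Finset.powersetCard (k + 1) (Finset.Ico a (a + m)), f S +
      ∑ S ∈ Finset.powersetCard k (Finset.Ico a (a + m)), f (insert (a + m) S) := by
  have hnot : ∀ j, ∀ S ∈ Finset.powersetCard j (Finset.Ico a (a + m)), a + m ∉ S := by
    intro j S hS h
    have := Finset.mem_Ico.1 ((Finset.mem_powersetCard.1 hS).1 h)
    omega
  have hI : Finset.Ico a (a + (m + 1)) = insert (a + m) (Finset.Ico a (a + m)) := by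
    ext x; simp only [Finset.mem_Ico, Finset.mem_insert]; omega
  rw [hI, Finset.powersetCard_succ_insert (by simp), Finset.sum_union, Finset.sum_image]
  · intro S hS T hT h
    have := congrArg (fun U => Finset.erase U (a + m)) h
    simpa [Finset.erase_insert (hnot k S hS), Finset.erase_insert (hnot k T hT)] using this
  · rw [Finset.disjoint_left]
    intro S hS hS'
    obtain ⟨T, _, rfl⟩ := Finset.mem_image.1 hS'
    exact hnot _ _ hS (Finset.mem_insert_self _ _)

lemma wt_insert (N : ℕ) (S : Finset ℕ) (hS : ∀ x ∈ S, x < N) :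
    wt (N + 1) (insert N S) = wt N S := by
  unfold wt
  congr 1
  ext i
  simp only [Finset.mem_filter, Finset.mem_insert]
  constructor
  · rintro ⟨h | h, h2, h3⟩
    · omega
    · push Not at h3
      exact ⟨h, by omega, h3.2⟩
  · rintro ⟨h, h2, h3⟩
    exact ⟨Or.inr h, by omega, by push Not; exact ⟨by omega, h3⟩⟩

lemma wt_insert' (N : ℕ) (S : Finset ℕ) (hS : ∀ x ∈ S, x < N) :
    wt (N + 2) (insert N S) = wt N S + 1 := by
  have : ((insert N S).filter fun i => i + 1 < N + 2 ∧ i + 1 ∉ insert N S) =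
      insert N (S.filter fun i => i + 1 < N ∧ i + 1 ∉ S) := by
    ext i
    simp only [Finset.mem_filter, Finset.mem_insert]
    constructor
    · rintro ⟨h | h, h2, h3⟩
      · exact Or.inl h
      · push Not at h3
        have := hS i h
        exact Or.inr ⟨h, by omega, h3.2⟩
    · rintro (h | ⟨h, h2, h3⟩)
      · subst h
        refine ⟨Or.inl rfl, by omega, ?_⟩
        push Not
        exact ⟨by omega, fun h => by have := hS _ h; omega⟩
      · exact ⟨Or.inr h, by omega, by push Not; exact ⟨by omega, h3⟩⟩
  unfold wt
  rw [this, Finset.card_insert_of_notMem]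
  intro h
  have := hS _ (Finset.mem_filter.1 h).1
  omega

lemma wt_big (N : ℕ) (S : Finset ℕ) (hS : ∀ x ∈ S, x < N) : wt (N + 2) S = wt (N + 1) S := by
  unfold wt
  congr 1
  ext i
  simp only [Finset.mem_filter]
  constructor
  · rintro ⟨h, h2, h3⟩
    have := hS i h
    exact ⟨h, by omega, h3⟩
  · rintro ⟨h, h2, h3⟩
    exact ⟨h, by omega, h3⟩

lemma lt_of_mem {a m k : ℕ} {S : Finset ℕ}
    (hS : S ∈ Finset.powersetCard k (Finset.Ico a (a + m))) : ∀ x ∈ S, x < a + m :=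
  fun _ hx => (Finset.mem_Ico.1 ((Finset.mem_powersetCard.1 hS).1 hx)).2

lemma FF_succ (a m k : ℕ) : FF a (m + 1) (k + 1) = ZZ a m (k + 1) + FF a m k := by
  unfold FF ZZ
  rw [sum_split_s12]
  refine congrArg₂ _ rfl (Finset.sum_congr rfl fun S hS => ?_)
  rw [← add_assoc, wt_insert _ _ (lt_of_mem hS)]

lemma ZZ_succ (a m k : ℕ) :
    ZZ a (m + 1) (k + 1) = ZZ a m (k + 1) + (1 + Polynomial.X) * FF a m k := by
  unfold FF ZZ
  rw [sum_split_s12, Finset.mul_sum]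
  refine congrArg₂ _ (Finset.sum_congr rfl fun S hS => ?_) (Finset.sum_congr rfl fun S hS => ?_)
  · rw [← wt_big _ _ (lt_of_mem hS)]; rfl
  · rw [← pow_succ', ← wt_insert' _ _ (lt_of_mem hS)]; rfl

lemma FF_rec (a m k : ℕ) : FF a (m + 2) (k + 1) =
    FF a (m + 1) k + FF a (m + 1) (k + 1) + Polynomial.X * FF a m k := by
  rw [FF_succ a (m + 1) k, ZZ_succ, FF_succ a m k]
  ring

lemma FF_zero (a m : ℕ) : FF a m 0 = 1 := by
  simp [FF, wt]

lemma FF_zero' (a k : ℕ) : FF a 0 (k + 1) = 0 := by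
  simp [FF, Finset.powersetCard_eq_empty.2 (show (∅ : Finset ℕ).card < k + 1 by simp)]

lemma FF_one (a k : ℕ) : FF a 1 (k + 1) = FF a 0 k := by
  have := FF_succ a 0 k
  simp only [zero_add] at this
  rw [this]
  simp [ZZ, Finset.powersetCard_eq_empty.2 (show (∅ : Finset ℕ).card < k + 1 by simp)]

/-- The closed form coefficients. -/
def cc (m k i : ℕ) : ℕ :=
  if i ≤ k ∧ 2 * i ≤ m then (m - i).choose i * (m - 2 * i).choose (k - i) else 0

lemma cc_zero_i (m k : ℕ) : cc m k 0 = m.choose k := by simp [cc]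

lemma cc_rec (m k i : ℕ) :
    cc (m + 2) (k + 1) (i + 1) = cc (m + 1) k (i + 1) + cc (m + 1) (k + 1) (i + 1) + cc m k i := by
  unfold cc
  by_cases hk : i ≤ k
  swap
  · simp only [show ¬ (i + 1 ≤ k + 1) by omega, show ¬ (i + 1 ≤ k) by omega, hk]; simp
  by_cases hm : 2 * i ≤ m
  swap
  · simp only [show ¬ (2 * (i + 1) ≤ m + 2) by omega, show ¬ (2 * (i + 1) ≤ m + 1) by omega, hm]
    simp
  obtain ⟨d, rfl⟩ := Nat.exists_eq_add_of_le hm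
  obtain ⟨l, rfl⟩ := Nat.exists_eq_add_of_le hk
  rw [if_pos (show i + 1 ≤ i + l + 1 ∧ 2 * (i + 1) ≤ 2 * i + d + 2 by omega),
    if_pos (show i ≤ i + l ∧ 2 * i ≤ 2 * i + d by omega)]
  rw [show 2 * i + d + 2 - (i + 1) = i + d + 1 by omega,
    show 2 * i + d + 2 - 2 * (i + 1) = d by omega, show i + l + 1 - (i + 1) = l by omega,
    show 2 * i + d - i = i + d by omega, show 2 * i + d - 2 * i = d by omega,
    show i + l - i = l by omega, Nat.choose_succ_succ]
  rcases d with _ | d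
  · rw [if_neg (by omega), if_neg (by omega)]
    simp
  · rw [if_pos (show i + 1 ≤ i + l + 1 ∧ 2 * (i + 1) ≤ 2 * i + (d + 1) + 1 by omega)]
    rw [show 2 * i + (d + 1) + 1 - (i + 1) = i + (d + 1) by omega,
      show 2 * i + (d + 1) + 1 - 2 * (i + 1) = d by omega]
    rcases l with _ | l
    · rw [if_neg (by omega)]
      simp; ring
    · rw [if_pos (by omega), show i + (l + 1) - (i + 1) = l by omega, Nat.choose_succ_succ d l]
      simp only [Nat.succ_eq_add_one]; ring

lemma cc_k0 (m i : ℕ) : cc m 0 i = if i = 0 then 1 else 0 := by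
  rcases i with _ | i <;> simp [cc]

lemma FF_coeff (a : ℕ) : ∀ m k i : ℕ, (FF a m k).coeff i = cc m k i
  | m, 0, i => by
    rw [FF_zero, cc_k0, Polynomial.coeff_one]; push_cast; rfl
  | 0, k + 1, i => by
    rw [FF_zero']
    rcases i with _ | i <;> simp [cc]
  | 1, k + 1, i => by
    rw [FF_one, FF_coeff a 0 k i]
    rcases i with _ | i
    · rcases k with _ | k
      · simp [cc]
      · simp [cc, Nat.choose_eq_zero_of_lt (show 1 < k + 1 + 1 by omega)]
    · simp [cc, show ¬ (2 * (i + 1) ≤ 1) by omega]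
  | m + 2, k + 1, i => by
    rw [FF_rec, Polynomial.coeff_add, Polynomial.coeff_add, FF_coeff a (m + 1) k i,
      FF_coeff a (m + 1) (k + 1) i]
    rcases i with _ | i
    · simp only [cc_zero_i, Polynomial.coeff_X_mul_zero, add_zero]
      rw [Nat.choose_succ_succ (m + 1) k]
      push_cast; rfl
    · rw [Polynomial.coeff_X_mul, FF_coeff a m k i, cc_rec]
      push_cast; rfl

lemma insert_two_mem (m k : ℕ) (S : Finset ℕ)
    (hS : S ∈ Finset.powersetCard k (Finset.Ico 3 (3 + m))) :
    insert 2 S ∈ Finset.powersetCard (k + 1) (Finset.Icc 1 (m + 2)) ∧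
      1 ∉ insert 2 S ∧ 2 ∈ insert 2 S ∧ 2 ∉ S := by
  obtain ⟨hs, hc⟩ := Finset.mem_powersetCard.1 hS
  have hb : ∀ x ∈ S, 3 ≤ x ∧ x < 3 + m := fun x hx => Finset.mem_Ico.1 (hs hx)
  have h2 : 2 ∉ S := fun h => by have := hb 2 h; omega
  refine ⟨Finset.mem_powersetCard.2 ⟨?_, by rw [Finset.card_insert_of_notMem h2, hc]⟩, ?_,
    Finset.mem_insert_self _ _, h2⟩
  · intro x hx
    rw [Finset.mem_Icc]
    rcases Finset.mem_insert.1 hx with rfl | hx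
    · omega
    · have := hb x hx; omega
  · intro h
    rcases Finset.mem_insert.1 h with h | h
    · omega
    · have := hb 1 h; omega

lemma alpha_eq (m k : ℕ) (hk : k ≤ m) (S : Finset ℕ)
    (hS : S ∈ Finset.powersetCard k (Finset.Ico 3 (3 + m))) :
    alphaStat (Finset.Icc 1 (m + 2)) (Finset.powersetCard (k + 1) (Finset.Icc 1 (m + 2)))
      (insert 2 S) = wt (3 + m) S := by
  obtain ⟨hB, h1B, h2B, h2S⟩ := insert_two_mem m k S hS
  obtain ⟨hs, hc⟩ := Finset.mem_powersetCard.1 hS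
  obtain ⟨hBs, hBc⟩ := Finset.mem_powersetCard.1 hB
  have hb : ∀ x ∈ S, 3 ≤ x ∧ x < 3 + m := fun x hx => Finset.mem_Ico.1 (hs hx)
  obtain ⟨he, hi⟩ := (act_iff (m + 2) (k + 1) (by omega) (by omega) _ hB).2 ⟨h1B, h2B⟩
  unfold alphaStat wt
  rw [he, hi]
  congr 1
  ext i
  simp only [Finset.mem_filter]
  constructor
  · rintro ⟨hiB, hB', hact⟩
    obtain ⟨_, h2'⟩ := (act_iff (m + 2) (k + 1) (by omega) (by omega) _ hB').1 hact
    have hi2 : i ≠ 2 := by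
      rintro rfl
      simp at h2'
    have hiS : i ∈ S := (Finset.mem_insert.1 hiB).resolve_left hi2
    obtain ⟨hs', hc'⟩ := Finset.mem_powersetCard.1 hB'
    have hlt := (Finset.mem_Icc.1 (hs' (Finset.mem_insert_self _ _))).2
    refine ⟨hiS, by omega, ?_⟩
    intro hmem
    rw [Finset.insert_eq_of_mem (Finset.mem_erase.2 ⟨by omega, Finset.mem_insert_of_mem hmem⟩),
      Finset.card_erase_of_mem hiB] at hc'
    omega
  · rintro ⟨hiS, hlt, hni⟩
    have hi3 := hb i hiS
    have hiB : i ∈ insert 2 S := Finset.mem_insert_of_mem hiS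
    have hniB : i + 1 ∉ insert 2 S := by
      intro h
      rcases Finset.mem_insert.1 h with h | h
      · omega
      · exact hni h
    have hB' : insert (i + 1) ((insert 2 S).erase i) ∈
        Finset.powersetCard (k + 1) (Finset.Icc 1 (m + 2)) := by
      refine Finset.mem_powersetCard.2 ⟨Finset.insert_subset (Finset.mem_Icc.2 (by omega))
        ((Finset.erase_subset _ _).trans hBs), ?_⟩
      rw [Finset.card_insert_of_notMem (fun h => hniB (Finset.mem_of_mem_erase h)),
        Finset.card_erase_of_mem hiB]
      omega
    refine ⟨hiB, hB', (act_iff (m + 2) (k + 1) (by omega) (by omega) _ hB').2 ⟨?_, ?_⟩⟩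
    · intro h
      rcases Finset.mem_insert.1 h with h | h
      · omega
      · exact h1B (Finset.mem_of_mem_erase h)
    · exact Finset.mem_insert_of_mem (Finset.mem_erase.2 ⟨by omega, h2B⟩)

lemma main_sum (m k : ℕ) (hk : k ≤ m) :
    ∑ B ∈ (Finset.powersetCard (k + 1) (Finset.Icc 1 (m + 2))).filter (fun B =>
        extAct (Finset.Icc 1 (m + 2)) (Finset.powersetCard (k + 1) (Finset.Icc 1 (m + 2))) B = 1 ∧
        intAct (Finset.Icc 1 (m + 2)) (Finset.powersetCard (k + 1) (Finset.Icc 1 (m + 2))) B = 0),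
      ((1 + Polynomial.X) ^
          alphaStat (Finset.Icc 1 (m + 2)) (Finset.powersetCard (k + 1) (Finset.Icc 1 (m + 2))) B
        : Polynomial ℤ) = FF 3 m k := by
  unfold FF
  symm
  refine Finset.sum_bij (fun S _ => insert 2 S) ?_ ?_ ?_ ?_
  · intro S hS
    obtain ⟨hB, h1B, h2B, _⟩ := insert_two_mem m k S hS
    exact Finset.mem_filter.2 ⟨hB, (act_iff _ _ (by omega) (by omega) _ hB).2 ⟨h1B, h2B⟩⟩
  · intro S hS T hT h
    have h2S := (insert_two_mem m k S hS).2.2.2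
    have h2T := (insert_two_mem m k T hT).2.2.2
    rw [← Finset.erase_insert h2S, ← Finset.erase_insert h2T, h]
  · intro B hB
    obtain ⟨hB, hact⟩ := Finset.mem_filter.1 hB
    obtain ⟨h1B, h2B⟩ := (act_iff _ _ (by omega) (by omega) _ hB).1 hact
    obtain ⟨hs, hc⟩ := Finset.mem_powersetCard.1 hB
    refine ⟨B.erase 2, Finset.mem_powersetCard.2 ⟨?_, ?_⟩, Finset.insert_erase h2B⟩
    · intro x hx
      obtain ⟨hx2, hxB⟩ := Finset.mem_erase.1 hx
      have := Finset.mem_Icc.1 (hs hxB)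
      have : x ≠ 1 := fun h => h1B (h ▸ hxB)
      rw [Finset.mem_Ico]
      omega
    · rw [Finset.card_erase_of_mem h2B]; omega
  · intro S hS
    rw [alpha_eq m k hk S hS]

/-- For `1 ≤ r ≤ n−1` and the uniform matroid
`U_{r,n} = SM({1,…,r})` on `[n]`, in `ℤ[t]`:
`Σ_{B basis, e(B)=1, i(B)=0} (1+t)^{α(B)}
  = Σ_{i=0}^{min(r−1, n−r−1)} C(n−2−i, i) C(n−2−2i, r−1−i) t^i`. -/
theorem statement12 (n r : ℕ) (h1 : 1 ≤ r) (h2 : r ≤ n - 1) :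
    ∑ B ∈ (schubertBases n r (Finset.Icc 1 r)).filter (fun B =>
        extAct (Finset.Icc 1 n) (schubertBases n r (Finset.Icc 1 r)) B = 1 ∧
        intAct (Finset.Icc 1 n) (schubertBases n r (Finset.Icc 1 r)) B = 0),
      ((1 + Polynomial.X) ^
          alphaStat (Finset.Icc 1 n) (schubertBases n r (Finset.Icc 1 r)) B
        : Polynomial ℤ)
      = ∑ i ∈ Finset.range (min (r - 1) (n - r - 1) + 1),
          (Nat.choose (n - 2 - i) i * Nat.choose (n - 2 - 2 * i) (r - 1 - i) : ℤ) •
            (Polynomial.X : Polynomial ℤ) ^ i := by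
  obtain ⟨k, rfl⟩ : ∃ k, r = k + 1 := ⟨r - 1, by omega⟩
  obtain ⟨m, rfl⟩ : ∃ m, n = m + 2 := ⟨n - 2, by omega⟩
  have hk : k ≤ m := by omega
  rw [schubert_uniform]
  refine Eq.trans ?_ ((main_sum m k hk).trans ?_)
  · congr
  ext j
  rw [FF_coeff, Polynomial.finsetSum_coeff]
  simp only [Polynomial.coeff_smul, Polynomial.coeff_X_pow, smul_eq_mul, mul_ite, mul_one,
    mul_zero, Finset.sum_ite_eq, Finset.mem_range]
  simp only [show m + 2 - 2 = m by omega, show k + 1 - 1 = k by omega,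
    show m + 2 - (k + 1) - 1 = m - k by omega]
  unfold cc
  by_cases h : j < min k (m - k) + 1
  · rw [if_pos h, if_pos (by omega)]
    push_cast; rfl
  · rw [if_neg h]
    split_ifs with h'
    · rw [Nat.choose_eq_zero_of_lt (show m - 2 * j < k - j by omega)]
      simp
    · simp
end GPoly
end
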